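/- For every real λ, the family 𝒢(λ) of signed graphs with smallest eigenvalue at least -λ has a finite forbidden subgraph characterization within the class of all signed graphs if and only if λ < λ*. -/

import Mathlib

/-- A (candidate) signed graph: a natural number `n` together with a real `n × n` matrix. -/
abbrev SG : Type := Σ n : ℕ, Matrix (Fin n) (Fin n) ℝ

/-- `G` is a signed graph: its matrix is symmetric, with zero diagonal and
off-diagonal entries in `{-1, 0, 1}`. -/
def IsSignedGraph (G : SG) : Prop :=
  G.2.IsSymm ∧ (∀ i, G.2 i i = 0) ∧
    ∀ i j, i ≠ j → G.2 i j = -1 ∨ G.2 i j = 0 ∨ G.2 i j = 1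

/-- A signed graph is `p`-colorable if there is a coloring of the vertices by `p` colors
such that endpoints of negative edges get identical colors and endpoints of positive
edges get different colors. -/
def SGColorable (p : ℕ) (G : SG) : Prop :=
  ∃ c : Fin G.1 → Fin p, ∀ u v, (G.2 u v = -1 → c u = c v) ∧ (G.2 u v = 1 → c u ≠ c v)

/-- `B` is an induced subgraph of `A`. -/
def SGInduced (B A : SG) : Prop :=
  ∃ f : Fin B.1 → Fin A.1, Function.Injective f ∧ ∀ u v, B.2 u v = A.2 (f u) (f v)

/-- The smallest eigenvalue of a signed graph. -/
noncomputable def sgLam1 (G : SG) : ℝ :=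
  sInf {t : ℝ | ∃ x : Fin G.1 → ℝ, x ≠ 0 ∧ G.2.mulVec x = t • x}

/-- `ℋ` has a finite forbidden subgraph characterization within the class `𝒢`:
there is a finite set `ℱ ⊆ 𝒢` such that `ℋ` consists exactly of the members of `𝒢`
containing no member of `ℱ` as an induced subgraph. -/
def HasFFSC (𝒢 ℋ : Set SG) : Prop :=
  ∃ ℱ : Set SG, ℱ.Finite ∧ ℱ ⊆ 𝒢 ∧ ∀ G ∈ 𝒢, (G ∈ ℋ ↔ ∀ F ∈ ℱ, ¬ SGInduced F G)

/-- The class `𝒢_p` of `p`-colorable signed graphs. -/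
def classGp (p : ℕ) : Set SG := {G | IsSignedGraph G ∧ SGColorable p G}

/-- The family `𝒢_p(λ)` of `p`-colorable signed graphs with smallest eigenvalue at
least `-λ`. -/
def classGpLam (p : ℕ) (lam : ℝ) : Set SG := {G ∈ classGp p | -lam ≤ sgLam1 G}

/-- The quadratic form `lam * |x|² + xᵀ A x` of an integer matrix `A`. -/
noncomputable def qform {V : Type*} [Fintype V] (A : V → V → ℤ) (lam : ℝ) (x : V → ℝ) : ℝ :=
  lam * ∑ i, x i ^ 2 + ∑ i, ∑ j, (A i j : ℝ) * x i * x j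

/-- The integer version of `IsSignedGraph` on an arbitrary vertex type. -/
structure IsSignedMat {V : Type*} (A : V → V → ℤ) : Prop where
  symm : ∀ i j, A i j = A j i
  diag : ∀ i, A i i = 0
  lower : ∀ i j, -1 ≤ A i j
  upper : ∀ i j, A i j ≤ 1

/-- The smallest eigenvalue of a suitable signed graph lies in `[-lam - ε, -lam)`, for
every `ε > 0`. -/
def RightLimit (lam : ℝ) : Prop :=
  ∀ ε > 0, ∃ (V : Type) (_ : Fintype V) (A : V → V → ℤ), IsSignedMat A ∧
    (∃ x, qform A lam x < 0) ∧ ∀ x, -(ε * ∑ i, x i ^ 2) ≤ qform A lam x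

/-- The symmetric block matrix with diagonal blocks `A`, `D` and off-diagonal block `B`. -/
def glue {V W : Type*} (A : V → V → ℤ) (B : V → W → ℤ) (D : W → W → ℤ) : V ⊕ W → V ⊕ W → ℤ
  | .inl u, .inl v => A u v
  | .inl u, .inr v => B u v
  | .inr u, .inl v => B v u
  | .inr u, .inr v => D u v

theorem IsSignedMat.glue {V W : Type*} {A : V → V → ℤ} {B : V → W → ℤ} {D : W → W → ℤ}
    (hA : IsSignedMat A) (hD : IsSignedMat D) (hl : ∀ u v, -1 ≤ B u v) (hu : ∀ u v, B u v ≤ 1) :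
    IsSignedMat (glue A B D) := by
  constructor
  · rintro (u | u) (v | v)
    exacts [hA.symm u v, rfl, rfl, hD.symm u v]
  · rintro (u | u)
    exacts [hA.diag u, hD.diag u]
  · rintro (u | u) (v | v)
    exacts [hA.lower u v, hl u v, hl v u, hD.lower u v]
  · rintro (u | u) (v | v)
    exacts [hA.upper u v, hu u v, hu v u, hD.upper u v]

theorem isSignedMat_zero {V : Type*} : IsSignedMat (fun _ _ : V => (0 : ℤ)) := by
  constructor <;> simp

theorem qform_zero {V : Type*} [Fintype V] (lam : ℝ) (x : V → ℝ) :
    qform (fun _ _ => 0) lam x = lam * ∑ i, x i ^ 2 := by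
  simp [qform]

theorem qform_glue {V W : Type*} [Fintype V] [Fintype W] (A : V → V → ℤ) (B : V → W → ℤ)
    (D : W → W → ℤ) (lam : ℝ) (x : V ⊕ W → ℝ) :
    qform (glue A B D) lam x = qform A lam (fun v => x (.inl v)) +
      qform D lam (fun v => x (.inr v)) + 2 * ∑ u, ∑ v, (B u v : ℝ) * x (.inl u) * x (.inr v) := by
  have hc : ∑ v, ∑ u, (B u v : ℝ) * x (.inr v) * x (.inl u) =
      ∑ u, ∑ v, (B u v : ℝ) * x (.inl u) * x (.inr v) := by
    rw [Finset.sum_comm]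
    exact Finset.sum_congr rfl fun u _ => Finset.sum_congr rfl fun v _ => by ring
  simp only [qform, Fintype.sum_sum_type, glue, Finset.sum_add_distrib, hc]
  ring

theorem qform_add_lam {V : Type*} [Fintype V] (A : V → V → ℤ) (lam t : ℝ) (x : V → ℝ) :
    qform A (lam + t) x = qform A lam x + t * ∑ i, x i ^ 2 := by
  simp only [qform]
  ring

theorem qform_pendant {V : Type*} [Fintype V] [DecidableEq V] (A : V → V → ℤ) (j : ℕ)
    {lam : ℝ} (hlam : lam ≠ 0) (x : V ⊕ V × Fin j → ℝ) :
    qform (glue A (fun u p => if u = p.1 then 1 else 0) (fun _ _ => 0)) lam x =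
      qform A (lam - j / lam) (fun v => x (.inl v)) +
      lam * ∑ v, ∑ m, (x (.inr (v, m)) + x (.inl v) / lam) ^ 2 := by
  have h1 : ∀ u, ∑ p : V × Fin j, (((if u = p.1 then 1 else 0 : ℤ)) : ℝ) * x (.inl u) * x (.inr p) =
      ∑ m, x (.inl u) * x (.inr (u, m)) := by
    intro u
    rw [Fintype.sum_prod_type, Finset.sum_eq_single u]
    · simp
    · intro b _ hb
      simp [Ne.symm hb]
    · simp
  rw [qform_glue, qform_zero, sub_eq_add_neg, qform_add_lam]
  simp only [h1, Fintype.sum_prod_type, Finset.mul_sum, add_assoc]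
  congr 1
  simp only [← Finset.sum_add_distrib]
  refine Finset.sum_congr rfl fun v _ => ?_
  have : -((j : ℝ) / lam) * x (.inl v) ^ 2 = ∑ _m : Fin j, -(1 / lam) * x (.inl v) ^ 2 := by
    simp
    ring
  rw [this]
  simp only [← Finset.sum_add_distrib]
  refine Finset.sum_congr rfl fun m _ => ?_
  field_simp
  ring

theorem RightLimit.of_pendant {lam : ℝ} (hlam : 0 < lam) (j : ℕ)
    (h : RightLimit (lam - j / lam)) : RightLimit lam := by
  classical
  intro ε hε
  obtain ⟨V, _, A, hA, ⟨x, hx⟩, hq⟩ := h ε hε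
  refine ⟨V ⊕ V × Fin j, inferInstance, glue A (fun u p => if u = p.1 then 1 else 0)
    (fun _ _ => 0), hA.glue isSignedMat_zero ?_ ?_, ⟨Sum.elim x fun p => -(x p.1 / lam), ?_⟩, ?_⟩
  · intro u v
    split_ifs <;> norm_num
  · intro u v
    split_ifs <;> norm_num
  · rw [qform_pendant A j hlam.ne']
    simpa using hx
  · intro y
    rw [qform_pendant A j hlam.ne']
    have h1 := hq fun v => y (.inl v)
    have h2 : 0 ≤ lam * ∑ v, ∑ m, (y (.inr (v, m)) + y (.inl v) / lam) ^ 2 := by positivity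
    have h3 : ε * ∑ i, y (.inl i) ^ 2 ≤ ε * ∑ i, y i ^ 2 := by
      gcongr
      rw [Fintype.sum_sum_type]
      have : 0 ≤ ∑ p, y (.inr p) ^ 2 := by positivity
      linarith
    linarith

/-- Some gadget, attached to a vertex `z`, has the effect of replacing the term `z²` by
`c z²` after minimising over the gadget. -/
def Achieves (lam c : ℝ) : Prop :=
  ∃ (V : Type) (_ : Fintype V) (A : V → V → ℤ) (w : V → ℤ), IsSignedMat A ∧
    (∀ v, -1 ≤ w v) ∧ (∀ v, w v ≤ 1) ∧
    (∀ x z, c * z ^ 2 ≤ qform A lam x + 2 * z * ∑ v, (w v : ℝ) * x v + z ^ 2) ∧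
    ∀ z, ∃ x, c * z ^ 2 = qform A lam x + 2 * z * ∑ v, (w v : ℝ) * x v + z ^ 2

theorem achieves_one (lam : ℝ) : Achieves lam 1 :=
  ⟨Empty, inferInstance, fun _ _ => 0, fun _ => 0, isSignedMat_zero, by simp, by simp,
    by simp [qform], fun z => ⟨0, by simp [qform]⟩⟩

theorem Achieves.pendant {lam c : ℝ} (hl : 1 < lam) (hc : 0 < c) (h : Achieves lam c) :
    Achieves lam (1 / (1 / c + 1 / (lam - 1))) := by
  obtain ⟨V, _, A, w, hA, hw1, hw2, hq, hq'⟩ := h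
  have hform : ∀ (x : Unit ⊕ V → ℝ) z, qform (glue (fun _ _ => 0) (fun _ : Unit => w) A) lam x +
      2 * z * ∑ v, (Sum.elim (fun _ => 1) w v : ℤ) * x v + z ^ 2 =
      (qform A lam (fun v => x (.inr v)) + 2 * (x (.inl ()) + z) * ∑ v, (w v : ℝ) * x (.inr v) +
      (x (.inl ()) + z) ^ 2) + (lam - 1) * x (.inl ()) ^ 2 := by
    intro x z
    have : ∑ v, (w v : ℝ) * x (.inl ()) * x (.inr v) =
        x (.inl ()) * ∑ v, (w v : ℝ) * x (.inr v) := by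
      rw [Finset.mul_sum]
      exact Finset.sum_congr rfl fun v _ => by ring
    simp [qform_glue, qform_zero, this]
    ring
  have hl' : 0 < lam - 1 := by linarith
  refine ⟨Unit ⊕ V, inferInstance, _, Sum.elim (fun _ => 1) w,
    isSignedMat_zero.glue hA (fun _ => hw1) (fun _ => hw2), ?_, ?_, ?_, ?_⟩
  · rintro (_ | v)
    exacts [by simp, hw1 v]
  · rintro (_ | v)
    exacts [by simp, hw2 v]
  · intro x z
    rw [hform]
    refine le_trans ?_ (add_le_add_left (hq _ _) _)
    have : c * (x (.inl ()) + z) ^ 2 + (lam - 1) * x (.inl ()) ^ 2 -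
        1 / (1 / c + 1 / (lam - 1)) * z ^ 2 =
        (c + (lam - 1)) * (x (.inl ()) + c / (c + (lam - 1)) * z) ^ 2 := by
      field_simp
      ring
    have h2 : 0 ≤ (c + (lam - 1)) * (x (.inl ()) + c / (c + (lam - 1)) * z) ^ 2 := by positivity
    linarith
  · intro z
    obtain ⟨x, hx⟩ := hq' (-(c / (c + (lam - 1)) * z) + z)
    refine ⟨Sum.elim (fun _ => -(c / (c + (lam - 1)) * z)) x, ?_⟩
    rw [hform]
    simp only [Sum.elim_inl, Sum.elim_inr, ← hx]
    field_simp
    ring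

theorem Achieves.extend {lam c : ℝ} (hl : 2 < lam) (hc : 0 < c) (h : Achieves lam c) :
    Achieves lam (1 / (1 + 1 / (c + (lam - 2)))) := by
  obtain ⟨V, _, A, w, hA, hw1, hw2, hq, hq'⟩ := h
  have hform : ∀ (x : Unit ⊕ V → ℝ) z, qform (glue (fun _ _ => 0) (fun _ : Unit => w) A) lam x +
      2 * z * ∑ v, (Sum.elim (fun _ => 1) (fun _ => 0) v : ℤ) * x v + z ^ 2 =
      (qform A lam (fun v => x (.inr v)) + 2 * x (.inl ()) * ∑ v, (w v : ℝ) * x (.inr v) +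
      x (.inl ()) ^ 2) + (lam - 2) * x (.inl ()) ^ 2 + (x (.inl ()) + z) ^ 2 := by
    intro x z
    have : ∑ v, (w v : ℝ) * x (.inl ()) * x (.inr v) =
        x (.inl ()) * ∑ v, (w v : ℝ) * x (.inr v) := by
      rw [Finset.mul_sum]
      exact Finset.sum_congr rfl fun v _ => by ring
    simp [qform_glue, qform_zero, this]
    ring
  have hl' : 0 < lam - 2 := by linarith
  refine ⟨Unit ⊕ V, inferInstance, _, Sum.elim (fun _ => 1) (fun _ => 0),
    isSignedMat_zero.glue hA (fun _ => hw1) (fun _ => hw2), ?_, ?_, ?_, ?_⟩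
  · rintro (_ | v) <;> simp
  · rintro (_ | v) <;> simp
  · intro x z
    rw [hform, add_assoc]
    refine le_trans ?_ (add_le_add_left (hq _ _) _)
    have : c * x (.inl ()) ^ 2 + ((lam - 2) * x (.inl ()) ^ 2 + (x (.inl ()) + z) ^ 2) -
        1 / (1 + 1 / (c + (lam - 2))) * z ^ 2 =
        (c + (lam - 2) + 1) * (x (.inl ()) + 1 / (c + (lam - 2) + 1) * z) ^ 2 := by
      field_simp
      ring
    have h2 : 0 ≤ (c + (lam - 2) + 1) * (x (.inl ()) + 1 / (c + (lam - 2) + 1) * z) ^ 2 := by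
      positivity
    linarith
  · intro z
    obtain ⟨x, hx⟩ := hq' (-(1 / (c + (lam - 2) + 1) * z))
    refine ⟨Sum.elim (fun _ => -(1 / (c + (lam - 2) + 1) * z)) x, ?_⟩
    rw [hform]
    simp only [Sum.elim_inl, Sum.elim_inr, ← hx]
    field_simp
    ring

/-- Joining two gadgets and `k` leaves at a vertex. -/
theorem RightLimit.of_achieves {lam : ℝ} (hl : 0 < lam) (k : ℕ)
    (h : ∀ ε > 0, ∃ c d, Achieves lam c ∧ Achieves lam d ∧ lam - 2 + c + d - k / lam < 0 ∧
      -ε < lam - 2 + c + d - k / lam) : RightLimit lam := by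
  intro ε hε
  obtain ⟨c, d, ⟨V, _, A, w, hA, hw1, hw2, hq, hq'⟩, ⟨V', _, A', w', hA', hw1', hw2', hr, hr'⟩,
    hneg, hgt⟩ := h ε hε
  have hform : ∀ x : Unit ⊕ ((V ⊕ V') ⊕ Fin k) → ℝ,
      qform (glue (fun _ _ => 0) (fun _ : Unit => Sum.elim (Sum.elim w w') (fun _ => 1))
        (glue (glue A (fun _ _ => 0) A') (fun _ _ => 0) (fun _ _ => 0))) lam x =
      (qform A lam (fun v => x (.inr (.inl (.inl v)))) +
        2 * x (.inl ()) * ∑ v, (w v : ℝ) * x (.inr (.inl (.inl v))) + x (.inl ()) ^ 2) +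
      (qform A' lam (fun v => x (.inr (.inl (.inr v)))) +
        2 * x (.inl ()) * ∑ v, (w' v : ℝ) * x (.inr (.inl (.inr v))) + x (.inl ()) ^ 2) +
      lam * ∑ m, (x (.inr (.inr m)) + x (.inl ()) / lam) ^ 2 +
      (lam - 2 - k / lam) * x (.inl ()) ^ 2 := by
    intro x
    have e : ∀ (U : Type) [Fintype U] (w : U → ℤ) (y : U → ℝ), ∑ v, (w v : ℝ) * x (.inl ()) * y v =
        x (.inl ()) * ∑ v, (w v : ℝ) * y v := by
      intro U _ w y
      rw [Finset.mul_sum]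
      exact Finset.sum_congr rfl fun v _ => by ring
    have e2 : lam * ∑ m, (x (.inr (.inr m)) + x (.inl ()) / lam) ^ 2 =
        lam * ∑ m, x (.inr (.inr m)) ^ 2 + 2 * x (.inl ()) * ∑ m, x (.inr (.inr m)) +
        k / lam * x (.inl ()) ^ 2 := by
      have : ((k : ℝ) / lam) * x (.inl ()) ^ 2 = ∑ _m : Fin k, (1 / lam) * x (.inl ()) ^ 2 := by
        simp
        ring
      rw [this]
      simp only [Finset.mul_sum, ← Finset.sum_add_distrib]
      refine Finset.sum_congr rfl fun m _ => ?_
      field_simp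
      ring
    rw [e2]
    simp [qform_glue, qform_zero, e]
    ring
  have hsm : IsSignedMat (glue (fun _ _ => 0)
      (fun _ : Unit => Sum.elim (Sum.elim w w') (fun _ : Fin k => 1))
      (glue (glue A (fun _ _ => 0) A') (fun _ _ => 0) (fun _ _ => 0))) := by
    refine isSignedMat_zero.glue ((hA.glue hA' ?_ ?_).glue isSignedMat_zero ?_ ?_) ?_ ?_
    · simp
    · simp
    · simp
    · simp
    · rintro _ ((v | v) | v)
      exacts [hw1 v, hw1' v, by simp]
    · rintro _ ((v | v) | v)
      exacts [hw2 v, hw2' v, by simp]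
  refine ⟨Unit ⊕ ((V ⊕ V') ⊕ Fin k), inferInstance, _, hsm, ?_, ?_⟩
  · obtain ⟨x, hx⟩ := hq' 1
    obtain ⟨y, hy⟩ := hr' 1
    refine ⟨Sum.elim (fun _ => 1) (Sum.elim (Sum.elim x y) fun _ => -(1 / lam)), ?_⟩
    rw [hform]
    simp only [Sum.elim_inl, Sum.elim_inr, ← hx, ← hy]
    simp
    linarith
  · intro x
    rw [hform]
    have h1 := hq (fun v => x (.inr (.inl (.inl v)))) (x (.inl ()))
    have h2 := hr (fun v => x (.inr (.inl (.inr v)))) (x (.inl ()))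
    have h3 : 0 ≤ lam * ∑ m, (x (.inr (.inr m)) + x (.inl ()) / lam) ^ 2 := by positivity
    have h4 : x (.inl ()) ^ 2 ≤ ∑ i, x i ^ 2 :=
      Finset.single_le_sum (f := fun i => x i ^ 2) (fun i _ => sq_nonneg _) (Finset.mem_univ _)
    nlinarith [mul_nonneg (by linarith : 0 ≤ lam - 2 + c + d - k / lam + ε)
      (sq_nonneg (x (.inl ())))]

theorem Achieves.add_pendants {lam y : ℝ} (hl : 1 < lam) (hy : 0 < y) (h : Achieves lam (1 / y))
    (k : ℕ) : Achieves lam (1 / (y + k * (1 / (lam - 1)))) := by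
  have ha : 0 < 1 / (lam - 1) := one_div_pos.2 (by linarith)
  induction k with
  | zero => simpa using h
  | succ k ih =>
    have := Achieves.pendant hl (by positivity) ih
    rw [one_div_one_div] at this
    convert this using 2
    push_cast
    ring

theorem Achieves.extend_inv {δ y : ℝ} (hδ : 0 < δ) (hy : 0 < y) (h : Achieves (2 + δ) (1 / y)) :
    Achieves (2 + δ) (1 / (1 + y / (1 + δ * y))) := by
  have := Achieves.extend (by linarith) (by positivity) h
  convert this using 3
  rw [add_sub_cancel_left]
  field_simp

theorem exists_nat_sub_mem {T b a : ℝ} (ha : 0 < a) (h : b ≤ T) :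
    ∃ k : ℕ, b ≤ T - k * a ∧ T - k * a < b + a := by
  refine ⟨⌊(T - b) / a⌋₊, ?_, ?_⟩
  · have := Nat.floor_le (div_nonneg (sub_nonneg.2 h) ha.le)
    rw [le_div_iff₀ ha] at this
    linarith
  · have := Nat.lt_floor_add_one ((T - b) / a)
    rw [div_lt_iff₀ ha] at this
    linarith

/-- Above the fixed point `u` of the extension map, the reciprocals of the achievable
constants are dense. -/
theorem achieves_approx {δ u : ℝ} (hδ : 0 < δ) (hδ' : δ < 0.53) (hu : 0 < u)
    (hfix : δ * u ^ 2 - δ * u - 1 = 0) (n : ℕ) : ∀ T ≥ u, ∃ y > 0, Achieves (2 + δ) (1 / y) ∧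
      |y - T| ≤ (1 / (1 + δ)) * (1 / (1 + δ)) ^ n := by
  have hlam : 1 / (2 + δ - 1) = 1 / (1 + δ) := by congr 1; ring
  have ha : 0 < 1 / (1 + δ) := by positivity
  have hu1 : 1 < u := by nlinarith
  have hu2 : 1 + δ < u := by nlinarith
  have hua : δ * (u + 1 / (1 + δ) - 1) < 1 := by
    have e1 : δ * (u - 1) = 1 / u := by
      field_simp
      linarith
    have e2 : 1 / u < 1 / (1 + δ) := one_div_lt_one_div_of_lt (by linarith) hu2
    have e3 : δ * (1 / (1 + δ)) = 1 - 1 / (1 + δ) := by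
      field_simp
      ring
    nlinarith
  induction n with
  | zero =>
    intro T hT
    obtain ⟨k, hk1, hk2⟩ := exists_nat_sub_mem ha (show (1 : ℝ) ≤ T by linarith)
    refine ⟨1 + k * (1 / (1 + δ)), by positivity, ?_, ?_⟩
    · have := (achieves_one (2 + δ))
      rw [← one_div_one] at this
      simpa [hlam] using this.add_pendants (by linarith) one_pos k
    · rw [abs_le]
      constructor <;> linarith
  | succ n ih =>
    intro T hT
    obtain ⟨k, hk1, hk2⟩ := exists_nat_sub_mem ha hT
    set T' := T - k * (1 / (1 + δ)) with hT'
    have hden : 0 < 1 - δ * (T' - 1) := by nlinarith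
    set S := (T' - 1) / (1 - δ * (T' - 1)) with hS
    have hSu : u ≤ S := by
      rw [hS, le_div_iff₀ hden]
      nlinarith
    have hS1 : 1 + S / (1 + δ * S) = T' := by
      have hx : 1 + δ * S = 1 / (1 - δ * (T' - 1)) := by
        rw [hS]
        field_simp
        ring
      rw [hx, hS, div_div_div_cancel_right₀ hden.ne', div_one]
      ring
    obtain ⟨y, hy, hach, hyS⟩ := ih S hSu
    have hS0 : 0 < S := hu.trans_le hSu
    refine ⟨1 + y / (1 + δ * y) + k * (1 / (1 + δ)), by positivity, ?_, ?_⟩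
    · have := (hach.extend_inv hδ hy).add_pendants (by linarith) (by positivity) k
      rwa [hlam] at this
    · have e : 1 + y / (1 + δ * y) + k * (1 / (1 + δ)) - T =
          (y - S) * (1 / ((1 + δ * y) * (1 + δ * S))) := by
        have : T = T' + k * (1 / (1 + δ)) := by rw [hT']; ring
        rw [this, ← hS1]
        field_simp
        ring
      rw [e, abs_mul, pow_succ, ← mul_assoc]
      refine mul_le_mul hyS ?_ (abs_nonneg _) (by positivity)
      have h1 : 0 < δ * y := by positivity
      have h2 : 1 + δ ≤ 1 + δ * S := by nlinarith
      rw [abs_of_nonneg (by positivity)]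
      refine one_div_le_one_div_of_le (by positivity) ?_
      nlinarith

theorem exists_achieves {δ u τ ε : ℝ} (hδ : 0 < δ) (hδ' : δ < 0.53) (hu : 0 < u)
    (hfix : δ * u ^ 2 - δ * u - 1 = 0) (hτ : 0 < τ) (hτu : τ ≤ 1 / u) (hε : 0 < ε) :
    ∃ c, Achieves (2 + δ) c ∧ τ - ε < c ∧ c < τ := by
  obtain ⟨c', hc'1, hc'2, hc'0⟩ : ∃ c', τ - ε < c' ∧ c' < τ ∧ 0 < c' := by
    refine ⟨max (τ - ε / 2) (τ / 2), ?_, ?_, ?_⟩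
    · exact lt_max_of_lt_left (by linarith)
    · exact max_lt (by linarith) (by linarith)
    · exact lt_max_of_lt_right (by linarith)
  have h1 : 1 / τ < 1 / c' := one_div_lt_one_div_of_lt hc'0 hc'2
  have hu' : u ≤ 1 / τ := by
    rw [le_div_iff₀ hτ]
    rw [le_div_iff₀ hu] at hτu
    linarith
  have hlt : 1 / (1 + δ) < 1 := by
    rw [div_lt_one (by linarith)]
    linarith
  obtain ⟨n, hn⟩ := exists_pow_lt_of_lt_one
    (show (0 : ℝ) < (1 / c' - 1 / τ) / 2 / (1 / (1 + δ)) by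
      apply div_pos (by linarith); positivity) hlt
  rw [lt_div_iff₀ (by positivity)] at hn
  obtain ⟨y, hy, hach, habs⟩ := achieves_approx hδ hδ' hu hfix n ((1 / τ + 1 / c') / 2)
    (by linarith)
  rw [abs_le] at habs
  refine ⟨1 / y, hach, ?_, ?_⟩
  · refine hc'1.trans ?_
    rw [lt_one_div hc'0 hy]
    linarith
  · rw [one_div_lt hy hτ]
    linarith

theorem RightLimit.of_split {δ u : ℝ} (hδ : 0 < δ) (hδ' : δ < 0.53) (hu : 0 < u)
    (hfix : δ * u ^ 2 - δ * u - 1 = 0) (k : ℕ) {c : ℝ} (hc : Achieves (2 + δ) c)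
    (h1 : c < k / (2 + δ) - δ) (h2 : k / (2 + δ) - δ - c ≤ 1 / u) : RightLimit (2 + δ) := by
  refine RightLimit.of_achieves (by linarith) k fun ε hε => ?_
  obtain ⟨d, hd, hd1, hd2⟩ := exists_achieves hδ hδ' hu hfix (sub_pos.2 h1) h2 hε
  exact ⟨c, d, hc, hd, by linarith, by linarith⟩

theorem RightLimit.of_lt_two_mul {δ u : ℝ} (hδ : 0 < δ) (hδ' : δ < 0.53) (hu : 0 < u)
    (hfix : δ * u ^ 2 - δ * u - 1 = 0) (k : ℕ)
    (h1 : 0 < k / (2 + δ) - δ) (h2 : k / (2 + δ) - δ < 2 * (1 / u)) : RightLimit (2 + δ) := by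
  obtain ⟨c, hc, hc1, hc2⟩ := exists_achieves hδ hδ' hu hfix
    (show 0 < (k / (2 + δ) - δ) / 2 by linarith) (by linarith)
    (show 0 < 1 / u - (k / (2 + δ) - δ) / 2 by linarith)
  exact RightLimit.of_split hδ hδ' hu hfix k hc (by linarith) (by linarith)

/-- The case `lam < 2.53` in terms of `lam = s + 1 / s`. -/
theorem rightLimit_of_param {s : ℝ} (hs : 1 < s) (hs6 : s ^ 2 + 1 ≤ s ^ 6)
    (hs' : s + 1 / s < 2.53) : RightLimit (s + 1 / s) := by
  obtain ⟨δ, hδ⟩ : ∃ δ, δ = s + 1 / s - 2 := ⟨_, rfl⟩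
  have hδs : δ = (s - 1) ^ 2 / s := by
    rw [hδ]
    field_simp
    ring
  have hl : s + 1 / s = 2 + δ := by linarith
  have hs0 : 0 < s - 1 := by linarith
  have hδ0 : 0 < δ := by
    rw [hδs]
    positivity
  have hu : 0 < s / (s - 1) := by positivity
  have hu' : 1 / (s / (s - 1)) = 1 - 1 / s := by
    field_simp
  have hfix : δ * (s / (s - 1)) ^ 2 - δ * (s / (s - 1)) - 1 = 0 := by
    rw [hδs]
    field_simp
    ring
  have hδs1 : δ * s = (s - 1) ^ 2 := by
    rw [hδs]
    field_simp
  rw [hl]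
  rcases le_or_gt δ 0.06 with hA | hA
  · have hs2 : s < 1.28 := by nlinarith
    have hs3 : 1.14 < s := by
      by_contra! h
      have h2 : s ^ 2 ≤ 1.14 ^ 2 := by gcongr
      nlinarith [mul_le_mul h2 h2 (sq_nonneg s) (by norm_num), sq_nonneg s]
    have hc : Achieves (2 + δ) ((s ^ 4 - s ^ 3 + s ^ 2 - s + 1) / (s ^ 4 + s ^ 2 + 1)) := by
      have h1 := achieves_one (2 + δ)
      rw [← one_div_one] at h1
      have h2 := (h1.extend_inv hδ0 one_pos).extend_inv hδ0 (by positivity)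
      convert h2 using 1
      rw [hδs]
      have : 0 < s ^ 4 - s ^ 3 + s ^ 2 - s + 1 := by nlinarith
      have h3 : 1 + (s - 1) ^ 2 / s * 1 = (s ^ 2 - s + 1) / s := by
        field_simp
        ring
      have h4 : 0 < s ^ 2 - s + 1 := by nlinarith
      have h5 : 1 + (s - 1) ^ 2 / s * (1 + 1 / ((s ^ 2 - s + 1) / s)) =
          (s ^ 4 - s ^ 3 + s ^ 2 - s + 1) / (s * (s ^ 2 - s + 1)) := by
        field_simp
        ring
      have h6 : 1 + (1 + 1 / ((s ^ 2 - s + 1) / s)) /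
          ((s ^ 4 - s ^ 3 + s ^ 2 - s + 1) / (s * (s ^ 2 - s + 1))) =
          (s ^ 4 + s ^ 2 + 1) / (s ^ 4 - s ^ 3 + s ^ 2 - s + 1) := by
        rw [eq_div_iff this.ne', add_mul, div_div_eq_mul_div, div_mul_cancel₀ _ this.ne']
        field_simp
        ring
      rw [h3, h5, h6, one_div_div]
    refine RightLimit.of_split hδ0 (by linarith) hu hfix 1 hc ?_ ?_
    · have h1 : (s ^ 4 - s ^ 3 + s ^ 2 - s + 1) / (s ^ 4 + s ^ 2 + 1) < 0.4 := by
        rw [div_lt_iff₀ (by positivity)]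
        nlinarith [mul_pos (sub_pos.2 hs3) (sub_pos.2 hs2)]
      have h2 : 0.48 < 1 / (2 + δ) := by
        rw [lt_div_iff₀ (by positivity)]
        linarith
      rw [Nat.cast_one]
      linarith
    · rw [hu', Nat.cast_one, ← hl, hδs, ← sub_nonneg]
      have : 1 - 1 / s - (1 / (s + 1 / s) - (s - 1) ^ 2 / s -
          (s ^ 4 - s ^ 3 + s ^ 2 - s + 1) / (s ^ 4 + s ^ 2 + 1)) =
          s * (s ^ 6 - (s ^ 2 + 1)) / ((s ^ 2 + 1) * (s ^ 4 + s ^ 2 + 1)) := by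
        field_simp
        ring
      rw [this]
      have := sub_nonneg.2 hs6
      positivity
  rcases le_or_gt δ 0.4 with hB | hB
  · have hs2 : 1.276 < s := by nlinarith
    refine RightLimit.of_lt_two_mul hδ0 (by linarith) hu hfix 1 ?_ ?_
    · have h2 : 0.41 < 1 / (2 + δ) := by
        rw [lt_div_iff₀ (by positivity)]
        linarith
      rw [Nat.cast_one]
      linarith
    · have h2 : 1 / (2 + δ) < 0.486 := by
        rw [div_lt_iff₀ (by positivity)]
        linarith
      have h3 : 1 / s < 0.784 := by
        rw [div_lt_iff₀ (by positivity)]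
        linarith
      rw [Nat.cast_one, hu']
      linarith
  · have hs2 : 1.8 < s := by nlinarith
    refine RightLimit.of_lt_two_mul hδ0 (by linarith) hu hfix 2 ?_ ?_
    · have h2 : 0.7 < 2 / (2 + δ) := by
        rw [lt_div_iff₀ (by positivity)]
        linarith
      push_cast
      linarith
    · have h2 : 2 / (2 + δ) < 0.84 := by
        rw [div_lt_iff₀ (by positivity)]
        linarith
      have h3 : 1 / s < 0.56 := by
        rw [div_lt_iff₀ (by positivity)]
        linarith
      push_cast
      rw [hu']
      linarith

theorem rightLimit_of_ge {lam σ : ℝ} (hσ : 1 < σ) (hσ6 : σ ^ 6 = σ ^ 2 + 1)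
    (h : σ + 1 / σ ≤ lam) : RightLimit lam := by
  have hσ2 : σ < 1.16 := by
    by_contra! h
    have h2 : 1.16 ^ 2 ≤ σ ^ 2 := by gcongr
    nlinarith [mul_le_mul h2 h2 (by norm_num) (sq_nonneg σ), sq_nonneg σ]
  have hσ0 : 0 < σ := by linarith
  have hgt : 2 < σ + 1 / σ := by
    have : σ + 1 / σ = 2 + (σ - 1) ^ 2 / σ := by
      field_simp
      ring
    have : 0 < (σ - 1) ^ 2 / σ := by
      have := sub_pos.2 hσ
      positivity
    linarith
  have hlam : 0 < lam := by linarith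
  obtain ⟨j, hj1, hj2⟩ := exists_nat_sub_mem (one_div_pos.2 hlam) h
  have hj : lam - j / lam = lam - j * (1 / lam) := by ring
  refine RightLimit.of_pendant hlam j ?_
  rw [hj]
  set m := lam - j * (1 / lam)
  have hm : m < 2.53 := by
    have h1 : σ + 1 / σ < 2.03 := by
      have : σ + 1 / σ = (σ ^ 2 + 1) / σ := by
        field_simp
      rw [this, div_lt_iff₀ hσ0]
      nlinarith [mul_pos (sub_pos.2 hσ) (sub_pos.2 hσ2)]
    have h2 : 1 / lam ≤ 1 / 2 := one_div_le_one_div_of_le two_pos (by linarith)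
    linarith
  have hm2 : 0 ≤ m ^ 2 - 4 := by nlinarith
  obtain ⟨s, hs1, hs⟩ : ∃ s, 1 < s ∧ s ^ 2 = m * s - 1 := by
    refine ⟨(m + √(m ^ 2 - 4)) / 2, ?_, ?_⟩
    · have := Real.sqrt_nonneg (m ^ 2 - 4)
      linarith
    · have := Real.sq_sqrt hm2
      nlinarith
  have hs0 : 0 < s := by linarith
  have hms : s + 1 / s = m := by
    field_simp
    linarith
  have hσs : σ ≤ s := by
    by_contra! hlt
    have : σ + 1 / σ - (s + 1 / s) = (σ - s) * (σ * s - 1) / (σ * s) := by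
      field_simp
      ring
    have h2 : 0 < σ * s - 1 := by nlinarith
    have h3 := sub_pos.2 hlt
    have : 0 < (σ - s) * (σ * s - 1) / (σ * s) := by positivity
    linarith
  rw [← hms]
  refine rightLimit_of_param hs1 ?_ (hms ▸ hm)
  have h1 : σ ^ 2 ≤ s ^ 2 := by gcongr
  have h2 : 1 ≤ σ ^ 2 := by nlinarith
  have : s ^ 6 - s ^ 2 - (σ ^ 6 - σ ^ 2) =
      (s ^ 2 - σ ^ 2) * (s ^ 4 + s ^ 2 * σ ^ 2 + σ ^ 4 - 1) := by ring
  have h3 : 0 ≤ (s ^ 2 - σ ^ 2) * (s ^ 4 + s ^ 2 * σ ^ 2 + σ ^ 4 - 1) := by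
    apply mul_nonneg (by linarith)
    have : 1 ≤ σ ^ 2 * σ ^ 2 := by nlinarith
    have : 0 ≤ s ^ 4 + s ^ 2 * σ ^ 2 := by positivity
    nlinarith
  linarith

theorem qform_extend {V W : Type*} [Fintype V] [Fintype W] (A : W → W → ℤ) (lam : ℝ)
    {f : V → W} (hf : Function.Injective f) (x : V → ℝ) :
    qform A lam (Function.extend f x 0) = qform (fun i j => A (f i) (f j)) lam x := by
  have h0 : ∀ i ∉ Set.range f, Function.extend f x 0 i = 0 := fun i hi =>
    Function.extend_apply' _ _ _ hi
  have h1 : ∀ i, Function.extend f x 0 (f i) = x i := fun i => hf.extend_apply _ _ _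
  unfold qform
  congr 2
  · refine (Fintype.sum_of_injective f hf _ _ (fun i hi => ?_) fun i => ?_).symm
    · simp [h0 i hi]
    · simp [h1]
  · refine (Fintype.sum_of_injective f hf _ _ (fun i hi => ?_) fun i => ?_).symm
    · simp [h0 i hi]
    · refine Fintype.sum_of_injective f hf _ _ (fun j hj => ?_) fun j => ?_
      · simp [h0 j hj]
      · simp [h1]

theorem sum_sq_extend {V W : Type*} [Fintype V] [Fintype W]
    {f : V → W} (hf : Function.Injective f) (x : V → ℝ) :
    ∑ i, Function.extend f x 0 i ^ 2 = ∑ i, x i ^ 2 := by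
  refine (Fintype.sum_of_injective f hf _ _ (fun i hi => ?_) fun i => ?_).symm
  · rw [Function.extend_apply' _ _ _ hi]
    simp
  · rw [hf.extend_apply]

theorem IsSignedMat.comp {V W : Type*} {A : W → W → ℤ} (hA : IsSignedMat A) (f : V → W) :
    IsSignedMat fun i j => A (f i) (f j) :=
  ⟨fun _ _ => hA.symm _ _, fun _ => hA.diag _, fun _ _ => hA.lower _ _, fun _ _ => hA.upper _ _⟩

/-- The signed graph of an integer matrix. -/
noncomputable def toSG {n : ℕ} (A : Fin n → Fin n → ℤ) : SG :=
  ⟨n, Matrix.of fun i j => (A i j : ℝ)⟩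

theorem isSignedGraph_toSG {n : ℕ} {A : Fin n → Fin n → ℤ} (hA : IsSignedMat A) :
    IsSignedGraph (toSG A) := by
  refine ⟨?_, fun i => ?_, fun i j _ => ?_⟩
  · ext i j
    exact congrArg Int.cast (hA.symm j i)
  · exact (congrArg Int.cast (hA.diag i)).trans Int.cast_zero
  · have h1 := hA.lower i j
    have h2 := hA.upper i j
    have : A i j = -1 ∨ A i j = 0 ∨ A i j = 1 := by omega
    change (A i j : ℝ) = -1 ∨ (A i j : ℝ) = 0 ∨ (A i j : ℝ) = 1
    exact_mod_cast this

theorem IsSignedGraph.exists_eq_toSG {G : SG} (hG : IsSignedGraph G) :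
    ∃ (n : ℕ) (A : Fin n → Fin n → ℤ), IsSignedMat A ∧ G = toSG A := by
  obtain ⟨n, M⟩ := G
  obtain ⟨h1, h2, h3⟩ := hG
  have h : ∀ i j, ∃ a : ℤ, -1 ≤ a ∧ a ≤ 1 ∧ M i j = a := by
    intro i j
    rcases eq_or_ne i j with rfl | hij
    · exact ⟨0, by norm_num, by norm_num, by simpa using h2 i⟩
    · rcases h3 i j hij with h | h | h
      · exact ⟨-1, by norm_num, by norm_num, by simpa using h⟩
      · exact ⟨0, by norm_num, by norm_num, by simpa using h⟩
      · exact ⟨1, by norm_num, by norm_num, by simpa using h⟩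
  choose A hl hu hM using h
  refine ⟨n, A, ⟨fun i j => ?_, fun i => ?_, hl, hu⟩, ?_⟩
  · have := h1.apply i j
    simp only [hM] at this
    exact_mod_cast this.symm
  · have := h2 i
    simp only [hM] at this
    exact_mod_cast this
  · unfold toSG
    congr
    ext i j
    simp [hM]

theorem qform_eq_dotProduct {n : ℕ} (A : Fin n → Fin n → ℤ) (lam : ℝ) (x : Fin n → ℝ) :
    qform A lam x = lam * (x ⬝ᵥ x) + x ⬝ᵥ (Matrix.of fun i j => (A i j : ℝ)).mulVec x := by
  simp only [qform, dotProduct, Matrix.mulVec, Matrix.of_apply, Finset.mul_sum]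
  congr 1
  · exact Finset.sum_congr rfl fun i _ => by ring
  · exact Finset.sum_congr rfl fun i _ => Finset.sum_congr rfl fun j _ => by ring

theorem qform_nonneg_of_le_sgLam1 {n : ℕ} {A : Fin n → Fin n → ℤ} (hA : IsSignedMat A) {lam : ℝ}
    (h : -lam ≤ sgLam1 (toSG A)) (x : Fin n → ℝ) : 0 ≤ qform A lam x := by
  set M : Matrix (Fin n) (Fin n) ℝ := Matrix.of fun i j => (A i j : ℝ) with hM
  set S := {t : ℝ | ∃ x : Fin n → ℝ, x ≠ 0 ∧ M.mulVec x = t • x} with hS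
  change -lam ≤ sInf S at h
  have hfin : S.Finite := by
    refine (Module.End.finite_hasEigenvalue (Matrix.toLin' M)).subset ?_
    rintro t ⟨x, hx, hxt⟩
    exact Module.End.hasEigenvalue_of_hasEigenvector (x := x)
      ⟨Module.End.mem_eigenspace_iff.2 (by simpa using hxt), hx⟩
  have hle : ∀ t ∈ S, -lam ≤ t := fun t ht => h.trans (csInf_le hfin.bddBelow ht)
  have hsymm : M.IsHermitian := by
    ext i j
    simp [hM, hA.symm i j]
  have hsymm' : (lam • (1 : Matrix (Fin n) (Fin n) ℝ) + M).IsHermitian := by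
    refine Matrix.IsHermitian.add ?_ hsymm
    ext i j
    simp [Matrix.one_apply, eq_comm]
  have hpos : (lam • (1 : Matrix (Fin n) (Fin n) ℝ) + M).PosSemidef := by
    rw [hsymm'.posSemidef_iff_eigenvalues_nonneg]
    intro i
    have h1 := hsymm'.mulVec_eigenvectorBasis i
    have h2 : hsymm'.eigenvalues i - lam ∈ S := by
      refine ⟨(hsymm'.eigenvectorBasis i).ofLp, ?_, ?_⟩
      · intro h0
        have := hsymm'.eigenvectorBasis.toBasis.ne_zero i
        apply this
        ext k
        simpa using congrFun h0 k
      · rw [Matrix.add_mulVec, Matrix.smul_mulVec, Matrix.one_mulVec] at h1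
        rw [sub_smul, ← h1, add_sub_cancel_left]
    have := hle _ h2
    simpa using by linarith
  have h3 := hpos.dotProduct_mulVec_nonneg x
  rw [qform_eq_dotProduct]
  simpa [Matrix.add_mulVec, Matrix.smul_mulVec] using h3

theorem le_sgLam1_iff {n : ℕ} {A : Fin n → Fin n → ℤ} (hA : IsSignedMat A) {lam : ℝ}
    (hlam : 0 ≤ lam) : -lam ≤ sgLam1 (toSG A) ↔ ∀ x, 0 ≤ qform A lam x := by
  refine ⟨qform_nonneg_of_le_sgLam1 hA, fun h => ?_⟩
  set M : Matrix (Fin n) (Fin n) ℝ := Matrix.of fun i j => (A i j : ℝ) with hM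
  set S := {t : ℝ | ∃ x : Fin n → ℝ, x ≠ 0 ∧ M.mulVec x = t • x} with hS
  change -lam ≤ sInf S
  rcases S.eq_empty_or_nonempty with hem | hne
  · rw [hem, Real.sInf_empty]
    linarith
  · refine le_csInf hne ?_
    rintro t ⟨x, hx, hxt⟩
    have h1 := h x
    rw [qform_eq_dotProduct, hxt, dotProduct_smul, smul_eq_mul, ← add_mul] at h1
    have h2 : 0 < x ⬝ᵥ x := by
      have : 0 ≤ x ⬝ᵥ x := Finset.sum_nonneg fun i _ => mul_self_nonneg _
      refine lt_of_le_of_ne this fun h0 => hx ?_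
      exact dotProduct_self_eq_zero.1 h0.symm
    have := nonneg_of_mul_nonneg_left h1 h2
    linarith

theorem sgInduced_toSG {m n : ℕ} {B : Fin m → Fin m → ℤ} {A : Fin n → Fin n → ℤ} :
    SGInduced (toSG B) (toSG A) ↔
      ∃ f : Fin m → Fin n, Function.Injective f ∧ B = fun i j => A (f i) (f j) := by
  constructor
  · rintro ⟨f, hf, h⟩
    refine ⟨f, hf, ?_⟩
    ext i j
    exact Int.cast_injective (α := ℝ) (h i j)
  · rintro ⟨f, hf, rfl⟩
    exact ⟨f, hf, fun _ _ => rfl⟩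

theorem not_hasFFSC_of_rightLimit {lam : ℝ} (hlam : 0 ≤ lam) (h : RightLimit lam) :
    ¬ HasFFSC {G | IsSignedGraph G} {G | IsSignedGraph G ∧ -lam ≤ sgLam1 G} := by
  rintro ⟨F, hfin, hF, hFG⟩
  have hbad : ∀ G ∈ F, ∀ᶠ ε in nhdsWithin (0 : ℝ) (Set.Ioi 0), ∃ (n : ℕ) (A : Fin n → Fin n → ℤ),
      G = toSG A ∧ ∃ x, qform A lam x < -(ε * ∑ i, x i ^ 2) := by
    intro G hG
    obtain ⟨n, A, hA, rfl⟩ := IsSignedGraph.exists_eq_toSG (hF hG)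
    have hnot : ¬ ∀ x, 0 ≤ qform A lam x := by
      rw [← le_sgLam1_iff hA hlam]
      intro hle
      exact (hFG _ (hF hG)).1 ⟨hF hG, hle⟩ _ hG ⟨id, Function.injective_id, fun _ _ => rfl⟩
    push Not at hnot
    obtain ⟨x, hx⟩ := hnot
    have hcont : Filter.Tendsto (fun ε : ℝ => -(ε * ∑ i, x i ^ 2)) (nhdsWithin 0 (Set.Ioi 0))
        (nhds 0) := by
      have : Continuous fun ε : ℝ => -(ε * ∑ i, x i ^ 2) := by fun_prop
      have := this.tendsto 0
      simp only [zero_mul, neg_zero] at this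
      exact this.mono_left nhdsWithin_le_nhds
    filter_upwards [hcont.eventually_const_lt hx] with ε hε
    exact ⟨n, A, rfl, x, hε⟩
  obtain ⟨ε, hε, hε0⟩ := ((hfin.eventually_all.2 hbad).and self_mem_nhdsWithin).exists
  obtain ⟨V, _, A, hA, ⟨x, hx⟩, hge⟩ := h ε hε0
  classical
  set e := (Fintype.equivFin V).symm
  set A' : Fin (Fintype.card V) → Fin (Fintype.card V) → ℤ := fun i j => A (e i) (e j) with hA'
  have hA's : IsSignedMat A' := hA.comp e
  have hqe : ∀ y, qform A' lam y = qform A lam (Function.extend e y 0) := fun y =>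
    (qform_extend A lam e.injective y).symm
  have hneg : qform A' lam (fun i => x (e i)) < 0 := by
    rw [hqe]
    convert hx using 2
    ext v
    obtain ⟨i, rfl⟩ := e.surjective v
    exact e.injective.extend_apply _ _ _
  have h1 : ¬ (IsSignedGraph (toSG A') ∧ -lam ≤ sgLam1 (toSG A')) := by
    rw [le_sgLam1_iff hA's hlam]
    rintro ⟨-, h⟩
    exact absurd (h _) (not_le.2 hneg)
  have h2 := (hFG (toSG A') (isSignedGraph_toSG hA's)).not.1 h1
  push Not at h2
  obtain ⟨G, hG, hind⟩ := h2
  obtain ⟨n, B, rfl, y, hy⟩ := hε G hG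
  obtain ⟨f, hf, rfl⟩ := sgInduced_toSG.1 hind
  have hinj : Function.Injective fun i => e (f i) := e.injective.comp hf
  have h3 := hge (Function.extend (fun i : Fin n => e (f i)) y 0)
  rw [qform_extend A lam (f := fun i : Fin n => e (f i)) hinj, sum_sq_extend hinj] at h3
  exact absurd h3 (not_le.2 hy)

/-- A bound on the support of negative vectors yields a finite forbidden subgraph
characterization. -/
theorem hasFFSC_of_bounded_support {lam : ℝ} (hlam : 0 ≤ lam) (N : ℕ)
    (h : ∀ (n : ℕ) (A : Fin n → Fin n → ℤ), IsSignedMat A → (∃ x, qform A lam x < 0) →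
      ∃ x, qform A lam x < 0 ∧ (Finset.univ.filter fun i => x i ≠ 0).card ≤ N) :
    HasFFSC {G | IsSignedGraph G} {G | IsSignedGraph G ∧ -lam ≤ sgLam1 G} := by
  refine ⟨{G | (∃ (n : ℕ) (A : Fin n → Fin n → ℤ), n ≤ N ∧ IsSignedMat A ∧ G = toSG A) ∧
    ¬ -lam ≤ sgLam1 G}, ?_, ?_, ?_⟩
  · refine Set.Finite.subset (s := ⋃ n ∈ Set.Iic N, Set.range
      fun B : Fin n → Fin n → Set.Icc (-1 : ℤ) 1 => toSG fun i j => (B i j : ℤ)) ?_ ?_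
    · exact (Set.finite_Iic N).biUnion fun n _ => Set.finite_range _
    · rintro G ⟨⟨n, A, hn, hA, rfl⟩, -⟩
      simp only [Set.mem_iUnion]
      exact ⟨n, hn, fun i j => ⟨A i j, hA.lower i j, hA.upper i j⟩, rfl⟩
  · rintro G ⟨⟨n, A, -, hA, rfl⟩, -⟩
    exact isSignedGraph_toSG hA
  · intro G hG
    obtain ⟨n, A, hA, rfl⟩ := IsSignedGraph.exists_eq_toSG hG
    constructor
    · rintro ⟨-, hle⟩ F ⟨⟨m, B, -, hB, rfl⟩, hF⟩ hind
      obtain ⟨f, hf, rfl⟩ := sgInduced_toSG.1 hind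
      rw [le_sgLam1_iff hA hlam] at hle
      refine hF ((le_sgLam1_iff hB hlam).2 fun x => ?_)
      rw [← qform_extend A lam hf]
      exact hle _
    · intro hno
      refine ⟨hG, ?_⟩
      rw [le_sgLam1_iff hA hlam]
      by_contra! hneg
      obtain ⟨x, hx, hcard⟩ := h n A hA hneg
      classical
      set s := Finset.univ.filter fun i => x i ≠ 0 with hs
      set f : Fin s.card → Fin n := fun i => s.equivFin.symm i with hf
      have hinj : Function.Injective f :=
        Subtype.val_injective.comp s.equivFin.symm.injective
      have hB := hA.comp f
      refine hno (toSG fun i j => A (f i) (f j)) ⟨⟨_, _, hcard, hB, rfl⟩, ?_⟩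
        ⟨f, hinj, fun _ _ => rfl⟩
      rw [le_sgLam1_iff hB hlam]
      intro hall
      refine absurd (hall fun i => x (f i)) (not_le.2 ?_)
      have hxe : Function.extend f (fun i => x (f i)) 0 = x := by
        ext v
        by_cases hv : v ∈ s
        · have : v = f (s.equivFin ⟨v, hv⟩) := by simp [hf]
          rw [this]
          exact hinj.extend_apply _ _ _
        · rw [Function.extend_apply']
          · have : x v = 0 := by simpa [hs] using hv
            rw [this]
            rfl
          · rintro ⟨i, rfl⟩
            exact hv (s.equivFin.symm i).2
      rwa [← qform_extend A lam hinj, hxe]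

theorem hasFFSC_of_neg {lam : ℝ} (hlam : lam < 0) :
    HasFFSC {G | IsSignedGraph G} {G | IsSignedGraph G ∧ -lam ≤ sgLam1 G} := by
  refine ⟨{toSG (n := 0) fun _ _ => 0}, Set.finite_singleton _, ?_, ?_⟩
  · rintro G rfl
    exact isSignedGraph_toSG isSignedMat_zero
  · intro G hG
    obtain ⟨n, A, hA, rfl⟩ := IsSignedGraph.exists_eq_toSG hG
    refine ⟨?_, fun h => absurd ⟨fun i => i.elim0, fun i => i.elim0, fun i => i.elim0⟩ (h _ rfl)⟩
    rintro ⟨-, h⟩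
    rcases Nat.eq_zero_or_pos n with rfl | hn
    · have h0 : sgLam1 (toSG A) = sInf ∅ := by
        unfold sgLam1
        congr 1
        refine Set.eq_empty_of_forall_notMem ?_
        rintro t ⟨x, hx, -⟩
        exact hx (funext fun i => Fin.elim0 i)
      rw [h0, Real.sInf_empty] at h
      linarith
    · have h1 := qform_nonneg_of_le_sgLam1 hA h (Pi.single ⟨0, hn⟩ 1)
      have h2 : qform A lam (Pi.single ⟨0, hn⟩ 1) = lam := by
        simp [qform, Pi.single_apply, hA.diag]
      linarith

/-- The columns of `R` indexed by `U` are vectors of norm `2` whose inner products are given by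
`A`. -/
def IsRep {V C : Type*} [Fintype C] [DecidableEq V] (A : V → V → ℤ) (U : Finset V)
    (R : C → V → ℤ) : Prop :=
  ∀ g ∈ U, ∀ h ∈ U, ∑ c, R c g * R c h = A g h + if g = h then 2 else 0

/-- The signed graph induced on `U` is represented by vectors `±e_c ± e_d`. -/
def DRep {V : Type*} [DecidableEq V] (A : V → V → ℤ) (U : Finset V) : Prop :=
  ∃ (C : Type) (_ : Fintype C) (R : C → V → ℤ), IsRep A U R

/-- The column `h` is `±e_c ± e_d`. -/
structure IsEdge {V C : Type*} (R : C → V → ℤ) (h : V) (c d : C) : Prop where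
  ne : c ≠ d
  left : R c h ^ 2 = 1
  right : R d h ^ 2 = 1
  other : ∀ e, e ≠ c → e ≠ d → R e h = 0

theorem IsEdge.symm {V C : Type*} {R : C → V → ℤ} {h : V} {c d : C} (H : IsEdge R h c d) :
    IsEdge R h d c :=
  ⟨H.ne.symm, H.right, H.left, fun e h1 h2 => H.other e h2 h1⟩

theorem IsEdge.eq_or_eq {V C : Type*} {R : C → V → ℤ} {h : V} {c d e : C} (H : IsEdge R h c d)
    (he : R e h ≠ 0) :
    e = c ∨ e = d := by
  by_contra! h'
  exact he (H.other e h'.1 h'.2)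

theorem IsEdge.left_ne {V C : Type*} {R : C → V → ℤ} {h : V} {c d : C} (H : IsEdge R h c d) :
    R c h ≠ 0 := by
  intro h0
  have := H.left
  simp [h0] at this

theorem IsEdge.right_ne {V C : Type*} {R : C → V → ℤ} {h : V} {c d : C} (H : IsEdge R h c d) :
    R d h ≠ 0 := H.symm.left_ne

theorem IsEdge.sum_eq {V C : Type*} [Fintype C] [DecidableEq C] {R : C → V → ℤ} {h : V} {c d : C}
    (H : IsEdge R h c d) (f : C → ℤ) :
    ∑ e, R e h * f e = R c h * f c + R d h * f d := by
  rw [← Finset.sum_pair (f := fun e => R e h * f e) H.ne]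
  refine (Finset.sum_subset (Finset.subset_univ _) fun e _ he => ?_).symm
  simp only [Finset.mem_insert, Finset.mem_singleton, not_or] at he
  simp [H.other e he.1 he.2]

theorem IsEdge.sum_eq_real {V C : Type*} [Fintype C] [DecidableEq C] {R : C → V → ℤ} {h : V}
    {c d : C} (H : IsEdge R h c d) (f : C → ℝ) :
    ∑ e, (R e h : ℝ) * f e = R c h * f c + R d h * f d := by
  rw [← Finset.sum_pair (f := fun e => (R e h : ℝ) * f e) H.ne]
  refine (Finset.sum_subset (Finset.subset_univ _) fun e _ he => ?_).symm
  simp only [Finset.mem_insert, Finset.mem_singleton, not_or] at he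
  simp [H.other e he.1 he.2]

section

variable {V C : Type*} [Fintype C] [DecidableEq V] {A : V → V → ℤ} {U : Finset V} {R : C → V → ℤ}

theorem IsRep.mono (hR : IsRep A U R) {W : Finset V} (h : W ⊆ U) : IsRep A W R :=
  fun g hg k hk => hR g (h hg) k (h hk)

theorem DRep.mono (hU : DRep A U) {W : Finset V} (h : W ⊆ U) : DRep A W := by
  obtain ⟨C, _, R, hR⟩ := hU
  exact ⟨C, _, R, hR.mono h⟩

theorem IsRep.sum_sq (hR : IsRep A U R) (hA : IsSignedMat A) {h : V} (hh : h ∈ U) :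
    ∑ c, R c h ^ 2 = 2 := by
  have := hR h hh h hh
  simp only [hA.diag, if_true, zero_add] at this
  rw [← this]
  exact Finset.sum_congr rfl fun c _ => sq _

theorem IsRep.exists_isEdge (hR : IsRep A U R) (hA : IsSignedMat A) {h : V} (hh : h ∈ U) {c : C}
    (hc : R c h ≠ 0) : ∃ d, IsEdge R h c d := by
  classical
  have hs := hR.sum_sq hA hh
  have hc1 : 1 ≤ R c h ^ 2 := by
    have := sq_nonneg (R c h)
    have : R c h ^ 2 ≠ 0 := pow_ne_zero 2 hc
    omega
  rw [← Finset.add_sum_erase _ _ (Finset.mem_univ c)] at hs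
  have hc2 : R c h ^ 2 ≠ 2 := by
    intro h2
    have h3 : R c h < 2 := by nlinarith
    have h4 : -2 < R c h := by nlinarith
    interval_cases R c h <;> simp at h2
  have hpos : 0 ≤ ∑ x ∈ Finset.univ.erase c, R x h ^ 2 := Finset.sum_nonneg fun _ _ => sq_nonneg _
  have hc3 : R c h ^ 2 = 1 := by omega
  have hs' : ∑ x ∈ Finset.univ.erase c, R x h ^ 2 = 1 := by omega
  obtain ⟨d, hd, hd0⟩ := Finset.exists_ne_zero_of_sum_ne_zero (by rw [hs']; norm_num)
  have hd1 : 1 ≤ R d h ^ 2 := by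
    have := sq_nonneg (R d h)
    omega
  rw [← Finset.add_sum_erase _ _ hd] at hs'
  have hpos' : 0 ≤ ∑ x ∈ (Finset.univ.erase c).erase d, R x h ^ 2 :=
    Finset.sum_nonneg fun _ _ => sq_nonneg _
  refine ⟨d, (Finset.ne_of_mem_erase hd).symm, hc3, by omega, fun e hec hed => ?_⟩
  have h0 : ∑ x ∈ (Finset.univ.erase c).erase d, R x h ^ 2 = 0 := by omega
  rw [Finset.sum_eq_zero_iff_of_nonneg fun _ _ => sq_nonneg _] at h0
  exact pow_eq_zero_iff two_ne_zero |>.1 (h0 e (by simp [hec, hed]))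

theorem IsRep.exists_isEdge' (hR : IsRep A U R) (hA : IsSignedMat A) {h : V} (hh : h ∈ U) :
    ∃ c d, IsEdge R h c d := by
  have hs := hR.sum_sq hA hh
  obtain ⟨c, -, hc⟩ := Finset.exists_ne_zero_of_sum_ne_zero (by rw [hs]; norm_num)
  exact ⟨c, hR.exists_isEdge hA hh (pow_ne_zero_iff two_ne_zero |>.1 hc)⟩

theorem IsRep.sq_le_one (hR : IsRep A U R) (hA : IsSignedMat A) {h : V} (hh : h ∈ U) (c : C) :
    R c h = 0 ∨ R c h ^ 2 = 1 := by
  by_cases hc : R c h = 0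
  · exact Or.inl hc
  · obtain ⟨d, hd⟩ := hR.exists_isEdge hA hh hc
    exact Or.inr hd.left

end

theorem IsRep.extend {V : Type*} {C : Type} [Fintype C] [DecidableEq V] {A : V → V → ℤ}
    {U : Finset V} {R : C → V → ℤ} (hR : IsRep A U R) (hA : IsSignedMat A) {v : V} (hv : v ∉ U)
    (z : C → ℤ) (hz : ∀ h ∈ U, ∑ c, R c h * z c = A v h) (hz2 : ∑ c, z c ^ 2 ≤ 2) :
    DRep A (insert v U) := by
  refine ⟨C ⊕ Fin (2 - ∑ c, z c ^ 2).toNat, inferInstance,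
    Sum.elim (fun c h => if h = v then z c else R c h) (fun _ h => if h = v then 1 else 0), ?_⟩
  intro g hg h hh
  rw [Fintype.sum_sum_type]
  simp only [Sum.elim_inl, Sum.elim_inr]
  have hz3 : ∑ c, z c * z c + ((2 - ∑ c, z c ^ 2).toNat : ℤ) = 2 := by
    rw [Int.toNat_of_nonneg (by linarith)]
    simp [sq]
  rcases Finset.mem_insert.1 hg with rfl | hg' <;> rcases Finset.mem_insert.1 hh with rfl | hh'
  · simpa [hA.diag] using hz3
  · have hne : h ≠ g := fun h0 => hv (h0 ▸ hh')
    simp only [if_true, hne, hne.symm, if_false, mul_zero, Finset.sum_const_zero, add_zero]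
    rw [← hz h hh']
    exact Finset.sum_congr rfl fun c _ => mul_comm _ _
  · have hne : g ≠ h := fun h0 => hv (h0 ▸ hg')
    simp only [if_true, hne, if_false, zero_mul, Finset.sum_const_zero, add_zero]
    rw [hA.symm, ← hz g hg']
  · have hne : g ≠ v := fun h0 => hv (h0 ▸ hg')
    have hne' : h ≠ v := fun h0 => hv (h0 ▸ hh')
    simp only [hne, hne', if_false, mul_zero, Finset.sum_const_zero, add_zero]
    exact hR g hg' h hh'

/-- Ridge regression of the row of a new vertex `v` over a represented set. -/
theorem IsRep.exists_energy_le {V C : Type*} [Fintype V] [Fintype C] [DecidableEq V]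
    {A : V → V → ℤ} {U : Finset V} {R : C → V → ℤ} (hR : IsRep A U R) (hA : IsSignedMat A)
    {δ : ℝ} (hδ : 0 < δ) (hgood : ∀ x, 0 ≤ qform A (2 + δ) x) {v : V} (hv : v ∉ U) :
    ∃ y : C → ℝ, ∑ c, y c ^ 2 + 1 / δ * ∑ h ∈ U, ((A v h : ℝ) - ∑ c, (R c h : ℝ) * y c) ^ 2 ≤
      2 + δ := by
  set N : Matrix C U ℝ := Matrix.of fun c h => (R c h : ℝ) with hN
  set b : U → ℝ := fun h => (A v h : ℝ) with hb
  have hpd : (δ • (1 : Matrix U U ℝ) + N.conjTranspose * N).PosDef :=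
    (Matrix.PosDef.one.smul hδ).add_posSemidef (Matrix.posSemidef_conjTranspose_mul_self N)
  obtain ⟨α, hα⟩ := Matrix.mulVec_surjective_iff_isUnit.2 hpd.isUnit b
  have hα' : ∀ h : U, δ * α h + ∑ c, (R c h : ℝ) * N.mulVec α c = b h := by
    intro h
    have := congrFun hα h
    rw [Matrix.add_mulVec, Matrix.smul_mulVec, Matrix.one_mulVec, ← Matrix.mulVec_mulVec] at this
    simp only [Pi.add_apply, Pi.smul_apply, smul_eq_mul] at this
    exact this
  have hE : ∑ h, b h * α h = δ * ∑ h, α h ^ 2 + ∑ c, N.mulVec α c ^ 2 := by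
    simp only [← hα', add_mul, Finset.sum_add_distrib, Finset.mul_sum, Finset.sum_mul]
    congr 1
    · exact Finset.sum_congr rfl fun h _ => by ring
    · rw [Finset.sum_comm]
      refine Finset.sum_congr rfl fun c _ => ?_
      rw [sq]
      conv_rhs => rw [Matrix.mulVec, dotProduct, Finset.sum_mul]
      refine Finset.sum_congr rfl fun h _ => ?_
      simp only [hN, Matrix.of_apply, Matrix.mulVec, dotProduct]
      ring
  have hform : qform A (2 + δ) (Function.extend (fun o : Option U => o.elim v Subtype.val)
      (fun o => o.elim 1 fun h => -α h) 0) = 2 + δ - ∑ h, b h * α h := by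
    have hinj : Function.Injective (fun o : Option U => o.elim v Subtype.val) := by
      rintro (_ | g) (_ | h) hgh
      · rfl
      · have e : v = h.1 := hgh
        exact absurd (e ▸ h.2) hv
      · have e : g.1 = v := hgh
        exact absurd (e ▸ g.2) hv
      · simpa using Subtype.ext hgh
    rw [qform_extend A _ hinj]
    have h1 : ∑ h : U, ∑ g : U, (A h g : ℝ) * -α h * -α g =
        ∑ c, N.mulVec α c ^ 2 - 2 * ∑ h, α h ^ 2 := by
      have e : ∀ h g : U, (A h g : ℝ) = ∑ c, (R c h : ℝ) * R c g - if h = g then 2 else 0 := by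
        intro h g
        have := hR h h.2 g g.2
        have h2 : (∑ c, (R c h : ℝ) * R c g) = ((∑ c, R c h * R c g : ℤ) : ℝ) := by push_cast; rfl
        rw [h2, this]
        simp only [Subtype.ext_iff]
        push_cast
        split_ifs <;> ring
      have e2 : ∀ c, N.mulVec α c ^ 2 = ∑ h : U, ∑ g : U, (R c h : ℝ) * R c g * α h * α g := by
        intro c
        simp only [Matrix.mulVec, dotProduct, hN, Matrix.of_apply, sq, Finset.sum_mul_sum]
        exact Finset.sum_congr rfl fun h _ => Finset.sum_congr rfl fun g _ => by ring
      simp only [e2, e]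
      rw [Finset.sum_comm (γ := C), Finset.mul_sum, ← Finset.sum_sub_distrib]
      refine Finset.sum_congr rfl fun h _ => ?_
      rw [Finset.sum_comm (γ := C)]
      have : 2 * α h ^ 2 = ∑ g : U, if h = g then 2 * α h * α g else 0 := by
        simp
        ring
      rw [this, ← Finset.sum_sub_distrib]
      refine Finset.sum_congr rfl fun g _ => ?_
      rw [sub_mul, sub_mul, Finset.sum_mul, Finset.sum_mul]
      congr 1
      · exact Finset.sum_congr rfl fun c _ => by ring
      · split_ifs <;> ring
    simp only [qform, Fintype.sum_option, Option.elim_none, Option.elim_some, hA.diag,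
      Finset.sum_add_distrib, h1, neg_sq]
    have e3 : ∑ h : U, (A v h : ℝ) * 1 * -α h = -∑ h, b h * α h := by
      rw [← Finset.sum_neg_distrib]
      exact Finset.sum_congr rfl fun h _ => by rw [hb]; ring
    have e4 : ∑ h : U, (A h v : ℝ) * -α h * 1 = -∑ h, b h * α h := by
      rw [← Finset.sum_neg_distrib]
      refine Finset.sum_congr rfl fun h _ => ?_
      rw [hb, hA.symm]
      ring
    rw [e3, e4, hE]
    push_cast
    ring
  refine ⟨N.mulVec α, ?_⟩
  have h2 := hgood (Function.extend (fun o : Option U => o.elim v Subtype.val)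
      (fun o => o.elim 1 fun h => -α h) 0)
  rw [hform] at h2
  have h3 : 1 / δ * ∑ h ∈ U, ((A v h : ℝ) - ∑ c, (R c h : ℝ) * N.mulVec α c) ^ 2 =
      δ * ∑ h, α h ^ 2 := by
    rw [← Finset.sum_coe_sort, Finset.mul_sum, Finset.mul_sum]
    refine Finset.sum_congr rfl fun h _ => ?_
    have := hα' h
    rw [hb] at this
    simp only at this
    rw [← this]
    field_simp
    ring
  rw [h3]
  linarith

/-- Numerical constraints on the parameters of the regression argument. -/
structure Params (δ C₀ κ : ℝ) : Prop where
  δ_ge : 0.0195 ≤ δ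
  δ_le : δ ≤ 0.0199
  C₀_ge : 6.6 ≤ C₀
  C₀_le : C₀ ≤ 6.7
  κ_pos : 0 < κ
  κ_le : κ ≤ 0.001
  tight : 2 + δ + κ < 1 / (2 * (2 + δ)) + (C₀ + 1) / (2 * (2 + δ * (C₀ + 1)))
  conduct : C₀ * (δ + 1 / (1 + C₀)) ≤ 1

namespace Params

variable {δ C₀ κ : ℝ}

theorem δ_pos (H : Params δ C₀ κ) : 0 < δ := by linarith [H.δ_ge]

theorem fifty_mul_le (H : Params δ C₀ κ) (e : ℝ) : 50 * e ^ 2 ≤ 1 / δ * e ^ 2 := by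
  refine mul_le_mul_of_nonneg_right ?_ (sq_nonneg e)
  rw [le_div_iff₀ H.δ_pos]
  linarith [H.δ_le]

theorem mul_sq_le (H : Params δ C₀ κ) (t : ℝ) : 6.6 * t ^ 2 ≤ C₀ * t ^ 2 :=
  mul_le_mul_of_nonneg_right H.C₀_ge (sq_nonneg t)

end Params

theorem sub_sq_ge {z : ℤ} (hz : z ^ 2 ≤ 1) {t h : ℝ} (ht : |h| = t) :
    (z = 0 ∧ ((z : ℝ) - h) ^ 2 = t ^ 2) ∨ (z ^ 2 = 1 ∧ (1 - t) ^ 2 ≤ ((z : ℝ) - h) ^ 2) := by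
  have h1 : z ≤ 1 := by nlinarith
  have h2 : -1 ≤ z := by nlinarith
  subst ht
  have : z = -1 ∨ z = 0 ∨ z = 1 := by omega
  rcases this with rfl | rfl | rfl
  · right
    refine ⟨rfl, ?_⟩
    push_cast
    nlinarith [sq_abs h, neg_abs_le h]
  · left
    simp
  · right
    refine ⟨rfl, ?_⟩
    push_cast
    nlinarith [sq_abs h, le_abs_self h]

theorem numeric_two {t y e : ℝ} (hE : 6.6 * t ^ 2 + y ^ 2 + 50 * e ^ 2 ≤ 2.021)
    (h : 2 ≤ t + y + e) : False := by
  nlinarith [sq_nonneg (6.6 * t - y), sq_nonneg (y - 50 * e), sq_nonneg (y - 1.7),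
    sq_nonneg (t - 0.26), sq_nonneg (e - 0.034)]

theorem numeric_three_term {T y e t : ℝ} (hT : T ≤ 1) (ht : t ≤ T) (h : 1 ≤ t + y + e) :
    50 / 51 * (1 - T) ^ 2 ≤ y ^ 2 + 50 * e ^ 2 := by
  have h1 : (1 - T) ^ 2 ≤ (y + e) ^ 2 := by
    apply pow_le_pow_left₀ <;> linarith
  nlinarith [sq_nonneg (y - 50 * e)]

theorem numeric_three {T q₁ q₂ q₃ : ℝ} (hE : 6.6 * T ^ 2 + q₁ + q₂ + q₃ ≤ 2.021)
    (h₁ : 50 / 51 * (1 - T) ^ 2 ≤ q₁) (h₂ : 50 / 51 * (1 - T) ^ 2 ≤ q₂)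
    (h₃ : 50 / 51 * (1 - T) ^ 2 ≤ q₃) : False := by
  nlinarith [sq_nonneg (T - 0.308)]

theorem numeric_edge {Λ t t' q q' e : ℝ} (ht : 6.6 * t ^ 2 ≤ Λ) (ht' : 6.6 * t' ^ 2 ≤ Λ)
    (hE : Λ + q + q' + 50 * e ^ 2 ≤ 2.021) (h : 1 ≤ t + t' + e)
    (hq : q = t ^ 2 ∨ (1 - t) ^ 2 ≤ q) (hq' : q' = t' ^ 2 ∨ (1 - t') ^ 2 ≤ q') : False := by
  rcases hq with hq | hq <;> rcases hq' with hq' | hq'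
  · nlinarith [sq_nonneg (t - t'), sq_nonneg (t - 0.48), sq_nonneg (t' - 0.48),
      sq_nonneg (e - 0.04)]
  · nlinarith [sq_nonneg (t' - 0.5257), sq_nonneg (t - 0.4416), sq_nonneg (e - 0.032)]
  · nlinarith [sq_nonneg (t - 0.5257), sq_nonneg (t' - 0.4416), sq_nonneg (e - 0.032)]
  · nlinarith [sq_nonneg (t - t'), sq_nonneg (t - 0.48), sq_nonneg (t' - 0.48),
      sq_nonneg (e - 0.03)]

theorem numeric_own {Λ t q : ℝ} (ht0 : 0 ≤ t) (ht : 6.6 * t ^ 2 ≤ Λ) (hΛ : Λ ≤ 2.021)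
    (hq : q = t ^ 2 ∨ (1 - t) ^ 2 ≤ q) : 0.64 * t ^ 2 ≤ q := by
  rcases hq with hq | hq
  · nlinarith
  · have : t ≤ 0.5554 := by nlinarith
    nlinarith

theorem numeric_path {Λ tc td τ qc qd qx e₁ e₂ : ℝ} (htc : 6.6 * tc ^ 2 ≤ Λ)
    (htd : 6.6 * td ^ 2 ≤ Λ) (hE : Λ + qc + qd + qx + 50 * e₁ ^ 2 + 50 * e₂ ^ 2 ≤ 2.021)
    (hqc : 0.64 * tc ^ 2 ≤ qc) (hqd : 0.64 * td ^ 2 ≤ qd) (h₁ : τ ≤ td + e₁)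
    (h₂ : 1 ≤ τ + tc + e₂) (hq : qx = τ ^ 2 ∨ (1 - τ) ^ 2 ≤ qx) : False := by
  rcases hq with hq | hq
  · have : τ ^ 2 + 3.94 * tc ^ 2 + 3.94 * td ^ 2 + 50 * e₁ ^ 2 +
      50 * e₂ ^ 2 ≤ 2.021 := by nlinarith
    nlinarith [sq_nonneg (τ - 0.44), sq_nonneg (tc - 0.519), sq_nonneg (td - 0.408),
      sq_nonneg (e₁ - 0.032), sq_nonneg (e₂ - 0.041)]
  · have : (1 - τ) ^ 2 + 3.94 * tc ^ 2 + 3.94 * td ^ 2 + 50 * e₁ ^ 2 +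
      50 * e₂ ^ 2 ≤ 2.021 := by nlinarith
    nlinarith [sq_nonneg (τ - 0.56), sq_nonneg (td - 0.519), sq_nonneg (tc - 0.408),
      sq_nonneg (e₂ - 0.032), sq_nonneg (e₁ - 0.041)]

theorem Params.numeric_double {δ C₀ κ Λ u w : ℝ} (H : Params δ C₀ κ) {r zd zx : ℤ} (hr : r ≠ 0)
    (hzd : zd ^ 2 ≤ 1) (hΛ : C₀ * u ^ 2 ≤ Λ + κ)
    (hE : Λ + ((zd : ℝ) - u) ^ 2 + ((zx : ℝ) - w) ^ 2 +
      1 / δ * (w + u) ^ 2 + 1 / δ * (r + (w - u)) ^ 2 ≤ 2 + δ) : False := by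
  have hδ := H.δ_pos
  have h1 := H.C₀_ge
  have h2 := H.C₀_le
  have hE' : C₀ * u ^ 2 + ((zd : ℝ) - u) ^ 2 + 2 / δ * (u - r / 2) ^ 2 +
      (((zx : ℝ) - w) ^ 2 + 2 / δ * (w + r / 2) ^ 2) ≤ 2 + δ + κ := by
    have : 1 / δ * (w + u) ^ 2 + 1 / δ * (r + (w - u)) ^ 2 =
        2 / δ * (u - r / 2) ^ 2 + 2 / δ * (w + r / 2) ^ 2 := by ring
    linarith
  have hw0 : 0 ≤ ((zx : ℝ) - w) ^ 2 + 2 / δ * (w + r / 2) ^ 2 := by positivity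
  have hd100 : 100 ≤ 2 / δ := by
    rw [le_div_iff₀ hδ]
    linarith [H.δ_le]
  have hsmall : 2 + δ + κ ≤ 2.021 := by linarith [H.δ_le, H.κ_le]
  by_cases hr2 : 4 ≤ r ^ 2
  · have h4 : (4 : ℝ) ≤ (r : ℝ) ^ 2 := by exact_mod_cast hr2
    have : 100 * (u - r / 2) ^ 2 ≤ 2 / δ * (u - r / 2) ^ 2 :=
      mul_le_mul_of_nonneg_right hd100 (sq_nonneg _)
    have h5 : 6.6 * u ^ 2 ≤ C₀ * u ^ 2 := H.mul_sq_le u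
    nlinarith [sq_nonneg ((zd : ℝ) - u), sq_nonneg (u - r * 0.469)]
  · have hr1 : r = 1 ∨ r = -1 := by
      have : r < 2 := by nlinarith
      have : -2 < r := by nlinarith
      omega
    have hw : 1 / (2 * (2 + δ)) ≤ ((zx : ℝ) - w) ^ 2 + 2 / δ * (w + r / 2) ^ 2 := by
      have h6 : (1 : ℝ) / 4 ≤ ((zx : ℝ) + r / 2) ^ 2 := by
        have : (1 : ℤ) ≤ (2 * zx + r) ^ 2 := by
          have : 2 * zx + r ≠ 0 := by omega
          have := sq_nonneg (2 * zx + r)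
          have : (2 * zx + r) ^ 2 ≠ 0 := pow_ne_zero 2 ‹_›
          omega
        have : (1 : ℝ) ≤ (2 * zx + r) ^ 2 := by exact_mod_cast this
        nlinarith
      have h7 : ((zx : ℝ) - w) ^ 2 + 2 / δ * (w + r / 2) ^ 2 =
          2 / (2 + δ) * ((zx : ℝ) + r / 2) ^ 2 +
          (δ * ((zx : ℝ) - w) - 2 * (w + r / 2)) ^ 2 / (δ * (2 + δ)) := by
        field_simp
        ring
      rw [h7]
      have h8 : 0 ≤ (δ * ((zx : ℝ) - w) - 2 * (w + r / 2)) ^ 2 / (δ * (2 + δ)) := by positivity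
      have h9 : 1 / (2 * (2 + δ)) = 2 / (2 + δ) * (1 / 4) := by
        field_simp
        norm_num
      have h10 : 2 / (2 + δ) * (1 / 4) ≤ 2 / (2 + δ) * ((zx : ℝ) + r / 2) ^ 2 :=
        mul_le_mul_of_nonneg_left h6 (by positivity)
      linarith
    have hr' : (r : ℝ) ^ 2 = 1 := by
      rcases hr1 with rfl | rfl <;> norm_num
    by_cases hzd0 : zd = 0
    · have hu : (C₀ + 1) / (2 * (2 + δ * (C₀ + 1))) ≤
          C₀ * u ^ 2 + ((zd : ℝ) - u) ^ 2 + 2 / δ * (u - r / 2) ^ 2 := by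
        have h7 : C₀ * u ^ 2 + ((zd : ℝ) - u) ^ 2 + 2 / δ * (u - r / 2) ^ 2 =
          (C₀ + 1) / (2 * (2 + δ * (C₀ + 1))) * r ^ 2 +
          (δ * (C₀ + 1) * u + 2 * (u - r / 2)) ^ 2 / (δ * (2 + δ * (C₀ + 1))) := by
          have : 0 < 2 + δ * (C₀ + 1) := by positivity
          rw [hzd0]
          field_simp
          ring
        rw [h7, hr', mul_one]
        have h8 : 0 ≤ (δ * (C₀ + 1) * u + 2 * (u - r / 2)) ^ 2 / (δ * (2 + δ * (C₀ + 1))) := by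
          positivity
        linarith
      linarith [H.tight]
    · have hw' : (0.247 : ℝ) ≤ 1 / (2 * (2 + δ)) := by
        rw [le_div_iff₀ (by positivity)]
        linarith [H.δ_le]
      have : 100 * (u - r / 2) ^ 2 ≤ 2 / δ * (u - r / 2) ^ 2 :=
        mul_le_mul_of_nonneg_right hd100 (sq_nonneg _)
      have h5 : 6.6 * u ^ 2 ≤ C₀ * u ^ 2 := H.mul_sq_le u
      have hz1 : zd = 1 ∨ zd = -1 := by
        have : zd < 2 := by nlinarith
        have : -2 < zd := by nlinarith
        omega
      rcases hr1 with rfl | rfl <;> rcases hz1 with rfl | rfl <;> push_cast at * <;>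
        nlinarith [sq_nonneg (u - 0.47), sq_nonneg (u + 0.47), sq_nonneg u]

theorem IsEdge.left_eq {V C : Type*} {R : C → V → ℤ} {h : V} {c d : C} (H : IsEdge R h c d) :
    R c h = 1 ∨ R c h = -1 := by
  have h1 := H.left
  have h2 : (R c h - 1) * (R c h + 1) = 0 := by linarith
  rcases mul_eq_zero.1 h2 with h2 | h2 <;> omega

/-- The elements of `U` of level `j` are edges starting at depth `j - 1`, and all coordinates of
depth `j` lie on such edges. -/
structure LevelAt {V C : Type*} (U : Finset V) (R : C → V → ℤ) (ℓ : V → ℕ) (dep : C → ℕ) (j : ℕ) :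
    Prop where
  edge : ∀ h ∈ U, ℓ h = j → ∃ c d, IsEdge R h c d ∧ dep c + 1 = j ∧ (dep d + 1 = j ∨ dep d = j)
  parent : ∀ c, dep c = j → ∃ h ∈ U, ℓ h = j ∧ R c h ≠ 0

theorem LevelAt.exists_parent {V C : Type*} {U : Finset V} {R : C → V → ℤ} {ℓ : V → ℕ}
    {dep : C → ℕ} {j : ℕ}
    (H : LevelAt U R ℓ dep j) {c : C} (hc : dep c = j) :
    ∃ h ∈ U, ℓ h = j ∧ ∃ d, IsEdge R h c d ∧ dep d + 1 = j := by
  obtain ⟨h, hU, hj, hne⟩ := H.parent c hc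
  obtain ⟨p, d, he, hp, -⟩ := H.edge h hU hj
  rcases he.eq_or_eq hne with rfl | rfl
  · omega
  · exact ⟨h, hU, hj, p, he.symm, hp⟩

section

variable {V C : Type*} [Fintype C]

/-- The residual at `h` of the approximate solution `y` of `Rᵀ y = b`. -/
noncomputable def edgeResidual (R : C → V → ℤ) (b : V → ℤ) (y : C → ℝ) (h : V) : ℝ :=
  b h - ∑ c, (R c h : ℝ) * y c

/-- The contributions of the coordinates and of the elements of `U` to the energy of `y`. -/
noncomputable def energyTerm [DecidableEq V] (R : C → V → ℤ) (U : Finset V) (b : V → ℤ) (δ : ℝ)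
    (y : C → ℝ) : C ⊕ V → ℝ :=
  Sum.elim (fun c => y c ^ 2) fun h => if h ∈ U then 1 / δ * edgeResidual R b y h ^ 2 else 0

/-- The position of a coordinate or a vertex in the layering. -/
def layerRank (ℓ : V → ℕ) (dep : C → ℕ) : C ⊕ V → ℕ :=
  Sum.elim (fun c => dep c + 1) ℓ

/-- The energy of the layers below `j`. -/
noncomputable def energyBelow [Fintype V] [DecidableEq V] (R : C → V → ℤ) (U : Finset V)
    (b : V → ℤ) (δ : ℝ) (y : C → ℝ) (ℓ : V → ℕ) (dep : C → ℕ) (j : ℕ) : ℝ :=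
  ∑ i with layerRank ℓ dep i < j, energyTerm R U b δ y i

theorem IsEdge.residual_eq {R : C → V → ℤ} {h : V} {c d : C} (H : IsEdge R h c d) (b : V → ℤ)
    (y : C → ℝ) : edgeResidual R b y h = b h - (R c h * y c + R d h * y d) := by
  classical
  rw [edgeResidual, H.sum_eq_real]

variable [DecidableEq V] {A : V → V → ℤ} {U : Finset V} {R : C → V → ℤ} {b : V → ℤ}
  {δ : ℝ} {y : C → ℝ} {ℓ : V → ℕ} {dep : C → ℕ}

theorem energyTerm_nonneg (hδ : 0 ≤ δ) (i : C ⊕ V) : 0 ≤ energyTerm R U b δ y i := by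
  rcases i with c | h
  · exact sq_nonneg (y c)
  · simp only [energyTerm, Sum.elim_inr]
    split_ifs <;> positivity

/-- All edges at level `j` are consistent with the rounding `z` of `y`. -/
theorem layer_consistent {C₀ κ Λ : ℝ} (hP : Params δ C₀ κ) (hR : IsRep A U R)
    (hA : IsSignedMat A) {j : ℕ} (hL : LevelAt U R ℓ dep j)
    (hE : ∀ S : Finset (C ⊕ V), (∀ i ∈ S, j ≤ layerRank ℓ dep i) →
      Λ + ∑ i ∈ S, energyTerm R U b δ y i ≤ 2 + δ) {z : C → ℤ}
    (hz : ∀ c, dep c + 1 = j ∨ dep c = j → z c ^ 2 ≤ 1)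
    (hΛ : ∀ c, dep c + 1 = j → (∃ h ∈ U, R c h ≠ 0) → C₀ * ((z c : ℝ) - y c) ^ 2 ≤ Λ + κ)
    (hN : ∀ c, dep c = j → ∃ h ∈ U, ℓ h = j ∧ ∃ d, IsEdge R h c d ∧ dep d + 1 = j ∧
      R c h * z c + R d h * z d = b h) {h : V} (hU : h ∈ U) (hj : ℓ h = j) :
    ∑ c, R c h * z c = b h := by
  classical
  have hsmall : 2 + δ + κ ≤ 2.021 := by linarith [hP.δ_le, hP.κ_le]
  have hE0 : Λ ≤ 2 + δ := by simpa using hE ∅ (by simp)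
  have hΛ' : ∀ c, dep c + 1 = j → (∃ h ∈ U, R c h ≠ 0) →
      6.6 * |(z c : ℝ) - y c| ^ 2 ≤ Λ + κ := by
    intro c h1 h2
    rw [sq_abs]
    exact (hP.mul_sq_le _).trans (hΛ c h1 h2)
  have hown : ∀ c, dep c + 1 = j ∨ dep c = j →
      y c ^ 2 = |(z c : ℝ) - y c| ^ 2 ∨ (1 - |(z c : ℝ) - y c|) ^ 2 ≤ y c ^ 2 := by
    intro c hc
    have h1 := sub_sq_ge (hz c hc) (rfl : |(z c : ℝ) - y c| = _)
    rw [sub_sub_cancel] at h1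
    exact h1.imp (·.2) (·.2)
  have habs : ∀ {g : V} {c d : C}, IsEdge R g c d → ∀ x : ℝ, |(R c g : ℝ) * x| = |x| := by
    intro g c d hg x
    rcases hg.left_eq with h | h <;> simp [h]
  obtain ⟨c, d, he, hc, hd⟩ := hL.edge h hU hj
  rw [he.sum_eq]
  by_contra hne
  set r : ℤ := b h - (R c h * z c + R d h * z d) with hr
  have hr0 : r ≠ 0 := fun h0 => hne (by omega)
  have hres : edgeResidual R b y h = r + (R c h * (z c - y c) + R d h * (z d - y d)) := by
    rw [he.residual_eq, hr]
    push_cast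
    ring
  have htri : 1 ≤ |(z c : ℝ) - y c| + |(z d : ℝ) - y d| + |edgeResidual R b y h| := by
    have h1 : (1 : ℝ) ≤ |(r : ℝ)| := by exact_mod_cast Int.one_le_abs hr0
    have h2 : (r : ℝ) = edgeResidual R b y h - R c h * (z c - y c) - R d h * (z d - y d) := by
      rw [hres]
      ring
    rw [h2] at h1
    have h3 := abs_sub (edgeResidual R b y h - R c h * (z c - y c)) (R d h * (z d - y d))
    have h4 := abs_sub (edgeResidual R b y h) (R c h * ((z c : ℝ) - y c))
    rw [habs he] at h4
    rw [habs he.symm] at h3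
    linarith
  rcases hd with hd | hd
  · have hS := hE {Sum.inl c, Sum.inl d, Sum.inr h} (by simp [layerRank, hc, hd, hj])
    rw [Finset.sum_insert (by simp [he.ne]), Finset.sum_pair (by simp)] at hS
    simp only [energyTerm, Sum.elim_inl, Sum.elim_inr, hU, if_true] at hS
    have h50 := hP.fifty_mul_le (edgeResidual R b y h)
    rw [← sq_abs (edgeResidual R b y h)] at h50
    refine numeric_edge (hΛ' c hc ⟨h, hU, he.left_ne⟩) (hΛ' d hd ⟨h, hU, he.right_ne⟩)
      (q := y c ^ 2) (q' := y d ^ 2) (e := |edgeResidual R b y h|) ?_ htri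
      (hown c (Or.inl hc)) (hown d (Or.inl hd))
    rw [sq_abs] at *
    linarith
  · obtain ⟨g, hgU, hgj, p, hep, hp, hcons⟩ := hN d hd
    have hresg : edgeResidual R b y g = R d g * (z d - y d) + R p g * (z p - y p) := by
      rw [hep.residual_eq, ← hcons]
      push_cast
      ring
    have hgh : g ≠ h := by
      rintro rfl
      have : p = c := (he.eq_or_eq hep.right_ne).resolve_right hep.ne.symm
      subst this
      exact hne (by rw [← hcons]; ring)
    by_cases hpc : p = c
    · subst hpc
      have hprod : R d g * R d h + R p g * R p h = A g h := by
        have h1 := hR g hgU h hU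
        rw [hep.sum_eq, if_neg hgh, add_zero] at h1
        exact h1
      have h1 := hA.lower g h
      have h2 := hA.upper g h
      have ha := hep.left_eq
      have hb := hep.symm.left_eq
      have hc' := he.left_eq
      have hd' := he.symm.left_eq
      obtain ⟨σ, hσ, hσd, hσp⟩ : ∃ σ : ℤ, σ ^ 2 = 1 ∧ R d h = σ * R d g ∧
          R p h = -σ * R p g := by
        refine ⟨R d g * R d h, ?_⟩
        rcases ha with ha | ha <;> rcases hb with hb | hb <;> rcases hc' with hc' | hc' <;>
          rcases hd' with hd' | hd' <;> rw [ha, hb, hc', hd'] at hprod <;>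
          rw [ha, hb, hc', hd'] <;> omega
      have hS := hE {Sum.inl p, Sum.inl d, Sum.inr g, Sum.inr h}
        (by simp [layerRank, hc, hd, hj, hgj])
      rw [Finset.sum_insert (by simp [he.ne]), Finset.sum_insert (by simp),
        Finset.sum_pair (by simp [hgh])] at hS
      simp only [energyTerm, Sum.elim_inl, Sum.elim_inr, hU, hgU, if_true] at hS
      have hσR : (σ : ℝ) ^ 2 = 1 := by exact_mod_cast hσ
      have hd2 : (R d g : ℝ) ^ 2 = 1 := by exact_mod_cast hep.left
      have hp2 : (R p g : ℝ) ^ 2 = 1 := by exact_mod_cast hep.right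
      refine hP.numeric_double (r := σ * r) (zd := R p g * z p) (zx := R d g * z d)
        (u := R p g * (z p - y p)) (w := R d g * (z d - y d)) (Λ := Λ)
        (mul_ne_zero (by rintro rfl; norm_num at hσ) hr0) ?_ ?_ ?_
      · rw [mul_pow, hep.right, one_mul]
        exact hz p (Or.inl hc)
      · rw [mul_pow, hp2, one_mul]
        exact hΛ p hc ⟨h, hU, he.left_ne⟩
      · have e1 : (((R p g * z p : ℤ) : ℝ) - R p g * (z p - y p)) ^ 2 = y p ^ 2 := by
          push_cast
          rw [← mul_sub, mul_pow, hp2]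
          ring
        have e2 : (((R d g * z d : ℤ) : ℝ) - R d g * (z d - y d)) ^ 2 = y d ^ 2 := by
          push_cast
          rw [← mul_sub, mul_pow, hd2]
          ring
        have e3 : (((σ * r : ℤ) : ℝ) + (R d g * (z d - y d) - R p g * (z p - y p))) ^ 2 =
            edgeResidual R b y h ^ 2 := by
          have h5 : ((σ * r : ℤ) : ℝ) + (R d g * (z d - y d) - R p g * (z p - y p)) =
              σ * edgeResidual R b y h := by
            rw [hres, hσd, hσp]
            push_cast
            linear_combination (-(R d g : ℝ) * (z d - y d) + R p g * (z p - y p)) * hσR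
          rw [h5, mul_pow, hσR, one_mul]
        rw [e1, e2, e3, ← hresg]
        linarith
    · have hS := hE {Sum.inl c, Sum.inl p, Sum.inl d, Sum.inr g, Sum.inr h}
        (by simp [layerRank, hc, hd, hj, hgj, hp])
      rw [Finset.sum_insert (by simp [he.ne, Ne.symm hpc]),
        Finset.sum_insert (by simp [hep.ne.symm]),
        Finset.sum_insert (by simp), Finset.sum_pair (by simp [hgh])] at hS
      simp only [energyTerm, Sum.elim_inl, Sum.elim_inr, hU, hgU, if_true] at hS
      have h50 := hP.fifty_mul_le (edgeResidual R b y h)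
      have h50' := hP.fifty_mul_le (edgeResidual R b y g)
      have htri' : |(z d : ℝ) - y d| ≤ |(z p : ℝ) - y p| + |edgeResidual R b y g| := by
        have h2 : (R d g : ℝ) * (z d - y d) = edgeResidual R b y g - R p g * (z p - y p) := by
          rw [hresg]
          ring
        rw [← habs hep, h2]
        have h4 := abs_sub (edgeResidual R b y g) (R p g * ((z p : ℝ) - y p))
        rw [habs hep.symm] at h4
        linarith
      have hsc := hΛ' c hc ⟨h, hU, he.left_ne⟩
      have hsp := hΛ' p hp ⟨g, hgU, hep.right_ne⟩
      refine numeric_path (Λ := Λ + κ) hsc hsp (e₁ := |edgeResidual R b y g|)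
        (e₂ := |edgeResidual R b y h|)
        ?_ (numeric_own (abs_nonneg _) hsc (by linarith) (hown c (Or.inl hc)))
        (numeric_own (abs_nonneg _) hsp (by linarith) (hown p (Or.inl hp))) htri' (by linarith)
        (hown d (Or.inr hd))
      rw [sq_abs, sq_abs]
      linarith

variable [Fintype V]

theorem energyBelow_nonneg (hδ : 0 ≤ δ) (j : ℕ) : 0 ≤ energyBelow R U b δ y ℓ dep j :=
  Finset.sum_nonneg fun _ _ => energyTerm_nonneg hδ _

theorem energyBelow_add_le (hδ : 0 ≤ δ) {j k : ℕ} (hjk : j ≤ k) (S : Finset (C ⊕ V))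
    (hS : ∀ i ∈ S, j ≤ layerRank ℓ dep i ∧ layerRank ℓ dep i < k) :
    energyBelow R U b δ y ℓ dep j + ∑ i ∈ S, energyTerm R U b δ y i ≤
      energyBelow R U b δ y ℓ dep k := by
  classical
  unfold energyBelow
  rw [← Finset.sum_union]
  · refine Finset.sum_le_sum_of_subset_of_nonneg (fun i hi => ?_)
      fun i _ _ => energyTerm_nonneg hδ i
    rcases Finset.mem_union.1 hi with hi | hi
    · simp only [Finset.mem_filter, Finset.mem_univ, true_and] at hi ⊢
      omega
    · simpa using (hS i hi).2
  · rw [Finset.disjoint_right]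
    intro i hi hi'
    have := (hS i hi).1
    simp only [Finset.mem_filter, Finset.mem_univ, true_and] at hi'
    omega

theorem energyBelow_add_le_total (hδ : 0 ≤ δ) {j : ℕ} (S : Finset (C ⊕ V))
    (hS : ∀ i ∈ S, j ≤ layerRank ℓ dep i) :
    energyBelow R U b δ y ℓ dep j + ∑ i ∈ S, energyTerm R U b δ y i ≤
      ∑ i, energyTerm R U b δ y i := by
  classical
  unfold energyBelow
  rw [← Finset.sum_union]
  · exact Finset.sum_le_sum_of_subset_of_nonneg (Finset.subset_univ _)
      fun i _ _ => energyTerm_nonneg hδ i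
  · rw [Finset.disjoint_right]
    intro i hi hi'
    have := hS i hi
    simp only [Finset.mem_filter, Finset.mem_univ, true_and] at hi'
    omega

theorem sum_energyTerm : ∑ i, energyTerm R U b δ y i =
    ∑ c, y c ^ 2 + 1 / δ * ∑ h ∈ U, edgeResidual R b y h ^ 2 := by
  rw [Fintype.sum_sum_type, Finset.mul_sum]
  simp [energyTerm]

/-- Smallness of the energy is transported along an edge. -/
theorem conduct_step (hδ : 0 < δ) {c p : C} {h : V} {j : ℕ} {K K' κ zc : ℝ} (hK : 0 ≤ K)
    (hKK : K' * (δ + 1 / (1 + K)) ≤ 1) (hh : h ∈ U) (hℓ : ℓ h = j) (he : IsEdge R h p c)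
    (hp : dep p + 1 = j) (hpK : K * y p ^ 2 ≤ energyBelow R U b δ y ℓ dep j + κ)
    (hb : (b h : ℝ) = R c h * zc) :
    K' * (zc - y c) ^ 2 ≤ energyBelow R U b δ y ℓ dep (j + 1) + κ := by
  classical
  have h1 := energyBelow_add_le (R := R) (U := U) (b := b) (y := y) (ℓ := ℓ) (dep := dep) hδ.le
    (Nat.le_succ j) {Sum.inl p, Sum.inr h} (by simp [layerRank, hp, hℓ])
  rw [Finset.sum_pair (by simp)] at h1
  simp only [energyTerm, Sum.elim_inl, Sum.elim_inr, hh, if_true] at h1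
  rw [he.residual_eq, hb] at h1
  set e := (R c h : ℝ) * zc - (R p h * y p + R c h * y c) with he'
  have hc : (R c h : ℝ) ^ 2 = 1 := by exact_mod_cast he.right
  have hp : (R p h : ℝ) ^ 2 = 1 := by exact_mod_cast he.left
  have h2 : (zc - y c) ^ 2 = (R p h * y p + e) ^ 2 := by
    have : R p h * y p + e = R c h * (zc - y c) := by rw [he']; ring
    rw [this, mul_pow, hc, one_mul]
  have h3 : (zc - y c) ^ 2 ≤ (δ + 1 / (1 + K)) * ((1 + K) * y p ^ 2 + 1 / δ * e ^ 2) := by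
    have h4 : (δ + 1 / (1 + K)) * ((1 + K) * y p ^ 2 + 1 / δ * e ^ 2) - (R p h * y p + e) ^ 2 =
        (δ * (1 + K) * (R p h * y p) - e) ^ 2 / (δ * (1 + K)) +
        (1 - (R p h : ℝ) ^ 2) * (y p ^ 2 + δ * (1 + K) * y p ^ 2) := by
      field_simp
      ring
    rw [hp, sub_self, zero_mul, add_zero] at h4
    have : 0 ≤ (δ * (1 + K) * (R p h * y p) - e) ^ 2 / (δ * (1 + K)) := by positivity
    rw [h2]
    linarith
  have hpos : 0 ≤ (1 + K) * y p ^ 2 + 1 / δ * e ^ 2 := by positivity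
  have h5 : K' * (zc - y c) ^ 2 ≤ (1 + K) * y p ^ 2 + 1 / δ * e ^ 2 := by
    by_cases hK' : 0 ≤ K'
    · calc K' * (zc - y c) ^ 2
          ≤ K' * ((δ + 1 / (1 + K)) * ((1 + K) * y p ^ 2 + 1 / δ * e ^ 2)) :=
            mul_le_mul_of_nonneg_left h3 hK'
        _ = (K' * (δ + 1 / (1 + K))) * ((1 + K) * y p ^ 2 + 1 / δ * e ^ 2) := by ring
        _ ≤ 1 * ((1 + K) * y p ^ 2 + 1 / δ * e ^ 2) := mul_le_mul_of_nonneg_right hKK hpos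
        _ = _ := one_mul _
    · nlinarith [sq_nonneg (zc - y c)]
  linarith

end

theorem abs_le_of_consistent {V C : Type*} [Fintype C] {R : C → V → ℤ} {b : V → ℤ} {y : C → ℝ}
    {h : V} {c d : C} (he : IsEdge R h c d) {z : C → ℤ}
    (hz : R c h * z c + R d h * z d = b h) :
    |(z c : ℝ)| ≤ |(z d : ℝ) - y d| + |y c| + |edgeResidual R b y h| := by
  have hres : edgeResidual R b y h = R c h * (z c - y c) + R d h * (z d - y d) := by
    rw [he.residual_eq, ← hz]
    push_cast
    ring
  have h1 : (R c h : ℝ) * z c =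
      R c h * y c + edgeResidual R b y h - R d h * (z d - y d) := by
    rw [hres]
    ring
  have h2 : |(R c h : ℝ) * z c| = |(z c : ℝ)| := by
    rcases he.left_eq with h | h <;> simp [h]
  have h3 : |(R c h : ℝ) * y c| = |y c| := by
    rcases he.left_eq with h | h <;> simp [h]
  have h4 : |(R d h : ℝ) * (z d - y d)| = |(z d : ℝ) - y d| := by
    rw [abs_mul]
    rcases he.symm.left_eq with h | h <;> simp [h]
  have h5 := abs_sub (R c h * y c + edgeResidual R b y h) (R d h * (z d - y d))
  have h6 := abs_add_le (R c h * y c) (edgeResidual R b y h)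
  rw [← h1, h2, h4] at h5
  rw [h3] at h6
  linarith

/-- Integral rounding of an approximate solution in the two last layers. -/
theorem exists_integral_solution {V C : Type*} [Fintype C] [Fintype V] [DecidableEq V]
    {A : V → V → ℤ} {U : Finset V} {R : C → V → ℤ} {b : V → ℤ} {δ : ℝ} {y : C → ℝ} {ℓ : V → ℕ}
    {dep : C → ℕ} {C₀ κ : ℝ} (hP : Params δ C₀ κ) (hR : IsRep A U R)
    (hA : IsSignedMat A) {j : ℕ} (hb : ∀ h ∈ U, b h ^ 2 ≤ 1)
    (hy : ∑ i, energyTerm R U b δ y i ≤ 2 + δ) (hU : ∀ h ∈ U, ℓ h ≤ j + 2)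
    (hb0 : ∀ h ∈ U, ℓ h ≤ j → b h = 0) (hdep : ∀ h ∈ U, ∀ c, R c h ≠ 0 → dep c ≤ ℓ h)
    (hL₁ : LevelAt U R ℓ dep (j + 1)) (hL₂ : LevelAt U R ℓ dep (j + 2))
    (hΛ : ∀ c, dep c = j → (∃ h ∈ U, R c h ≠ 0) →
      C₀ * y c ^ 2 ≤ energyBelow R U b δ y ℓ dep (j + 1) + κ) :
    ∃ z : C → ℤ, (∀ h ∈ U, ∑ c, R c h * z c = b h) ∧ ∑ c, z c ^ 2 ≤ 2 := by
  classical
  have hδ := hP.δ_pos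
  have hE : ∀ i, ∀ S : Finset (C ⊕ V), (∀ s ∈ S, i ≤ layerRank ℓ dep s) →
      energyBelow R U b δ y ℓ dep i + ∑ s ∈ S, energyTerm R U b δ y s ≤ 2 + δ :=
    fun i S hS => (energyBelow_add_le_total hδ.le S hS).trans hy
  have ex₁ : ∀ c, ∃ x : ℤ, (dep c = j + 1 → ∃ h ∈ U, ℓ h = j + 1 ∧ ∃ d,
      IsEdge R h c d ∧ dep d + 1 = j + 1 ∧ R c h * x = b h) ∧
      (dep c ≠ j + 1 → x = 0) := by
    intro c
    by_cases hc : dep c = j + 1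
    · obtain ⟨h, hh, hj, d, he, hd⟩ := hL₁.exists_parent hc
      refine ⟨R c h * b h, fun _ => ⟨h, hh, hj, d, he, hd, ?_⟩, fun h' => absurd hc h'⟩
      rw [← mul_assoc, ← sq, he.left, one_mul]
    · exact ⟨0, fun h' => absurd h' hc, fun _ => rfl⟩
  choose z₁ hz₁ using ex₁
  have ex₂ : ∀ c, ∃ x : ℤ, (dep c = j + 2 → ∃ h ∈ U, ℓ h = j + 2 ∧ ∃ d,
      IsEdge R h c d ∧ dep d + 1 = j + 2 ∧ R c h * x + R d h * z₁ d = b h) ∧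
      (dep c ≠ j + 2 → x = z₁ c) := by
    intro c
    by_cases hc : dep c = j + 2
    · obtain ⟨h, hh, hj, d, he, hd⟩ := hL₂.exists_parent hc
      refine ⟨R c h * (b h - R d h * z₁ d), fun _ => ⟨h, hh, hj, d, he, hd, ?_⟩,
        fun h' => absurd hc h'⟩
      rw [← mul_assoc, ← sq, he.left, one_mul, sub_add_cancel]
    · exact ⟨z₁ c, fun h' => absurd h' hc, fun _ => rfl⟩
  choose z hz using ex₂
  have hz0 : ∀ c, dep c ≠ j + 1 → dep c ≠ j + 2 → z c = 0 := fun c h1 h2 => by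
    rw [(hz c).2 h2, (hz₁ c).2 h1]
  have hN₁ : ∀ c, dep c = j + 1 → ∃ h ∈ U, ℓ h = j + 1 ∧ ∃ d, IsEdge R h c d ∧
      dep d + 1 = j + 1 ∧ R c h * z c + R d h * z d = b h := by
    intro c hc
    obtain ⟨h, hh, hj, d, he, hd, heq⟩ := (hz₁ c).1 hc
    refine ⟨h, hh, hj, d, he, hd, ?_⟩
    rw [(hz c).2 (by omega), heq, hz0 d (by omega) (by omega), mul_zero, add_zero]
  have hN₂ : ∀ c, dep c = j + 2 → ∃ h ∈ U, ℓ h = j + 2 ∧ ∃ d, IsEdge R h c d ∧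
      dep d + 1 = j + 2 ∧ R c h * z c + R d h * z d = b h := by
    intro c hc
    obtain ⟨h, hh, hj, d, he, hd, heq⟩ := (hz c).1 hc
    refine ⟨h, hh, hj, d, he, hd, ?_⟩
    rw [(hz d).2 (by omega), heq]
  have hΛ₂ : ∀ c, dep c = j + 1 →
      C₀ * ((z c : ℝ) - y c) ^ 2 ≤ energyBelow R U b δ y ℓ dep (j + 2) + κ := by
    intro c hc
    obtain ⟨h, hh, hj, d, he, hd, heq⟩ := hN₁ c hc
    rw [hz0 d (by omega) (by omega), mul_zero, add_zero] at heq
    exact conduct_step hδ (by linarith [hP.C₀_ge]) hP.conduct hh hj he.symm hd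
      (hΛ d (by omega) ⟨h, hh, he.right_ne⟩) (by exact_mod_cast heq.symm)
  have hsmall : 2 + δ + κ ≤ 2.021 := by linarith [hP.δ_le, hP.κ_le]
  have hz1 : ∀ c, z c ^ 2 ≤ 1 := by
    intro c
    by_cases h1 : dep c = j + 1
    · obtain ⟨h, hh, hj, d, he, hd, heq⟩ := hN₁ c h1
      rw [hz0 d (by omega) (by omega), mul_zero, add_zero] at heq
      calc z c ^ 2 = R c h ^ 2 * z c ^ 2 := by rw [he.left, one_mul]
        _ = b h ^ 2 := by rw [← mul_pow, heq]
        _ ≤ 1 := hb h hh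
    by_cases h2 : dep c = j + 2
    · obtain ⟨h, hh, hj, d, he, hd, heq⟩ := hN₂ c h2
      by_contra hlt
      have h2z : (2 : ℝ) ≤ |(z c : ℝ)| := by
        have : (2 : ℤ) ≤ |z c| := by
          by_contra h3
          have h4 : |z c| ≤ 1 := by omega
          have := abs_nonneg (z c)
          rw [← sq_abs] at hlt
          nlinarith
        exact_mod_cast this
      have hS := hE (j + 2) {Sum.inl c, Sum.inr h} (by simp [layerRank, h2, hj])
      rw [Finset.sum_pair (by simp)] at hS
      simp only [energyTerm, Sum.elim_inl, Sum.elim_inr, hh, if_true] at hS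
      have h5 := hΛ₂ d (by omega)
      have h6 := hP.mul_sq_le ((z d : ℝ) - y d)
      have h7 := hP.fifty_mul_le (edgeResidual R b y h)
      refine numeric_two (t := |(z d : ℝ) - y d|) (y := |y c|) (e := |edgeResidual R b y h|) ?_
        (h2z.trans (abs_le_of_consistent he heq))
      simp only [sq_abs]
      linarith
    · simp [hz0 c h1 h2]
  have hcons₁ : ∀ h ∈ U, ℓ h = j + 1 → ∑ c, R c h * z c = b h := by
    intro h hh hj
    refine layer_consistent hP hR hA hL₁ (hE (j + 1)) (fun c _ => hz1 c) (fun c hc hu => ?_) hN₁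
      hh hj
    rw [hz0 c (by omega) (by omega), Int.cast_zero, zero_sub, neg_sq]
    exact hΛ c (by omega) hu
  have hcons₂ : ∀ h ∈ U, ℓ h = j + 2 → ∑ c, R c h * z c = b h := by
    intro h hh hj
    exact layer_consistent hP hR hA hL₂ (hE (j + 2)) (fun c _ => hz1 c)
      (fun c hc _ => hΛ₂ c (by omega)) hN₂ hh hj
  refine ⟨z, fun h hh => ?_, ?_⟩
  · have h1 := hU h hh
    by_cases h2 : ℓ h ≤ j
    · rw [hb0 h hh h2]
      refine Finset.sum_eq_zero fun c _ => ?_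
      by_cases hc : R c h = 0
      · simp [hc]
      · have := hdep h hh c hc
        rw [hz0 c (by omega) (by omega), mul_zero]
    · obtain h3 | h3 : ℓ h = j + 1 ∨ ℓ h = j + 2 := by omega
      · exact hcons₁ h hh h3
      · exact hcons₂ h hh h3
  · by_contra hlt
    have hcard : 2 < (Finset.univ.filter fun c => z c ≠ 0).card := by
      have h1 : ∑ c, z c ^ 2 ≤ ∑ c, if z c ≠ 0 then 1 else 0 := by
        refine Finset.sum_le_sum fun c _ => ?_
        split_ifs with h
        · exact hz1 c
        · simp [not_not.1 h]
      rw [Finset.sum_boole] at h1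
      have h2 : (2 : ℤ) < ((Finset.univ.filter fun c => z c ≠ 0).card : ℤ) := by omega
      exact_mod_cast h2
    obtain ⟨a₁, a₂, a₃, h₁, h₂, h₃, h₁₂, h₁₃, h₂₃⟩ := Finset.two_lt_card_iff.1 hcard
    have key : ∀ c, z c ≠ 0 → ∃ (S : Finset (C ⊕ V)) (t : ℝ),
        (∀ i ∈ S, j + 2 ≤ layerRank ℓ dep i ∧ (i = Sum.inl c ∨ ∃ h d, i = Sum.inr h ∧
          IsEdge R h c d ∧ dep d = j + 1 ∧ dep c = j + 2)) ∧ 0 ≤ t ∧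
        6.6 * t ^ 2 ≤ energyBelow R U b δ y ℓ dep (j + 2) + κ ∧
        ∀ T, T ≤ 1 → t ≤ T → 50 / 51 * (1 - T) ^ 2 ≤ ∑ i ∈ S, energyTerm R U b δ y i := by
      intro c hc
      have hone : (1 : ℝ) ≤ |(z c : ℝ)| := by exact_mod_cast Int.one_le_abs hc
      by_cases h1 : dep c = j + 1
      · refine ⟨{Sum.inl c}, |(z c : ℝ) - y c|, by simp [layerRank, h1], abs_nonneg _, ?_, ?_⟩
        · rw [sq_abs]
          exact (hP.mul_sq_le _).trans (hΛ₂ c h1)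
        · intro T hT ht
          have h2 := abs_sub_abs_le_abs_sub (z c : ℝ) (y c)
          have := numeric_three_term (y := |y c|) (e := 0) hT ht (by linarith)
          simpa [energyTerm] using this
      · have h2 : dep c = j + 2 := by
          by_contra h2
          exact hc (hz0 c h1 h2)
        obtain ⟨h, hh, hj, d, he, hd, heq⟩ := hN₂ c h2
        refine ⟨{Sum.inl c, Sum.inr h}, |(z d : ℝ) - y d|, ?_, abs_nonneg _, ?_, ?_⟩
        · simp only [Finset.mem_insert, Finset.mem_singleton]
          rintro i (rfl | rfl)
          · exact ⟨by simp [layerRank, h2], Or.inl rfl⟩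
          · exact ⟨by simp [layerRank, hj], Or.inr ⟨h, d, rfl, he, by omega, h2⟩⟩
        · rw [sq_abs]
          exact (hP.mul_sq_le _).trans (hΛ₂ d (by omega))
        · intro T hT ht
          have h3 := numeric_three_term (y := |y c|) (e := |edgeResidual R b y h|) hT ht
            (by linarith [abs_le_of_consistent (y := y) he heq])
          rw [Finset.sum_pair (by simp)]
          simp only [energyTerm, Sum.elim_inl, Sum.elim_inr, hh, if_true]
          rw [sq_abs, sq_abs] at h3
          linarith [hP.fifty_mul_le (edgeResidual R b y h)]
    simp only [Finset.mem_filter, Finset.mem_univ, true_and] at h₁ h₂ h₃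
    obtain ⟨S₁, t₁, hS₁, ht₁0, ht₁, hq₁⟩ := key a₁ h₁
    obtain ⟨S₂, t₂, hS₂, ht₂0, ht₂, hq₂⟩ := key a₂ h₂
    obtain ⟨S₃, t₃, hS₃, ht₃0, ht₃, hq₃⟩ := key a₃ h₃
    have hdisj : ∀ {c c' : C} {S S' : Finset (C ⊕ V)}, c ≠ c' →
        (∀ i ∈ S, j + 2 ≤ layerRank ℓ dep i ∧ (i = Sum.inl c ∨ ∃ h d, i = Sum.inr h ∧
          IsEdge R h c d ∧ dep d = j + 1 ∧ dep c = j + 2)) →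
        (∀ i ∈ S', j + 2 ≤ layerRank ℓ dep i ∧ (i = Sum.inl c' ∨ ∃ h d, i = Sum.inr h ∧
          IsEdge R h c' d ∧ dep d = j + 1 ∧ dep c' = j + 2)) → Disjoint S S' := by
      intro c c' S S' hne hS hS'
      rw [Finset.disjoint_left]
      intro i hi hi'
      rcases (hS i hi).2 with rfl | ⟨h, d, rfl, he, hd, hc⟩ <;>
        rcases (hS' _ hi').2 with h' | ⟨h', d', h'', he', hd', hc'⟩
      · exact hne (Sum.inl_injective h')
      · exact absurd h'' (by simp)
      · exact absurd h' (by simp)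
      · obtain rfl := Sum.inr_injective h''
        rcases he.eq_or_eq he'.left_ne with h4 | h4
        · exact hne h4.symm
        · rw [h4] at hc'
          omega
    have hS := hE (j + 2) (S₁ ∪ S₂ ∪ S₃) (by
      intro i hi
      simp only [Finset.mem_union] at hi
      rcases hi with (hi | hi) | hi
      · exact (hS₁ i hi).1
      · exact (hS₂ i hi).1
      · exact (hS₃ i hi).1)
    rw [Finset.sum_union (Finset.disjoint_union_left.2 ⟨hdisj h₁₃ hS₁ hS₃, hdisj h₂₃ hS₂ hS₃⟩),
      Finset.sum_union (hdisj h₁₂ hS₁ hS₂)] at hS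
    obtain ⟨T, hT, hT₁, hT₂, hT₃⟩ : ∃ T, 6.6 * T ^ 2 ≤
        energyBelow R U b δ y ℓ dep (j + 2) + κ ∧ t₁ ≤ T ∧ t₂ ≤ T ∧ t₃ ≤ T := by
      refine ⟨max t₁ (max t₂ t₃), ?_, by simp, by simp, by simp⟩
      rcases max_choice t₁ (max t₂ t₃) with h | h <;> rw [h]
      · exact ht₁
      · rcases max_choice t₂ t₃ with h | h <;> rw [h] <;> assumption
    have hT1 : T ≤ 1 := by
      have := hE (j + 2) ∅ (by simp)
      rw [Finset.sum_empty] at this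
      nlinarith
    exact numeric_three (by linarith) (hq₁ T hT1 hT₁) (hq₂ T hT1 hT₂) (hq₃ T hT1 hT₃)

section

variable {V C : Type*} [Fintype C] [DecidableEq V] {A : V → V → ℤ} {U : Finset V} {R : C → V → ℤ}
  {ℓ : V → ℕ} {dep : C → ℕ}

theorem IsRep.exists_common (hR : IsRep A U R) {g h : V} (hg : g ∈ U) (hh : h ∈ U) (hne : g ≠ h)
    (hA : A g h ≠ 0) : ∃ c, R c g ≠ 0 ∧ R c h ≠ 0 := by
  have h1 := hR g hg h hh
  rw [if_neg hne, add_zero] at h1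
  obtain ⟨c, -, hc⟩ := Finset.exists_ne_zero_of_sum_ne_zero (h1.trans_ne hA)
  exact ⟨c, left_ne_zero_of_mul hc, right_ne_zero_of_mul hc⟩

theorem IsRep.inner_eq (hR : IsRep A U R) {g h : V} (hg : g ∈ U) (hh : h ∈ U) (hne : g ≠ h)
    {c d : C} (he : IsEdge R g c d) : R c g * R c h + R d g * R d h = A g h := by
  classical
  have h1 := hR g hg h hh
  rwa [if_neg hne, add_zero, he.sum_eq] at h1

/-- Nonadjacent elements sharing a coordinate share both coordinates. -/
theorem IsRep.twins (hR : IsRep A U R) {g h : V} (hg : g ∈ U) (hh : h ∈ U)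
    (hne : g ≠ h) (h0 : A g h = 0) {c d : C} (he : IsEdge R g c d) (hc : R c h ≠ 0) :
    R d h ≠ 0 := by
  intro hd
  have h1 := hR.inner_eq hg hh hne he
  rw [hd, mul_zero, add_zero, h0] at h1
  rcases mul_eq_zero.1 h1 with h1 | h1
  · exact he.left_ne h1
  · exact hc h1

/-- Twins have the same neighbours. -/
theorem IsRep.twins_adj (hR : IsRep A U R) (hA : IsSignedMat A) {g h k : V} (hg : g ∈ U)
    (hh : h ∈ U) (hk : k ∈ U) {c d : C} (he : IsEdge R g c d) (he' : IsEdge R h c d)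
    (hkg : A k g ≠ 0) (hkh : k ≠ h) : A k h ≠ 0 := by
  have hkg' : g ≠ k := by
    rintro rfl
    exact hkg (hA.diag _)
  have h1 := hR.inner_eq hg hk hkg' he
  have h2 := hR.inner_eq hh hk hkh.symm he'
  rw [hA.symm] at h1 h2
  have h3 := hA.lower k g
  have h4 := hA.upper k g
  rw [← h1] at h3 h4 hkg
  rw [← h2]
  rcases he.left_eq with e1 | e1 <;> rcases he.symm.left_eq with e2 | e2 <;>
    rcases he'.left_eq with e3 | e3 <;> rcases he'.symm.left_eq with e4 | e4 <;>
    rw [e1, e2] at h3 h4 hkg <;> rw [e3, e4] <;>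
    rcases hR.sq_le_one hA hk c with e5 | e5 <;> rcases hR.sq_le_one hA hk d with e6 | e6 <;>
    first
    | (rw [e5] at h3 h4 hkg ⊢; omega)
    | (rw [e6] at h3 h4 hkg ⊢; omega)
    | (exfalso
       have h5 : (R c k - 1) * (R c k + 1) = 0 := by linarith
       have h6 : (R d k - 1) * (R d k + 1) = 0 := by linarith
       rcases mul_eq_zero.1 h5 with h5 | h5 <;> rcases mul_eq_zero.1 h6 with h6 | h6 <;> omega)

/-- A distance function yields the layer structure of a represented set. -/
theorem IsRep.levelAt (hR : IsRep A U R) (hA : IsSignedMat A)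
    (hlip : ∀ g h, A g h ≠ 0 → ℓ g ≤ ℓ h + 1) {j : ℕ}
    (hdown : ∀ h ∈ U, 2 ≤ ℓ h → ℓ h ≤ j → ∃ g ∈ U, A g h ≠ 0 ∧ ℓ g + 1 = ℓ h) (hj : 2 ≤ j)
    (hbot : ∀ g ∈ U, ∀ h ∈ U, ℓ g ≤ 1 → ℓ h = j → ∀ c d, IsEdge R g c d → IsEdge R h c d →
      A g h ≠ 0)
    (hdep : ∀ h ∈ U, ∀ c, R c h ≠ 0 → dep c ≤ ℓ h)
    (hdep' : ∀ c, 1 ≤ dep c → ∃ h ∈ U, ℓ h = dep c ∧ R c h ≠ 0)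
    (hpos : ∀ h ∈ U, ℓ h = j → ∀ c, R c h ≠ 0 → 1 ≤ dep c) : LevelAt U R ℓ dep j := by
  refine ⟨fun h hh hℓ => ?_, fun c hc => ?_⟩
  · have key : ∀ c, R c h ≠ 0 → j ≤ dep c + 1 ∧ dep c ≤ j := by
      intro c hc
      refine ⟨?_, (hdep h hh c hc).trans_eq hℓ⟩
      by_contra hlt
      obtain ⟨g, hg, hgℓ, hgc⟩ := hdep' c (hpos h hh hℓ c hc)
      have hne : g ≠ h := by
        rintro rfl
        omega
      have h0 : A g h = 0 := by
        by_contra h0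
        have := hlip h g (by rwa [hA.symm])
        omega
      obtain ⟨d, he⟩ := hR.exists_isEdge hA hg hgc
      have hd := hR.twins hg hh hne h0 he hc
      have he' : IsEdge R h c d := by
        obtain ⟨d', hd'⟩ := hR.exists_isEdge hA hh hc
        rcases hd'.eq_or_eq hd with h1 | h1
        · exact absurd h1 he.ne.symm
        · rwa [h1]
      by_cases hg1 : ℓ g ≤ 1
      · exact hbot g hg h hh hg1 hℓ c d he he' h0
      · obtain ⟨k, hk, hkg, hkℓ⟩ := hdown g hg (by omega) (by omega)
        have h1 := hR.twins_adj hA hg hh hk he he' hkg (by rintro rfl; omega)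
        have := hlip h k (by rwa [hA.symm])
        omega
    obtain ⟨g, hg, hgh, hgℓ⟩ := hdown h hh (by omega) (by omega)
    obtain ⟨c, hcg, hch⟩ := hR.exists_common hg hh (by rintro rfl; omega) hgh
    obtain ⟨d, he⟩ := hR.exists_isEdge hA hh hch
    have h1 := hdep g hg c hcg
    have h2 := key c hch
    have h3 := key d he.right_ne
    exact ⟨c, d, he, by omega, by omega⟩
  · obtain ⟨h, hh, hℓ, hne⟩ := hdep' c (by omega)
    exact ⟨h, hh, by omega, hne⟩

theorem conduct_chain [Fintype V] {b : V → ℤ} {δ κ : ℝ} {y : C → ℝ} (hδ : 0 < δ) {K : ℕ → ℝ}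
    (hK : ∀ n, 0 ≤ K n) (hKs : ∀ n, K (n + 1) * (δ + 1 / (1 + K n)) ≤ 1) {i j : ℕ}
    (hb0 : ∀ h ∈ U, ℓ h ≤ j → b h = 0) (hL : ∀ n, i < n → n ≤ j → LevelAt U R ℓ dep n)
    (hbase : ∀ c, dep c = i → (∃ h ∈ U, R c h ≠ 0) →
      K 0 * y c ^ 2 ≤ energyBelow R U b δ y ℓ dep (i + 1) + κ) (n : ℕ) (hn : i + n ≤ j) :
    ∀ c, dep c = i + n → (∃ h ∈ U, R c h ≠ 0) →
      K n * y c ^ 2 ≤ energyBelow R U b δ y ℓ dep (i + n + 1) + κ := by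
  induction n with
  | zero => exact hbase
  | succ n ih =>
    intro c hc _
    obtain ⟨h, hh, hj, d, he, hd⟩ := (hL (i + n + 1) (by omega) (by omega)).exists_parent hc
    have := conduct_step hδ (hK n) (hKs n) hh hj he.symm hd
      (ih (by omega) d (by omega) ⟨h, hh, he.right_ne⟩) (zc := 0)
      (by rw [hb0 h hh (by omega)]; simp)
    rwa [zero_sub, neg_sq] at this

end

/-- Extension of a representation to a vertex far from the root. -/
theorem DRep.insert_of_far {V : Type*} [Fintype V] [DecidableEq V] {A : V → V → ℤ} {U : Finset V}
    {ℓ : V → ℕ} {δ C₀ κ : ℝ} (hP : Params δ C₀ κ) (hA : IsSignedMat A)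
    (hgood : ∀ x, 0 ≤ qform A (2 + δ) x) {K : ℕ → ℝ} (hK0 : K 0 = 0) (hK : ∀ n, 0 ≤ K n)
    (hKs : ∀ n, K (n + 1) * (δ + 1 / (1 + K n)) ≤ 1) {n₀ : ℕ} (hKn : C₀ ≤ K n₀)
    (hpos : ∀ h, 1 ≤ ℓ h) (hlip : ∀ g h, A g h ≠ 0 → ℓ g ≤ ℓ h + 1)
    (hdown : ∀ h, 2 ≤ ℓ h → ∃ g, A g h ≠ 0 ∧ ℓ g + 1 = ℓ h) (hU : DRep A U) {v : V} (hv : v ∉ U)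
    (hle : ∀ h ∈ U, ℓ h ≤ ℓ v) (hlt : ∀ g, ℓ g < ℓ v → g ∈ U) (hfar : n₀ + 5 ≤ ℓ v) :
    DRep A (insert v U) := by
  obtain ⟨C, _, R, hR⟩ := hU
  obtain ⟨y, hy⟩ := hR.exists_energy_le hA hP.δ_pos hgood hv
  obtain ⟨k, hk⟩ : ∃ k, ℓ v = k + 2 := ⟨ℓ v - 2, by omega⟩
  set dep : C → ℕ := fun c => sInf (ℓ '' {h | h ∈ U ∧ R c h ≠ 0}) with hdepdef
  have hdep : ∀ h ∈ U, ∀ c, R c h ≠ 0 → dep c ≤ ℓ h := fun h hh c hc =>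
    Nat.sInf_le ⟨h, ⟨hh, hc⟩, rfl⟩
  have hdep'' : ∀ c, (∃ h ∈ U, R c h ≠ 0) → ∃ h ∈ U, ℓ h = dep c ∧ R c h ≠ 0 := by
    rintro c ⟨h, hh, hc⟩
    obtain ⟨g, ⟨hg, hgc⟩, hgℓ⟩ := Nat.sInf_mem (s := ℓ '' {h | h ∈ U ∧ R c h ≠ 0})
      ⟨_, ⟨h, ⟨hh, hc⟩, rfl⟩⟩
    exact ⟨g, hg, hgℓ, hgc⟩
  have hdep' : ∀ c, 1 ≤ dep c → ∃ h ∈ U, ℓ h = dep c ∧ R c h ≠ 0 := by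
    intro c hc
    refine hdep'' c ?_
    by_contra! hemp
    have : ℓ '' {h | h ∈ U ∧ R c h ≠ 0} = ∅ := by
      rw [Set.image_eq_empty, Set.eq_empty_iff_forall_notMem]
      exact fun h hh => hh.2 (hemp h hh.1)
    simp only [hdepdef] at hc
    rw [this, Nat.sInf_empty] at hc
    omega
  have hdownU : ∀ h ∈ U, 2 ≤ ℓ h → ∃ g ∈ U, A g h ≠ 0 ∧ ℓ g + 1 = ℓ h := by
    intro h hh h2
    obtain ⟨g, hg, hgℓ⟩ := hdown h h2
    exact ⟨g, hlt g (by have := hle h hh; omega), hg, hgℓ⟩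
  have hL : ∀ j, 4 ≤ j → LevelAt U R ℓ dep j := by
    intro j hj
    refine hR.levelAt hA hlip (fun h hh h2 _ => hdownU h hh h2) (by omega) ?_ hdep hdep' ?_
    · intro g hg h hh hg1 hℓ c d he he' _
      obtain ⟨k, hk, hkh, hkℓ⟩ := hdownU h hh (by omega)
      have := hlip k g (hR.twins_adj hA hh hg hk he' he hkh (by rintro rfl; omega))
      omega
    · intro h hh _ c hc
      obtain ⟨g, -, hg, -⟩ := hdep'' c ⟨h, hh, hc⟩
      rw [← hg]
      exact hpos g
  have hb0 : ∀ h ∈ U, ℓ h ≤ k → A v h = 0 := by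
    intro h _ hh
    by_contra h0
    have := hlip v h h0
    omega
  obtain ⟨z, hz, hz2⟩ := exists_integral_solution (b := A v) (y := y) (ℓ := ℓ) (dep := dep) (j := k)
    hP hR hA (fun h _ => by
      have h1 := hA.lower v h
      have h2 := hA.upper v h
      nlinarith) (by
        rw [sum_energyTerm]
        exact hy) (fun h hh => (hle h hh).trans_eq hk) hb0 hdep (hL _ (by omega))
      (hL _ (by omega)) (by
        intro c hc hu
        have hcz := conduct_chain (b := A v) (y := y) (κ := κ) (i := k - n₀) (j := k)
          hP.δ_pos hK hKs
          hb0 (fun n hn _ => hL n (by omega)) (by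
            intro c _ _
            rw [hK0, zero_mul]
            exact add_nonneg (energyBelow_nonneg hP.δ_pos.le _) hP.κ_pos.le) n₀ (by omega) c
            (by omega) hu
        rw [Nat.sub_add_cancel (by omega)] at hcz
        exact (mul_le_mul_of_nonneg_right hKn (sq_nonneg _)).trans hcz)
  exact hR.extend hA hv z hz hz2

/-- Induction over the initial segments of a finite set ordered by `ℓ`. -/
theorem initialSegment_induction {V : Type*} [Fintype V] [DecidableEq V] (ℓ : V → ℕ)
    (P : Finset V → Prop) (U₀ : Finset V) (h₀ : P U₀) (hseg : ∀ h ∈ U₀, ∀ g, g ∉ U₀ → ℓ h ≤ ℓ g)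
    (step : ∀ U v, U₀ ⊆ U → P U → v ∉ U → (∀ h ∈ U, ℓ h ≤ ℓ v) → (∀ g, ℓ g < ℓ v → g ∈ U) →
      P (insert v U)) : P Finset.univ := by
  suffices H : ∀ n, ∀ U : Finset V, Uᶜ.card = n → U₀ ⊆ U → P U →
      (∀ h ∈ U, ∀ g, g ∉ U → ℓ h ≤ ℓ g) → P Finset.univ from H _ U₀ rfl subset_rfl h₀ hseg
  intro n
  induction n with
  | zero =>
    intro U hn _ hU _
    rw [Finset.card_eq_zero, Finset.compl_eq_empty_iff] at hn
    rwa [← hn]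
  | succ n ih =>
    intro U hn hsub hU hs
    obtain ⟨v, hv, hmin⟩ := Finset.exists_min_image Uᶜ ℓ (Finset.card_pos.1 (by omega))
    rw [Finset.mem_compl] at hv
    refine ih (insert v U) ?_ (hsub.trans (Finset.subset_insert _ _))
      (step U v hsub hU hv (fun h hh => hs h hh v hv) ?_) ?_
    · rw [Finset.card_compl] at hn ⊢
      rw [Finset.card_insert_of_notMem hv]
      omega
    · intro g hg
      by_contra hgU
      have := hmin g (Finset.mem_compl.2 hgU)
      omega
    · intro h hh g hg
      simp only [Finset.mem_insert, not_or] at hh hg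
      rcases hh with rfl | hh
      · exact hmin g (Finset.mem_compl.2 hg.2)
      · exact hs h hh g hg.2

/-- The underlying graph of a signed graph. -/
def adjGraph {V : Type*} (A : V → V → ℤ) : SimpleGraph V :=
  SimpleGraph.fromRel fun u v => A u v ≠ 0

theorem IsSignedMat.adj_iff {V : Type*} {A : V → V → ℤ} (hA : IsSignedMat A) {u v : V} :
    (adjGraph A).Adj u v ↔ A u v ≠ 0 := by
  rw [adjGraph, SimpleGraph.fromRel_adj, hA.symm v u, or_self, and_iff_right_iff_imp]
  rintro h rfl
  exact h (hA.diag _)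

namespace SimpleGraph

variable {V : Type*} {G : SimpleGraph V} {S : Set V}

/-- The distance of a vertex from a set of vertices. -/
noncomputable def setDist (G : SimpleGraph V) (S : Set V) (v : V) : ℕ :=
  sInf ((fun s => G.dist s v) '' S)

theorem setDist_singleton (r v : V) : G.setDist {r} v = G.dist r v := by
  simp [setDist]

theorem setDist_le {s : V} (hs : s ∈ S) (v : V) : G.setDist S v ≤ G.dist s v :=
  Nat.sInf_le ⟨s, hs, rfl⟩

theorem exists_setDist_eq (hS : S.Nonempty) (v : V) : ∃ s ∈ S, G.dist s v = G.setDist S v :=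
  Nat.sInf_mem (hS.image _)

theorem Connected.setDist_eq_zero (hG : G.Connected) (hS : S.Nonempty) {v : V} :
    G.setDist S v = 0 ↔ v ∈ S := by
  constructor
  · intro h
    obtain ⟨s, hs, hd⟩ := exists_setDist_eq (G := G) hS v
    rw [h, hG.dist_eq_zero_iff] at hd
    exact hd ▸ hs
  · intro h
    simpa using setDist_le (G := G) h v

theorem Connected.setDist_le_succ (hG : G.Connected) (hS : S.Nonempty) {g h : V} (ha : G.Adj g h) :
    G.setDist S g ≤ G.setDist S h + 1 := by
  obtain ⟨s, hs, hd⟩ := exists_setDist_eq (G := G) hS h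
  have h1 := hG.dist_triangle (u := s) (v := h) (w := g)
  rw [dist_eq_one_iff_adj.2 ha.symm] at h1
  have := setDist_le (G := G) hs g
  omega

theorem Connected.exists_adj_setDist (hG : G.Connected) (hS : S.Nonempty) {h : V}
    (hh : 1 ≤ G.setDist S h) : ∃ g, G.Adj g h ∧ G.setDist S g + 1 = G.setDist S h := by
  obtain ⟨s, hs, hd⟩ := exists_setDist_eq (G := G) hS h
  obtain ⟨w, hw⟩ := hG.exists_walk_length_eq_dist s h
  have ha := w.adj_getVert_succ (i := w.length - 1) (by omega)
  rw [Nat.sub_add_cancel (by omega), w.getVert_length] at ha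
  refine ⟨_, ha, ?_⟩
  have h1 := setDist_le (G := G) hs (w.getVert (w.length - 1))
  have h2 := dist_le (w.take (w.length - 1))
  rw [Walk.take_length] at h2
  have h3 := hG.setDist_le_succ hS ha.symm
  omega

/-- The vertices at distance at most `n` from `r`. -/
noncomputable def distBall [Fintype V] (G : SimpleGraph V) (r : V) (n : ℕ) : Finset V :=
  open Classical in {v | G.dist r v ≤ n}

theorem mem_distBall [Fintype V] {r v : V} {n : ℕ} : v ∈ G.distBall r n ↔ G.dist r v ≤ n := by
  simp [distBall]

theorem Connected.exists_adj_dist (hG : G.Connected) {r h : V} {n : ℕ} (hh : G.dist r h = n + 1) :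
    ∃ g, G.Adj g h ∧ G.dist r g = n := by
  obtain ⟨g, hg, hd⟩ := hG.exists_adj_setDist (Set.singleton_nonempty r) (h := h)
    (by rw [setDist_singleton]; omega)
  rw [setDist_singleton, setDist_singleton] at hd
  exact ⟨g, hg, by omega⟩

theorem Connected.card_distBall_le [Fintype V] (hG : G.Connected) {Δ : ℕ}
    (hΔ : ∀ v, {u | G.Adj v u}.ncard ≤ Δ) (r : V) (n : ℕ) :
    (G.distBall r n).card ≤ (Δ + 1) ^ n := by
  classical
  induction n with
  | zero =>
    rw [pow_zero, Finset.card_le_one]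
    intro a ha b hb
    rw [mem_distBall, Nat.le_zero, hG.dist_eq_zero_iff] at ha hb
    exact ha.symm.trans hb
  | succ n ih =>
    have hsub : G.distBall r (n + 1) ⊆
        (G.distBall r n).biUnion fun v => insert v (Finset.univ.filter fun u => G.Adj v u) := by
      intro x hx
      rw [mem_distBall] at hx
      rw [Finset.mem_biUnion]
      rcases hx.lt_or_eq with hx | hx
      · exact ⟨x, mem_distBall.2 (by omega), Finset.mem_insert_self _ _⟩
      · obtain ⟨g, hg, hd⟩ := hG.exists_adj_dist hx
        exact ⟨g, mem_distBall.2 hd.le, Finset.mem_insert_of_mem (by simpa using hg)⟩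
    refine (Finset.card_le_card hsub).trans ((Finset.card_biUnion_le_card_mul _ _ (Δ + 1)
      fun v _ => (Finset.card_insert_le _ _).trans ?_).trans ?_)
    · have h1 : (Finset.univ.filter fun u => G.Adj v u).card = {u | G.Adj v u}.ncard := by
        rw [← Set.ncard_coe_finset]
        simp
      have := hΔ v
      omega
    · rw [pow_succ]
      exact Nat.mul_le_mul_right _ ih

theorem Connected.exists_geodesic (hG : G.Connected) (r : V) (n : ℕ) : ∀ x, G.dist r x = n →
    ∃ p : ℕ → V, p n = x ∧ (∀ i ≤ n, G.dist r (p i) = i) ∧ ∀ i < n, G.Adj (p i) (p (i + 1)) := by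
  induction n with
  | zero => exact fun x hx => ⟨fun _ => x, rfl, fun i hi => by rw [hx]; omega, fun i hi => by omega⟩
  | succ n ih =>
    intro x hx
    obtain ⟨g, hg, hd⟩ := hG.exists_adj_dist hx
    obtain ⟨p, hp, h1, h2⟩ := ih g hd
    refine ⟨fun i => if i ≤ n then p i else x, by simp, fun i hi => ?_, fun i hi => ?_⟩
    · by_cases h : i ≤ n
      · simp [h, h1 i h]
      · simp only [h, if_false, hx]
        omega
    · by_cases h : i + 1 ≤ n
      · simp [h, (by omega : i ≤ n), h2 i (by omega)]
      · obtain rfl : i = n := by omega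
        simpa [hp] using hg

end SimpleGraph

/-- The numbers `K n` bound the conductances of coordinates at depth `n` from below. -/
structure IsConduct (δ C₀ : ℝ) (K : ℕ → ℝ) (n₀ : ℕ) : Prop where
  zero : K 0 = 0
  nonneg : ∀ n, 0 ≤ K n
  step : ∀ n, K (n + 1) * (δ + 1 / (1 + K n)) ≤ 1
  le : C₀ ≤ K n₀

theorem dRep_geodesic {V : Type*} [DecidableEq V] {A : V → V → ℤ} (hA : IsSignedMat A)
    {d : V → ℕ} (hd : ∀ g h, A g h ≠ 0 → d g ≤ d h + 1)
    {p : ℕ → V} {m : ℕ} (hp : ∀ i ≤ m, d (p i) = i) (ha : ∀ i < m, A (p i) (p (i + 1)) ≠ 0) :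
    DRep A ((Finset.range (m + 1)).image p) := by
  set s : ℕ → ℤ := fun i => if i < m then A (p i) (p (i + 1)) else 1 with hs
  have hs1 : ∀ i, s i * s i = 1 := by
    intro i
    by_cases hi : i < m
    · have h1 := hA.lower (p i) (p (i + 1))
      have h2 := hA.upper (p i) (p (i + 1))
      have h3 := ha i hi
      simp only [hs, hi, if_true]
      obtain h | h : A (p i) (p (i + 1)) = 1 ∨ A (p i) (p (i + 1)) = -1 := by omega
      all_goals simp [h]
    · simp [hs, hi]
  refine ⟨Fin (m + 2), inferInstance, fun c x => (if (c : ℕ) = d x then 1 else 0) +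
    s (d x) * if (c : ℕ) = d x + 1 then 1 else 0, ?_⟩
  have key : ∀ i ≤ m, ∀ j ≤ m, i ≤ j → ∑ c : Fin (m + 2),
      ((if (c : ℕ) = d (p i) then 1 else 0) +
        s (d (p i)) * if (c : ℕ) = d (p i) + 1 then 1 else 0) *
      ((if (c : ℕ) = d (p j) then 1 else 0) +
        s (d (p j)) * if (c : ℕ) = d (p j) + 1 then 1 else 0) =
      A (p i) (p j) + if p i = p j then 2 else 0 := by
    intro i hi j hj hij
    rw [hp i hi, hp j hj, Fin.sum_univ_eq_sum_range (fun c =>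
      ((if c = i then 1 else 0) + s i * if c = i + 1 then 1 else 0) *
      ((if c = j then 1 else 0) + s j * if c = j + 1 then 1 else 0)) (m + 2)]
    simp only [add_mul, Finset.sum_add_distrib, ite_mul, mul_ite, one_mul, zero_mul, mul_one,
      mul_zero, Finset.sum_ite_eq', Finset.mem_range, (by omega : i < m + 2),
      (by omega : i + 1 < m + 2), if_true]
    rcases hij.eq_or_lt with rfl | hij
    · simp [hs1, hA.diag]
    · have hne : p i ≠ p j := by
        intro h
        have := hp j hj
        rw [← h, hp i hi] at this
        omega
      rcases Nat.lt_or_ge (i + 1) j with h | h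
      · have h0 : A (p i) (p j) = 0 := by
          by_contra h0
          rw [hA.symm] at h0
          have := hd _ _ h0
          rw [hp i hi, hp j hj] at this
          omega
        rw [if_neg (by omega : ¬i = j), if_neg (by omega : ¬i = j + 1),
          if_neg (by omega : ¬i + 1 = j),
          if_neg (by omega : ¬i + 1 = j + 1), if_neg hne, h0]
        ring
      · obtain rfl : j = i + 1 := by omega
        rw [if_neg (by omega : ¬i = i + 1), if_neg (by omega : ¬i = i + 1 + 1), if_pos rfl,
          if_neg (by omega : ¬i + 1 = i + 1 + 1), if_neg hne, hs]
        simp [(by omega : i < m)]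
  intro g hg h hh
  obtain ⟨i, hi, rfl⟩ := Finset.mem_image.1 hg
  obtain ⟨j, hj, rfl⟩ := Finset.mem_image.1 hh
  rw [Finset.mem_range] at hi hj
  rcases le_total i j with hij | hij
  · exact key i (by omega) j (by omega) hij
  · rw [hA.symm]
    simp only [eq_comm (a := p i)]
    rw [← key j (by omega) i (by omega) hij]
    exact Finset.sum_congr rfl fun c _ => mul_comm _ _

section

variable {V : Type*} [Fintype V] [DecidableEq V] {A : V → V → ℤ} {δ C₀ κ : ℝ} {K : ℕ → ℝ} {n₀ : ℕ}

theorem DRep.univ_of_distBall (hP : Params δ C₀ κ) (hK : IsConduct δ C₀ K n₀) (hA : IsSignedMat A)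
    (hgood : ∀ x, 0 ≤ qform A (2 + δ) x) (hG : (adjGraph A).Connected) {r : V}
    (hr : DRep A ((adjGraph A).distBall r (n₀ + 3))) : DRep A Finset.univ := by
  refine initialSegment_induction (fun v => (adjGraph A).dist r v + 1) (DRep A) _ hr ?_ ?_
  · intro h hh g hg
    rw [SimpleGraph.mem_distBall] at hh hg
    omega
  · intro U v hsub hU hv hle hlt
    refine DRep.insert_of_far hP hA hgood hK.zero hK.nonneg hK.step hK.le (fun h => by simp) ?_ ?_
      hU hv hle hlt ?_
    · intro g h hgh
      have := hG.setDist_le_succ (Set.singleton_nonempty r) (hA.adj_iff.2 hgh)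
      rw [SimpleGraph.setDist_singleton, SimpleGraph.setDist_singleton] at this
      omega
    · intro h hh
      obtain ⟨g, hg, hd⟩ := hG.exists_adj_dist
        (Nat.sub_add_cancel (show 1 ≤ (adjGraph A).dist r h by omega)).symm
      exact ⟨g, hA.adj_iff.1 hg, by omega⟩
    · have : v ∉ (adjGraph A).distBall r (n₀ + 3) := fun h => hv (hsub h)
      rw [SimpleGraph.mem_distBall] at this
      omega

end

theorem adjGraph_comp {V W : Type*} {A : V → V → ℤ} (hA : IsSignedMat A) {f : W → V} :
    adjGraph (fun i j => A (f i) (f j)) = (adjGraph A).comap f := by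
  ext i j
  rw [SimpleGraph.comap_adj, hA.adj_iff, (hA.comp f).adj_iff]

theorem DRep.of_subtype {V : Type*} [DecidableEq V] {A : V → V → ℤ} {X : Finset V}
    (h : DRep (fun i j : X => A i j) Finset.univ) : DRep A X := by
  obtain ⟨C, hC, R, hR⟩ := h
  refine ⟨C, hC, fun c v => if hv : v ∈ X then R c ⟨v, hv⟩ else 0, fun g hg h hh => ?_⟩
  simpa [hg, hh] using hR ⟨g, hg⟩ (Finset.mem_univ _) ⟨h, hh⟩ (Finset.mem_univ _)

theorem DRep.of_coe_subset {V : Type*} [DecidableEq V] {A : V → V → ℤ} {X P : Finset V}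
    {Y : Finset X}
    (h : DRep A P) (hY : ∀ y ∈ Y, (y : V) ∈ P) : DRep (fun i j : X => A i j) Y := by
  obtain ⟨C, hC, R, hR⟩ := h
  refine ⟨C, hC, fun c v => R c v, fun g hg h hh => ?_⟩
  simpa only [Subtype.coe_inj] using hR g (hY g hg) h (hY h hh)

theorem qform_subtype_nonneg {V : Type*} [Fintype V] {A : V → V → ℤ} {lam : ℝ}
    (hgood : ∀ x, 0 ≤ qform A lam x) (X : Finset V) (x : X → ℝ) :
    0 ≤ qform (fun i j : X => A i j) lam x := by
  rw [← qform_extend A lam Subtype.val_injective]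
  exact hgood _

/-- A connected good signed graph that is large compared with its maximum degree is represented
by vectors `±e_c ± e_d`. -/
theorem DRep.univ_of_degree_le {V : Type*} [Fintype V] [DecidableEq V] {A : V → V → ℤ} {δ C₀ κ : ℝ}
    {K : ℕ → ℝ} {n₀ : ℕ} (hP : Params δ C₀ κ) (hK : IsConduct δ C₀ K n₀) (hA : IsSignedMat A)
    (hgood : ∀ x, 0 ≤ qform A (2 + δ) x) (hG : (adjGraph A).Connected) {Δ : ℕ}
    (hΔ : ∀ v, {u | A v u ≠ 0}.ncard ≤ Δ) (hV : (Δ + 1) ^ (2 * (n₀ + 3)) < Fintype.card V) :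
    DRep A Finset.univ := by
  obtain ⟨r₀⟩ := hG.nonempty
  set G := adjGraph A with hGdef
  set L := n₀ + 3 with hL
  obtain ⟨r, hr⟩ : ∃ r, r ∉ G.distBall r₀ (2 * L) := by
    by_contra! h
    have h1 := hG.card_distBall_le (Δ := Δ) (fun v => by simpa only [hGdef, hA.adj_iff] using hΔ v)
      r₀ (2 * L)
    rw [Finset.eq_univ_iff_forall.2 h, Finset.card_univ] at h1
    omega
  rw [SimpleGraph.mem_distBall, SimpleGraph.dist_comm] at hr
  obtain ⟨p, hp, hd, ha⟩ := hG.exists_geodesic r _ r₀ rfl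
  set m := G.dist r r₀ with hm
  set P : Finset V := (Finset.range (m + 1)).image p with hPdef
  have hlip : ∀ g h, A g h ≠ 0 → G.dist r g ≤ G.dist r h + 1 := fun g h hgh => by
    have := hG.setDist_le_succ (Set.singleton_nonempty r) (hA.adj_iff.2 hgh)
    rwa [SimpleGraph.setDist_singleton, SimpleGraph.setDist_singleton] at this
  have hPrep : DRep A P := dRep_geodesic hA hlip hd fun i hi => hA.adj_iff.1 (ha i hi)
  set X : Finset V := G.distBall r₀ L ∪ P with hX
  have hpX : ∀ i ≤ m, p i ∈ X := fun i hi => Finset.mem_union_right _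
    (Finset.mem_image_of_mem _ (Finset.mem_range.2 (by omega)))
  have hr₀X : r₀ ∈ X := hp ▸ hpX m le_rfl
  have hGX : adjGraph (fun i j : X => A i j) = G.comap Subtype.val := adjGraph_comp hA
  have hball : ∀ n ≤ L, ∀ x, G.dist r₀ x = n → ∃ hx : x ∈ X,
      (G.comap (Subtype.val : X → V)).Reachable ⟨r₀, hr₀X⟩ ⟨x, hx⟩ := by
    intro n
    induction n with
    | zero =>
      intro _ x hx
      rw [hG.dist_eq_zero_iff] at hx
      subst hx
      exact ⟨hr₀X, .rfl⟩
    | succ n ih =>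
      intro hn x hx
      obtain ⟨g, hg, hgd⟩ := hG.exists_adj_dist hx
      obtain ⟨hgX, hgr⟩ := ih (by omega) g hgd
      exact ⟨Finset.mem_union_left _ (SimpleGraph.mem_distBall.2 (hx.trans_le hn)),
        hgr.trans (SimpleGraph.Adj.reachable (SimpleGraph.comap_adj.2 hg))⟩
  have hpath : ∀ n, ∀ hn : n ≤ m, (G.comap (Subtype.val : X → V)).Reachable ⟨r₀, hr₀X⟩
      ⟨p (m - n), hpX _ (Nat.sub_le _ _)⟩ := by
    intro n
    induction n with
    | zero =>
      intro _
      have : (⟨r₀, hr₀X⟩ : X) = ⟨p (m - 0), hpX _ (Nat.sub_le _ _)⟩ := Subtype.ext hp.symm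
      rw [this]
    | succ n ih =>
      intro hn
      refine (ih (by omega)).trans (SimpleGraph.Adj.reachable (SimpleGraph.comap_adj.2 ?_)).symm
      have := ha (m - (n + 1)) (by omega)
      rwa [show m - (n + 1) + 1 = m - n by omega] at this
  have hconn : (adjGraph (fun i j : X => A i j)).Connected := by
    rw [hGX, SimpleGraph.connected_iff_exists_forall_reachable]
    refine ⟨⟨r₀, hr₀X⟩, fun ⟨x, hx⟩ => ?_⟩
    rcases Finset.mem_union.1 hx with h | h
    · obtain ⟨_, h1⟩ := hball _ (SimpleGraph.mem_distBall.1 h) x rfl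
      exact h1
    · obtain ⟨i, hi, rfl⟩ := Finset.mem_image.1 h
      rw [Finset.mem_range] at hi
      have := hpath (m - i) (by omega)
      simpa [show m - (m - i) = i by omega] using this
  have hrX : r ∈ X := by
    have h0 := hd 0 (Nat.zero_le _)
    rw [hG.dist_eq_zero_iff] at h0
    exact h0 ▸ hpX 0 (Nat.zero_le _)
  have hXrep : DRep A X := by
    refine DRep.of_subtype (DRep.univ_of_distBall hP hK (hA.comp _) (qform_subtype_nonneg hgood X)
      hconn (r := ⟨r, hrX⟩) (hPrep.of_coe_subset ?_))
    rintro ⟨y, hy⟩ hyd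
    rw [SimpleGraph.mem_distBall] at hyd
    rcases Finset.mem_union.1 hy with h | h
    · exfalso
      obtain ⟨w, hw⟩ := hconn.exists_walk_length_eq_dist ⟨r, hrX⟩ ⟨y, hy⟩
      have h1 := SimpleGraph.dist_le
        ((w.mapLe hGX.le).map (SimpleGraph.Embedding.comap ⟨_, Subtype.val_injective⟩ G).toHom)
      rw [SimpleGraph.Walk.length_map, SimpleGraph.Walk.length_mapLe, hw] at h1
      have h2 := hG.dist_triangle (u := r) (v := y) (w := r₀)
      rw [SimpleGraph.mem_distBall, SimpleGraph.dist_comm] at h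
      change G.dist r y ≤ _ at h1
      omega
    · exact h
  exact DRep.univ_of_distBall hP hK hA hgood hG (r := r₀) (hXrep.mono Finset.subset_union_left)

section

variable {V C : Type*} [Fintype C] {A : V → V → ℤ} {U : Finset V} {R : C → V → ℤ}

theorem energy_ge {b : V → ℤ} {δ C₀ κ : ℝ} (hP : Params δ C₀ κ) {y : C → ℝ}
    (hy : ∑ c, y c ^ 2 + 1 / δ * ∑ h ∈ U, edgeResidual R b y h ^ 2 ≤ 2 + δ) (S : Finset C)
    {T : Finset V} (hT : T ⊆ U) :
    ∑ c ∈ S, y c ^ 2 + ∑ h ∈ T, 50 * edgeResidual R b y h ^ 2 ≤ 2 + δ := by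
  refine (add_le_add (Finset.sum_le_sum_of_subset_of_nonneg (Finset.subset_univ S)
    fun _ _ _ => sq_nonneg _) ?_).trans hy
  rw [Finset.mul_sum]
  exact (Finset.sum_le_sum fun h _ => hP.fifty_mul_le _).trans
    (Finset.sum_le_sum_of_subset_of_nonneg hT
      fun _ _ _ => mul_nonneg (one_div_nonneg.2 hP.δ_pos.le) (sq_nonneg _))

theorem numeric_hub_large {t : ℤ} {η p q : ℝ} (hη : η ^ 2 ≤ 0.00016)
    (h : q ^ 2 + 50 * (t + η - q) ^ 2 ≤ 1.046 - p ^ 2) (ht : t ≠ 0) :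
    t ^ 2 = 1 ∧ 0.95 ≤ q ^ 2 + 50 * (t + η - q) ^ 2 := by
  have hη1 : η ≤ 0.013 := by nlinarith
  have hη2 : -0.013 ≤ η := by nlinarith
  have h1 : (t + η) ^ 2 * 50 ≤ 51 * (q ^ 2 + 50 * (t + η - q) ^ 2) := by
    nlinarith [sq_nonneg (q - 50 * (t + η - q))]
  have ht2 : t ^ 2 = 1 := by
    have : (t : ℝ) < 2 := by nlinarith [sq_nonneg p]
    have : (-2 : ℝ) < t := by nlinarith [sq_nonneg p]
    have h3 : t < 2 := by exact_mod_cast ‹(t : ℝ) < 2›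
    have h4 : -2 < t := by exact_mod_cast this
    obtain rfl | rfl : t = 1 ∨ t = -1 := by omega
    all_goals norm_num
  refine ⟨ht2, ?_⟩
  obtain rfl | rfl := sq_eq_one_iff.1 ht2
  · push_cast at h1 ⊢
    nlinarith
  · push_cast at h1 ⊢
    nlinarith

/-- If all elements of `U` contain the coordinate `f`, the system can be solved in integers. -/
theorem IsRep.exists_solution_of_common [DecidableEq V] {b : V → ℤ} {δ C₀ κ : ℝ}
    (hP : Params δ C₀ κ)
    (hR : IsRep A U R) (hA : IsSignedMat A) (hne : U.Nonempty) {y : C → ℝ}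
    (hy : ∑ c, y c ^ 2 + 1 / δ * ∑ h ∈ U, edgeResidual R b y h ^ 2 ≤ 2 + δ) {f : C}
    (hf : ∀ h ∈ U, R f h ≠ 0) {σ : ℤ} (hσ : σ ^ 2 = 1) (hσy : ((σ : ℝ) - y f) ^ 2 ≤ 0.00016) :
    ∃ z : C → ℤ, (∀ h ∈ U, ∑ c, R c h * z c = b h) ∧ ∑ c, z c ^ 2 ≤ 2 := by
  classical
  have ex : ∀ h, ∃ x, h ∈ U → IsEdge R h f x := fun h => by
    by_cases hh : h ∈ U
    · obtain ⟨d, hd⟩ := hR.exists_isEdge hA hh (hf h hh)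
      exact ⟨d, fun _ => hd⟩
    · exact ⟨f, fun h => absurd h hh⟩
  choose x hx using ex
  set t : V → ℤ := fun h => R (x h) h * (b h - R f h * σ) with ht
  set η : V → ℝ := fun h => R (x h) h * R f h * (σ - y f) with hη
  have hη2 : ∀ h ∈ U, η h ^ 2 ≤ 0.00016 := by
    intro h hh
    have h1 : (R f h : ℝ) ^ 2 = 1 := by exact_mod_cast (hx h hh).left
    have h2 : (R (x h) h : ℝ) ^ 2 = 1 := by exact_mod_cast (hx h hh).right
    simpa only [hη, mul_pow, h1, h2, one_mul] using hσy
  have hres : ∀ h ∈ U, edgeResidual R b y h ^ 2 = (t h + η h - y (x h)) ^ 2 := by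
    intro h hh
    have h2 : (R (x h) h : ℝ) ^ 2 = 1 := by exact_mod_cast (hx h hh).right
    rw [(hx h hh).residual_eq]
    have h3 : (t h + η h - y (x h) : ℝ) = R (x h) h *
        (b h - (R f h * y f + R (x h) h * y (x h))) := by
      simp only [ht, hη]
      push_cast
      linear_combination y (x h) * h2
    rw [h3, mul_pow, h2, one_mul]
  have hyf : 0.974 ≤ y f ^ 2 := by
    obtain rfl | rfl := sq_eq_one_iff.1 hσ
    · push_cast at hσy
      have : 0.987 ≤ y f := by nlinarith
      nlinarith
    · push_cast at hσy
      have : y f ≤ -0.987 := by nlinarith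
      nlinarith
  have hδ := hP.δ_le
  have hone : ∀ h ∈ U, y (x h) ^ 2 + 50 * (t h + η h - y (x h)) ^ 2 ≤ 1.046 - 0 ^ 2 := by
    intro h hh
    have := energy_ge hP hy {f, x h} (Finset.singleton_subset_iff.2 hh)
    rw [Finset.sum_pair (hx h hh).ne, Finset.sum_singleton, hres h hh] at this
    linarith
  have hdiff : ∀ h ∈ U, ∀ h' ∈ U, x h ≠ x h' → t h = 0 ∨ t h' = 0 := by
    intro h hh h' hh' hne
    by_contra! hc
    have := energy_ge hP hy {f, x h, x h'} (T := {h, h'}) (by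
      rw [Finset.insert_subset_iff, Finset.singleton_subset_iff]
      exact ⟨hh, hh'⟩)
    rw [Finset.sum_insert (by simp [(hx h hh).ne, (hx h' hh').ne]), Finset.sum_pair hne,
      Finset.sum_pair (by rintro rfl; exact hne rfl), hres h hh, hres h' hh'] at this
    have h1 := (numeric_hub_large (hη2 h hh) (hone h hh) hc.1).2
    have h2 := (numeric_hub_large (hη2 h' hh') (hone h' hh') hc.2).2
    linarith
  have hsame : ∀ h ∈ U, ∀ h' ∈ U, x h = x h' → t h = t h' := by
    intro h hh h' hh' he
    by_contra hne
    have hhh : h ≠ h' := by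
      rintro rfl
      exact hne rfl
    have := energy_ge hP hy {f} (T := {h, h'}) (by
      rw [Finset.insert_subset_iff, Finset.singleton_subset_iff]
      exact ⟨hh, hh'⟩)
    rw [Finset.sum_singleton, Finset.sum_pair hhh, hres h hh, hres h' hh', he] at this
    have h1 := hη2 h hh
    have h2 := hη2 h' hh'
    have h3 : (1 : ℝ) ≤ ((t h : ℝ) - t h') ^ 2 := by
      have : 1 ≤ (t h - t h') ^ 2 := by
        have := sq_nonneg (t h - t h')
        have : (t h - t h') ^ 2 ≠ 0 := pow_ne_zero 2 (sub_ne_zero.2 hne)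
        omega
      exact_mod_cast this
    set e := (t h : ℝ) + η h - y (x h') with he
    set e' := (t h' : ℝ) + η h' - y (x h') with he'
    have h4 : (t h : ℝ) - t h' = e - e' - η h + η h' := by
      rw [he, he']
      ring
    rw [h4] at h3
    nlinarith [sq_nonneg (e + e'), sq_nonneg (e + η h), sq_nonneg (e - η h'), sq_nonneg (e' - η h),
      sq_nonneg (e' + η h'), sq_nonneg (η h + η h')]
  obtain ⟨h₀, hh₀, hall⟩ : ∃ h₀ ∈ U, t h₀ = 0 → ∀ h ∈ U, t h = 0 := by
    by_cases hz : ∃ h ∈ U, t h ≠ 0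
    · obtain ⟨h, hh, h0⟩ := hz
      exact ⟨h, hh, fun h1 => absurd h1 h0⟩
    · push Not at hz
      obtain ⟨h, hh⟩ := hne
      exact ⟨h, hh, fun _ => hz⟩
  have hne₀ := (hx h₀ hh₀).ne
  refine ⟨fun c => if c = f then σ else if c = x h₀ then t h₀ else 0, fun h hh => ?_, ?_⟩
  · rw [(hx h hh).sum_eq, if_pos rfl, if_neg (hx h hh).ne.symm]
    have h3 : (if x h = x h₀ then t h₀ else 0) = t h := by
      split_ifs with he
      · exact hsame _ hh₀ _ hh he.symm
      · rcases hdiff h hh h₀ hh₀ he with h1 | h1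
        · exact h1.symm
        · exact (hall h1 h hh).symm
    rw [h3]
    simp only [ht]
    linear_combination (b h - R f h * σ) * (hx h hh).right
  · rw [← Finset.sum_subset (Finset.subset_univ {f, x h₀}), Finset.sum_pair hne₀]
    · simp only [if_true, hne₀.symm, if_false, hσ]
      by_cases h0 : t h₀ = 0
      · simp [h0]
      · rw [(numeric_hub_large (hη2 _ hh₀) (hone _ hh₀) h0).1]
        norm_num
    · intro c _ hc
      simp only [Finset.mem_insert, Finset.mem_singleton, not_or] at hc
      simp [hc.1, hc.2]

end

/-- The vertices adjacent to at least half of `Q`. -/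
def nearSet {V : Type*} (A : V → V → ℤ) (Q : Finset V) : Set V :=
  {x | Q.card ≤ 2 * (Q.filter fun q => A x q ≠ 0).card}

section

variable {V C : Type*} [Fintype C] [DecidableEq V] {A : V → V → ℤ} {U Q : Finset V} {R : C → V → ℤ}

/-- Adjacent elements do not share both coordinates. -/
theorem IsRep.eq_zero_of_adj (hR : IsRep A U R) (hA : IsSignedMat A) {g h : V} (hg : g ∈ U)
    (hh : h ∈ U) (hgh : A g h ≠ 0) {c d : C} (he : IsEdge R g c d) (hc : R c h ≠ 0) :
    R d h = 0 := by
  have hne : g ≠ h := by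
    rintro rfl
    exact hgh (hA.diag _)
  have h1 := hR.inner_eq hg hh hne he
  obtain ⟨e, he'⟩ := hR.exists_isEdge hA hh hc
  by_contra hd
  obtain rfl : d = e := (he'.eq_or_eq hd).resolve_left he.ne.symm
  have h2 := hA.lower g h
  have h3 := hA.upper g h
  rw [← h1] at h2 h3 hgh
  rcases he.left_eq with e1 | e1 <;> rcases he.symm.left_eq with e2 | e2 <;>
    rcases he'.left_eq with e3 | e3 <;> rcases he'.symm.left_eq with e4 | e4 <;>
    simp [e1, e2, e3, e4] at h2 h3 hgh

theorem IsRep.exists_mem_or (hR : IsRep A U R) (hA : IsSignedMat A) {g h : V} (hg : g ∈ U)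
    (hh : h ∈ U) (hgh : A g h ≠ 0) {c d : C} (he : IsEdge R g c d) : R c h ≠ 0 ∨ R d h ≠ 0 := by
  have hne : g ≠ h := by
    rintro rfl
    exact hgh (hA.diag _)
  by_contra! h0
  have h1 := hR.inner_eq hg hh hne he
  rw [h0.1, h0.2] at h1
  simp at h1
  exact hgh h1.symm

theorem IsRep.exists_hub (hR : IsRep A U R) (hA : IsSignedMat A) (hQU : Q ⊆ U)
    (hadj : ∀ q ∈ Q, ∀ q' ∈ Q, q ≠ q' → A q q' ≠ 0) (hcard : 5 ≤ Q.card) :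
    ∃ f, ∀ q ∈ Q, R f q ≠ 0 := by
  obtain ⟨q₁, h₁, q₂, h₂, h₁₂⟩ := Finset.one_lt_card.1 (by omega : 1 < Q.card)
  obtain ⟨f, hf₁, hf₂⟩ := hR.exists_common (hQU h₁) (hQU h₂) h₁₂ (hadj _ h₁ _ h₂ h₁₂)
  obtain ⟨b, hb⟩ := hR.exists_isEdge hA (hQU h₁) hf₁
  obtain ⟨c, hc⟩ := hR.exists_isEdge hA (hQU h₂) hf₂
  refine ⟨f, fun q₃ h₃ h0 => ?_⟩
  have h₁₃ : q₁ ≠ q₃ := by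
    rintro rfl
    exact hf₁ h0
  have h₂₃ : q₂ ≠ q₃ := by
    rintro rfl
    exact hf₂ h0
  have hb₃ : R b q₃ ≠ 0 := (hR.exists_mem_or hA (hQU h₁) (hQU h₃) (hadj _ h₁ _ h₃ h₁₃)
    hb).resolve_left (not_not.2 h0)
  have hc₃ : R c q₃ ≠ 0 := (hR.exists_mem_or hA (hQU h₂) (hQU h₃) (hadj _ h₂ _ h₃ h₂₃)
    hc).resolve_left (not_not.2 h0)
  have hbc : c ≠ b := by
    rintro rfl
    exact hc.right_ne (hR.eq_zero_of_adj hA (hQU h₁) (hQU h₂) (hadj _ h₁ _ h₂ h₁₂) hb hf₂)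
  obtain ⟨e, he⟩ := hR.exists_isEdge hA (hQU h₃) hb₃
  obtain rfl : c = e := (he.eq_or_eq hc₃).resolve_left hbc
  obtain ⟨q₄, h₄, hn⟩ := Finset.exists_mem_notMem_of_card_lt_card
    (lt_of_le_of_lt (Finset.card_le_three (a := q₁) (b := q₂) (c := q₃)) (by omega : 3 < Q.card))
  simp only [Finset.mem_insert, Finset.mem_singleton, not_or] at hn
  have a₁ := hadj _ h₁ _ h₄ (Ne.symm hn.1)
  have a₂ := hadj _ h₂ _ h₄ (Ne.symm hn.2.1)
  have a₃ := hadj _ h₃ _ h₄ (Ne.symm hn.2.2)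
  rcases hR.exists_mem_or hA (hQU h₃) (hQU h₄) a₃ he with h | h
  · have e1 := hR.eq_zero_of_adj hA (hQU h₃) (hQU h₄) a₃ he h
    have e2 := hR.eq_zero_of_adj hA (hQU h₁) (hQU h₄) a₁ hb.symm h
    exact (hR.exists_mem_or hA (hQU h₂) (hQU h₄) a₂ hc).elim (· e2) (· e1)
  · have e1 := hR.eq_zero_of_adj hA (hQU h₃) (hQU h₄) a₃ he.symm h
    have e2 := hR.eq_zero_of_adj hA (hQU h₂) (hQU h₄) a₂ hc.symm h
    exact (hR.exists_mem_or hA (hQU h₁) (hQU h₄) a₁ hb).elim (· e2) (· e1)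

theorem IsRep.eq_of_hub (hR : IsRep A U R) (hA : IsSignedMat A) (hQU : Q ⊆ U)
    (hadj : ∀ q ∈ Q, ∀ q' ∈ Q, q ≠ q' → A q q' ≠ 0) {f : C} (hf : ∀ q ∈ Q, R f q ≠ 0) {c : C}
    (hc : c ≠ f) {q q' : V} (hq : q ∈ Q) (hq' : q' ∈ Q) (h : R c q ≠ 0) (h' : R c q' ≠ 0) :
    q = q' := by
  by_contra hne
  obtain ⟨d, hd⟩ := hR.exists_isEdge hA (hQU hq) (hf q hq)
  obtain rfl : c = d := (hd.eq_or_eq h).resolve_left hc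
  exact h' (hR.eq_zero_of_adj hA (hQU hq) (hQU hq') (hadj _ hq _ hq' hne) hd (hf q' hq'))

theorem IsRep.mem_nearSet_iff (hR : IsRep A U R) (hA : IsSignedMat A) (hQU : Q ⊆ U)
    (hadj : ∀ q ∈ Q, ∀ q' ∈ Q, q ≠ q' → A q q' ≠ 0) (hcard : 5 ≤ Q.card) {f : C}
    (hf : ∀ q ∈ Q, R f q ≠ 0) {h : V} (hh : h ∈ U) : h ∈ nearSet A Q ↔ R f h ≠ 0 := by
  classical
  have hone : ∀ c, c ≠ f → (Q.filter fun q => R c q ≠ 0).card ≤ 1 := by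
    intro c hc
    rw [Finset.card_le_one]
    intro q hq q' hq'
    rw [Finset.mem_filter] at hq hq'
    exact hR.eq_of_hub hA hQU hadj hf hc hq.1 hq'.1 hq.2 hq'.2
  change Q.card ≤ _ ↔ _
  constructor
  · intro hn h0
    obtain ⟨c, d, hcd⟩ := hR.exists_isEdge' hA hh
    have hcf : c ≠ f := by
      rintro rfl
      exact hcd.left_ne h0
    have hdf : d ≠ f := by
      rintro rfl
      exact hcd.right_ne h0
    have hsub : (Q.filter fun q => A h q ≠ 0) ⊆
        (Q.filter fun q => R c q ≠ 0) ∪ Q.filter fun q => R d q ≠ 0 := by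
      intro q hq
      rw [Finset.mem_filter] at hq
      rw [Finset.mem_union, Finset.mem_filter, Finset.mem_filter]
      exact (hR.exists_mem_or hA hh (hQU hq.1) hq.2 hcd).imp (⟨hq.1, ·⟩) (⟨hq.1, ·⟩)
    have := (Finset.card_le_card hsub).trans (Finset.card_union_le _ _)
    have := hone c hcf
    have := hone d hdf
    omega
  · intro h0
    obtain ⟨e, he⟩ := hR.exists_isEdge hA hh h0
    have hsub : (Q.filter fun q => ¬ A h q ≠ 0) ⊆ Q.filter fun q => R e q ≠ 0 := by
      intro q hq
      rw [Finset.mem_filter, not_not] at hq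
      refine Finset.mem_filter.2 ⟨hq.1, ?_⟩
      by_cases hqh : h = q
      · exact hqh ▸ he.right_ne
      · exact hR.twins hh (hQU hq.1) hqh hq.2 he (hf q hq.1)
    have := Finset.card_le_card hsub
    have := hone e he.ne.symm
    have := Finset.card_filter_add_card_filter_not (s := Q) (fun q => A h q ≠ 0)
    omega

theorem IsRep.sum_hub_le {δ C₀ κ : ℝ} (hP : Params δ C₀ κ) (hR : IsRep A U R) (hA : IsSignedMat A)
    (hQU : Q ⊆ U) (hadj : ∀ q ∈ Q, ∀ q' ∈ Q, q ≠ q' → A q q' ≠ 0) {f : C}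
    (hf : ∀ q ∈ Q, R f q ≠ 0) {b : V → ℤ} {y : C → ℝ}
    (hy : ∑ c, y c ^ 2 + 1 / δ * ∑ h ∈ U, edgeResidual R b y h ^ 2 ≤ 2 + δ) :
    ∑ q ∈ Q, ((b q : ℝ) - R f q * y f) ^ 2 ≤ 2.07 := by
  classical
  have ex : ∀ q, ∃ x, q ∈ Q → IsEdge R q f x := fun q => by
    by_cases hq : q ∈ Q
    · obtain ⟨d, hd⟩ := hR.exists_isEdge hA (hQU hq) (hf q hq)
      exact ⟨d, fun _ => hd⟩
    · exact ⟨f, fun h => absurd h hq⟩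
  choose x hx using ex
  have hinj : Set.InjOn x Q := by
    intro q hq q' hq' h
    refine hR.eq_of_hub hA hQU hadj hf (hx q hq).ne.symm hq hq' (hx q hq).right_ne ?_
    rw [h]
    exact (hx q' hq').right_ne
  have h1 := energy_ge hP hy (Q.image x) hQU
  rw [Finset.sum_image hinj, ← Finset.sum_add_distrib] at h1
  have h2 : ∀ q ∈ Q, ((b q : ℝ) - R f q * y f) ^ 2 * (50 / 51) ≤
      y (x q) ^ 2 + 50 * edgeResidual R b y q ^ 2 := by
    intro q hq
    rw [(hx q hq).residual_eq]
    have h3 : (R (x q) q : ℝ) ^ 2 = 1 := by exact_mod_cast (hx q hq).right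
    have h4 : (R (x q) q * y (x q) : ℝ) ^ 2 = y (x q) ^ 2 := by rw [mul_pow, h3, one_mul]
    nlinarith [sq_nonneg (R (x q) q * y (x q) - 50 * (b q - (R f q * y f + R (x q) q * y (x q))))]
  have h3 := (Finset.sum_le_sum h2).trans h1
  rw [← Finset.sum_mul] at h3
  have := hP.δ_le
  linarith

end

section

variable {V : Type*} {A : V → V → ℤ} {Q : Finset V}

/-- The coordinate of a hub is close to `±1` at the vertices near the cluster. -/
theorem exists_sign_near (hA : IsSignedMat A) {v : V} (hv : v ∈ nearSet A Q) {κ : ℝ}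
    (hκ : κ ≤ 0.001) (hcard : 28 ≤ κ * Q.card) {r : V → ℤ} (hr : ∀ q ∈ Q, r q ^ 2 = 1) {t : ℝ}
    (hsum : ∑ q ∈ Q, ((A v q : ℝ) - r q * t) ^ 2 ≤ 2.07) :
    ∃ σ : ℤ, σ ^ 2 = 1 ∧ ((σ : ℝ) - t) ^ 2 ≤ 0.00016 := by
  set m := (Q.filter fun q => A v q ≠ 0).card with hm
  have hv' : (Q.card : ℝ) ≤ 2 * m := by
    have : Q.card ≤ 2 * m := hv
    exact_mod_cast this
  have hm1 : 14000 ≤ (m : ℝ) := by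
    by_contra! h
    nlinarith [(Nat.cast_nonneg Q.card : (0 : ℝ) ≤ Q.card)]
  have hle : (m : ℝ) * (|t| - 1) ^ 2 ≤ 2.07 := by
    refine le_trans ?_ hsum
    rw [hm, ← nsmul_eq_mul]
    refine (Finset.card_nsmul_le_sum _ _ _ ?_).trans (Finset.sum_le_sum_of_subset_of_nonneg
      (Finset.filter_subset (fun q => A v q ≠ 0) Q) fun _ _ _ => sq_nonneg _)
    intro q hq
    rw [Finset.mem_filter] at hq
    have h1 := hA.lower v q
    have h2 := hA.upper v q
    have h3 := hq.2
    rcases sq_eq_one_iff.1 (hr q hq.1) with e | e <;>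
      obtain e' | e' : A v q = 1 ∨ A v q = -1 := by omega
    all_goals
      rw [e, e']
      push_cast
      rcases abs_cases t with ⟨h, h'⟩ | ⟨h, h'⟩ <;> rw [h] <;> nlinarith
  have hle' : (|t| - 1) ^ 2 ≤ 0.00016 := by
    by_contra! h
    nlinarith
  rcases abs_cases t with ⟨h, -⟩ | ⟨h, -⟩ <;> rw [h] at hle'
  · exact ⟨1, by norm_num, by push_cast; linarith [sub_sq_comm 1 t]⟩
  · refine ⟨-1, by norm_num, ?_⟩
    push_cast
    linarith [sub_sq_comm (-1) t]

/-- The coordinate of a hub is small at the vertices that are not near the cluster. -/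
theorem mul_sq_le_of_notMem_near {v : V} (hv : v ∉ nearSet A Q) {κ : ℝ}
    (hκ : 0 < κ) (hcard : 28 ≤ κ * Q.card) {r : V → ℤ} (hr : ∀ q ∈ Q, r q ^ 2 = 1) {t : ℝ}
    (hsum : ∑ q ∈ Q, ((A v q : ℝ) - r q * t) ^ 2 ≤ 2.07) : 6.7 * t ^ 2 ≤ κ := by
  set m := (Q.filter fun q => ¬ A v q ≠ 0).card with hm
  have hv' : (Q.card : ℝ) ≤ 2 * m := by
    have h1 : ¬ Q.card ≤ 2 * (Q.filter fun q => A v q ≠ 0).card := hv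
    have h2 := Finset.card_filter_add_card_filter_not (s := Q) (fun q => A v q ≠ 0)
    have : Q.card ≤ 2 * m := by omega
    exact_mod_cast this
  have hle : (m : ℝ) * t ^ 2 ≤ 2.07 := by
    refine le_trans ?_ hsum
    rw [hm, ← nsmul_eq_mul]
    refine (Finset.card_nsmul_le_sum _ _ _ ?_).trans (Finset.sum_le_sum_of_subset_of_nonneg
      (Finset.filter_subset (fun q => ¬ A v q ≠ 0) Q) fun _ _ _ => sq_nonneg _)
    intro q hq
    rw [Finset.mem_filter, not_not] at hq
    have h1 : (r q : ℝ) ^ 2 = 1 := by exact_mod_cast hr q hq.1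
    rw [hq.2, Int.cast_zero, zero_sub, neg_sq, mul_pow, h1, one_mul]
  have h14 : 14 ≤ κ * m := by nlinarith
  by_contra! h
  nlinarith [mul_le_mul_of_nonneg_right h14 (sq_nonneg t), mul_le_mul_of_nonneg_left hle hκ.le]

end

section

variable {V : Type*} [Fintype V] [DecidableEq V] {A : V → V → ℤ} {U Q : Finset V} {δ C₀ κ : ℝ}

theorem DRep.insert_of_cluster (hP : Params δ C₀ κ) (hA : IsSignedMat A)
    (hgood : ∀ x, 0 ≤ qform A (2 + δ) x) (hG : (adjGraph A).Connected)
    (hadj : ∀ q ∈ Q, ∀ q' ∈ Q, q ≠ q' → A q q' ≠ 0) (hcard : 28 ≤ κ * Q.card) {ℓ : V → ℕ}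
    (hℓ : ∀ v, ℓ v = (adjGraph A).setDist (nearSet A Q) v + 1) (hQU : Q ⊆ U) (hU : DRep A U)
    {v : V} (hv : v ∉ U) (hle : ∀ h ∈ U, h ∉ Q → ℓ h ≤ ℓ v) (hlt : ∀ g, ℓ g < ℓ v → g ∈ U) :
    DRep A (insert v U) := by
  classical
  obtain ⟨C, _, R, hR⟩ := hU
  obtain ⟨y, hy⟩ := hR.exists_energy_le hA hP.δ_pos hgood hv
  have hcard' : 28000 ≤ Q.card := by
    have : (28000 : ℝ) ≤ Q.card := by
      have := hP.κ_le
      have := hP.κ_pos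
      by_contra! h
      nlinarith
    exact_mod_cast this
  obtain ⟨f, hf⟩ := hR.exists_hub hA hQU hadj (by omega)
  have hnear : ∀ h ∈ U, (h ∈ nearSet A Q ↔ R f h ≠ 0) := fun h hh =>
    hR.mem_nearSet_iff hA hQU hadj (by omega) hf hh
  obtain ⟨q₀, hq₀⟩ := Finset.card_pos.1 (by omega : 0 < Q.card)
  have hS : (nearSet A Q).Nonempty := ⟨q₀, (hnear q₀ (hQU hq₀)).2 (hf q₀ hq₀)⟩
  have hℓ1 : ∀ h, ℓ h ≤ 1 ↔ h ∈ nearSet A Q := fun h => by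
    rw [hℓ, ← hG.setDist_eq_zero hS]
    omega
  replace hle : ∀ h ∈ U, ℓ h ≤ ℓ v := fun h hh => by
    by_cases hhQ : h ∈ Q
    · have := (hℓ1 h).2 ((hnear h hh).2 (hf h hhQ))
      have := hℓ v
      omega
    · exact hle h hh hhQ
  have hr : ∀ q ∈ Q, R f q ^ 2 = 1 := fun q hq =>
    (hR.sq_le_one hA (hQU hq) f).resolve_left (hf q hq)
  have hsum := hR.sum_hub_le hP hA hQU hadj hf (b := A v) hy
  by_cases hvn : v ∈ nearSet A Q
  · obtain ⟨σ, hσ, hσy⟩ := exists_sign_near hA hvn hP.κ_le hcard hr hsum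
    obtain ⟨z, hz, hz2⟩ := hR.exists_solution_of_common hP hA ⟨q₀, hQU hq₀⟩ (b := A v) hy
      (fun h hh => (hnear h hh).1 ((hℓ1 h).1 ((hle h hh).trans ((hℓ1 v).2 hvn)))) hσ hσy
    exact hR.extend hA hv z hz hz2
  have hyf := mul_sq_le_of_notMem_near hvn hP.κ_pos hcard hr hsum
  obtain ⟨k, hk⟩ : ∃ k, ℓ v = k + 2 := ⟨ℓ v - 2, by have := (hℓ1 v).not.2 hvn; omega⟩
  have hlip : ∀ g h, A g h ≠ 0 → ℓ g ≤ ℓ h + 1 := fun g h hgh => by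
    have := hG.setDist_le_succ hS (hA.adj_iff.2 hgh)
    rw [hℓ, hℓ]
    omega
  have hpos : ∀ h, 1 ≤ ℓ h := fun h => by rw [hℓ]; omega
  set dep : C → ℕ := fun c => if c = f then 0 else sInf (ℓ '' {h | h ∈ U ∧ R c h ≠ 0}) with hdepdef
  have hdepf : dep f = 0 := if_pos rfl
  have hdepc : ∀ c, c ≠ f → dep c = sInf (ℓ '' {h | h ∈ U ∧ R c h ≠ 0}) := fun c hc => if_neg hc
  have hdep : ∀ h ∈ U, ∀ c, R c h ≠ 0 → dep c ≤ ℓ h := by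
    intro h hh c hc
    by_cases hcf : c = f
    · rw [hcf, hdepf]
      omega
    · rw [hdepc c hcf]
      exact Nat.sInf_le ⟨h, ⟨hh, hc⟩, rfl⟩
  have hdep'' : ∀ c, c ≠ f → (∃ h ∈ U, R c h ≠ 0) → ∃ h ∈ U, ℓ h = dep c ∧ R c h ≠ 0 := by
    rintro c hcf ⟨h, hh, hc⟩
    obtain ⟨g, ⟨hg, hgc⟩, hgℓ⟩ := Nat.sInf_mem (s := ℓ '' {h | h ∈ U ∧ R c h ≠ 0})
      ⟨_, ⟨h, ⟨hh, hc⟩, rfl⟩⟩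
    exact ⟨g, hg, hgℓ.trans (hdepc c hcf).symm, hgc⟩
  have hdep' : ∀ c, 1 ≤ dep c → ∃ h ∈ U, ℓ h = dep c ∧ R c h ≠ 0 := by
    intro c hc
    have hcf : c ≠ f := by
      rintro rfl
      omega
    refine hdep'' c hcf ?_
    by_contra! hemp
    have : ℓ '' {h | h ∈ U ∧ R c h ≠ 0} = ∅ := by
      rw [Set.image_eq_empty, Set.eq_empty_iff_forall_notMem]
      exact fun h hh => hh.2 (hemp h hh.1)
    rw [hdepc c hcf, this, Nat.sInf_empty] at hc
    omega
  have hdep1 : ∀ h ∈ U, ∀ c, c ≠ f → R c h ≠ 0 → 1 ≤ dep c := by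
    intro h hh c hcf hc
    obtain ⟨g, -, hg, -⟩ := hdep'' c hcf ⟨h, hh, hc⟩
    rw [← hg]
    exact hpos g
  have hdownU : ∀ h ∈ U, 2 ≤ ℓ h → ∃ g ∈ U, A g h ≠ 0 ∧ ℓ g + 1 = ℓ h := by
    intro h hh h2
    rw [hℓ] at h2
    obtain ⟨g, hg, hgℓ⟩ := hG.exists_adj_setDist hS (h := h) (by omega)
    have hgh : ℓ g + 1 = ℓ h := by rw [hℓ, hℓ, hgℓ]
    exact ⟨g, hlt g (by have := hle h hh; omega), hA.adj_iff.1 hg, hgh⟩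
  have hL : ∀ j, 1 ≤ j → LevelAt U R ℓ dep j := by
    intro j hj
    rcases hj.eq_or_lt with rfl | hj
    · refine ⟨fun h hh h1 => ?_, fun c hc => ?_⟩
      · obtain ⟨d, hd⟩ := hR.exists_isEdge hA hh ((hnear h hh).1 ((hℓ1 h).1 h1.le))
        have h2 := hdep1 h hh d hd.ne.symm hd.right_ne
        have h3 := hdep h hh d hd.right_ne
        exact ⟨f, d, hd, by omega, by omega⟩
      · obtain ⟨h, hh, hd, hch⟩ := hdep' c hc.ge
        exact ⟨h, hh, hd.trans hc, hch⟩
    · have hnf : ∀ h ∈ U, ℓ h = j → R f h = 0 := fun h hh hhj => by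
        by_contra h0
        have := (hℓ1 h).2 ((hnear h hh).2 h0)
        omega
      refine hR.levelAt hA hlip (fun h hh h2 _ => hdownU h hh h2) hj ?_ hdep hdep' ?_
      · intro g hg h hh hg1 hhj c d he he'
        have h0 := hnf h hh hhj
        rcases he.eq_or_eq ((hnear g hg).1 ((hℓ1 g).1 hg1)) with rfl | rfl
        · exact absurd h0 he'.left_ne
        · exact absurd h0 he'.right_ne
      · intro h hh hhj c hc
        refine hdep1 h hh c ?_ hc
        rintro rfl
        exact hc (hnf h hh hhj)
  have hb0 : ∀ h ∈ U, ℓ h ≤ k → A v h = 0 := by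
    intro h _ hh
    by_contra h0
    have := hlip v h h0
    omega
  obtain ⟨z, hz, hz2⟩ := exists_integral_solution (b := A v) (y := y) (ℓ := ℓ) (dep := dep) (j := k)
    hP hR hA (fun h _ => by
      have h1 := hA.lower v h
      have h2 := hA.upper v h
      nlinarith) (by
        rw [sum_energyTerm]
        exact hy) (fun h hh => (hle h hh).trans_eq hk) hb0 hdep (hL _ (by omega))
      (hL _ (by omega)) (by
        intro c hc hu
        have hcz := conduct_chain (b := A v) (y := y) (κ := κ) (i := 0) (j := k) (K := fun _ => C₀)
          hP.δ_pos (fun _ => by linarith [hP.C₀_ge]) (fun _ => hP.conduct)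
          hb0 (fun n hn _ => hL n (by omega)) (by
            rintro c hc ⟨h, hh, hch⟩
            have hcf : c = f := by
              by_contra hcf
              have := hdep1 h hh c hcf hch
              omega
            have h1 : C₀ * y c ^ 2 ≤ 6.7 * y c ^ 2 :=
              mul_le_mul_of_nonneg_right hP.C₀_le (sq_nonneg _)
            rw [← hcf] at hyf
            have := energyBelow_nonneg (R := R) (U := U) (b := A v) (y := y) (ℓ := ℓ) (dep := dep)
              hP.δ_pos.le (0 + 1)
            linarith) k (by omega) c (by omega) hu
        rwa [zero_add] at hcz)
  exact hR.extend hA hv z hz hz2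

/-- A connected good signed graph with a large clique representing a hub is represented by vectors
`±e_c ± e_d`. -/
theorem DRep.univ_of_cluster (hP : Params δ C₀ κ) (hA : IsSignedMat A)
    (hgood : ∀ x, 0 ≤ qform A (2 + δ) x) (hG : (adjGraph A).Connected)
    (hadj : ∀ q ∈ Q, ∀ q' ∈ Q, q ≠ q' → A q q' ≠ 0) (hcard : 28 ≤ κ * Q.card) (hQ : DRep A Q) :
    DRep A Finset.univ := by
  set ℓ : V → ℕ := fun v => (adjGraph A).setDist (nearSet A Q) v + 1 with hℓ
  refine initialSegment_induction (fun v => if v ∈ Q then 0 else ℓ v) (DRep A) Q hQ ?_ ?_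
  · intro h hh g _
    simp [hh]
  · intro U v hQU hU hv hle hlt
    have hvQ : v ∉ Q := fun h => hv (hQU h)
    simp only [hvQ, if_false] at hle hlt
    refine DRep.insert_of_cluster hP hA hgood hG hadj hcard (ℓ := ℓ) (fun _ => rfl) hQU hU hv ?_ ?_
    · intro h hh hhQ
      simpa [hhQ] using hle h hh
    · intro g hg
      refine hlt g ?_
      split_ifs
      · simp [hℓ]
      · exact hg

end

/-- Ramsey's theorem for two colours. -/
theorem exists_ramsey (s t : ℕ) : ∃ N : ℕ, ∀ {V : Type} (P : V → V → Prop),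
    (∀ x y, P x y → P y x) → ∀ S : Finset V, N ≤ S.card →
    (∃ T ⊆ S, T.card = s ∧ (T : Set V).Pairwise P) ∨
      ∃ T ⊆ S, T.card = t ∧ (T : Set V).Pairwise fun x y => ¬ P x y := by
  induction s generalizing t with
  | zero => exact ⟨0, fun P _ S _ => Or.inl ⟨∅, by simp⟩⟩
  | succ s ihs =>
    induction t with
    | zero => exact ⟨0, fun P _ S _ => Or.inr ⟨∅, by simp⟩⟩
    | succ t iht =>
      obtain ⟨N₁, h₁⟩ := ihs (t + 1)
      obtain ⟨N₂, h₂⟩ := iht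
      refine ⟨N₁ + N₂ + 1, fun {V} P hP S hS => ?_⟩
      classical
      obtain ⟨x, hx⟩ := Finset.card_pos.1 (by omega : 0 < S.card)
      have hc := Finset.card_filter_add_card_filter_not (s := S.erase x) (fun y => P x y)
      rw [Finset.card_erase_of_mem hx] at hc
      have hsub : ∀ (p : V → Prop) [DecidablePred p] (T : Finset V), T ⊆ (S.erase x).filter p →
          x ∉ T ∧ insert x T ⊆ S ∧ ∀ y ∈ T, p y := by
        intro p _ T hT
        have hT' : ∀ y ∈ T, (y ≠ x ∧ y ∈ S) ∧ p y := fun y hy => by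
          simpa only [Finset.mem_filter, Finset.mem_erase] using hT hy
        exact ⟨fun h => (hT' x h).1.1 rfl, Finset.insert_subset hx fun y hy => (hT' y hy).1.2,
          fun y hy => (hT' y hy).2⟩
      rcases le_or_gt N₁ ((S.erase x).filter fun y => P x y).card with h | h
      · rcases h₁ P hP _ h with ⟨T, hT, hTc, hTP⟩ | ⟨T, hT, hTc, hTP⟩
        · obtain ⟨hxT, hTS, hTp⟩ := hsub _ T hT
          refine Or.inl ⟨insert x T, hTS, by rw [Finset.card_insert_of_notMem hxT, hTc], ?_⟩
          rw [Finset.coe_insert]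
          exact hTP.insert fun y hy _ => ⟨hTp y hy, hP _ _ (hTp y hy)⟩
        · obtain ⟨-, hTS, -⟩ := hsub _ T hT
          exact Or.inr ⟨T, (Finset.subset_insert _ _).trans hTS, hTc, hTP⟩
      · rcases h₂ P hP ((S.erase x).filter fun y => ¬ P x y) (by omega) with
          ⟨T, hT, hTc, hTP⟩ | ⟨T, hT, hTc, hTP⟩
        · obtain ⟨-, hTS, -⟩ := hsub _ T hT
          exact Or.inl ⟨T, (Finset.subset_insert _ _).trans hTS, hTc, hTP⟩
        · obtain ⟨hxT, hTS, hTp⟩ := hsub _ T hT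
          refine Or.inr ⟨insert x T, hTS, by rw [Finset.card_insert_of_notMem hxT, hTc], ?_⟩
          rw [Finset.coe_insert]
          exact hTP.insert fun y hy _ => ⟨hTp y hy, fun h => hTp y hy (hP _ _ h)⟩

section

variable {V : Type} [Fintype V] [DecidableEq V] {A : V → V → ℤ} {δ : ℝ}

/-- Evaluation of the quadratic form on a vertex `p` together with a set of its neighbours. -/
theorem qform_star (hA : IsSignedMat A) (lam : ℝ) {p : V} {T : Finset V}
    (hT : ∀ x ∈ T, A p x ≠ 0) {c : ℤ}
    (hc : ∀ x ∈ T, ∀ y ∈ T, x ≠ y → A p x * A x y * A p y = c) (a b : ℝ) :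
    qform A lam (fun v => if v = p then a else if v ∈ T then b * A p v else 0) =
      lam * (a ^ 2 + T.card * b ^ 2) + 2 * T.card * a * b + T.card * (T.card - 1) * c * b ^ 2 := by
  have hp : p ∉ T := fun h => hT p h (hA.diag p)
  have hsq : ∀ x ∈ T, (A p x : ℝ) ^ 2 = 1 := by
    intro x hx
    have h1 := hA.lower p x
    have h2 := hA.upper p x
    have h3 := hT x hx
    obtain e | e : A p x = 1 ∨ A p x = -1 := by omega
    all_goals rw [e]; norm_num
  set w : V → ℝ := fun v => if v = p then a else if v ∈ T then b * A p v else 0 with hw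
  have hsum : ∀ g : V → ℝ, (∀ v, v ∉ insert p T → g v = 0) →
      ∑ v, g v = g p + ∑ v ∈ T, g v := by
    intro g hg
    rw [← Finset.sum_insert hp]
    exact (Finset.sum_subset (Finset.subset_univ _) fun v _ hv => hg v hv).symm
  have hwp : w p = a := if_pos rfl
  have hwT : ∀ x ∈ T, w x = b * A p x := fun x hx => by
    simp only [hw]
    rw [if_neg (by rintro rfl; exact hp hx), if_pos hx]
  have hw0 : ∀ v, v ∉ insert p T → w v = 0 := fun v hv => by
    rw [Finset.mem_insert, not_or] at hv
    simp only [hw]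
    rw [if_neg hv.1, if_neg hv.2]
  have h1 : ∑ v, w v ^ 2 = a ^ 2 + T.card * b ^ 2 := by
    rw [hsum _ (fun v hv => by rw [hw0 v hv]; ring), hwp, Finset.sum_congr rfl (g := fun _ => b ^ 2)
      (fun x hx => by rw [hwT x hx, mul_pow, hsq x hx, mul_one]), Finset.sum_const, nsmul_eq_mul]
  have hcol : ∑ j, (A p j : ℝ) * w p * w j = T.card * (a * b) := by
    rw [hsum _ (fun v hv => by rw [hw0 v hv]; ring), hA.diag,
      Finset.sum_congr rfl (g := fun _ => a * b)
      (fun x hx => by rw [hwT x hx, hwp]; linear_combination a * b * hsq x hx), Finset.sum_const,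
      nsmul_eq_mul]
    simp
  have hrow : ∀ x ∈ T, ∑ j, (A x j : ℝ) * w x * w j = a * b + (T.card - 1) * c * b ^ 2 := by
    intro x hx
    rw [hsum _ (fun v hv => by rw [hw0 v hv]; ring), hA.symm x p, hwp, hwT x hx,
      ← Finset.add_sum_erase _ _ hx, hA.diag, Finset.sum_congr rfl (g := fun _ => (c : ℝ) * b ^ 2)
      (fun y hy => ?_), Finset.sum_const, nsmul_eq_mul, Finset.card_erase_of_mem hx,
      Nat.cast_sub (Finset.card_pos.2 ⟨x, hx⟩)]
    · push_cast
      linear_combination a * b * hsq x hx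
    · rw [Finset.mem_erase] at hy
      have := hc x hx y hy.2 hy.1.symm
      rw [hwT y hy.2, ← this]
      push_cast
      ring
  rw [qform, h1, hsum _ (fun v hv => by simp [hw0 v hv]), hcol, Finset.sum_congr rfl hrow,
    Finset.sum_const, nsmul_eq_mul]
  ring

/-- A high degree vertex of a good signed graph gives a large clique representing a hub. -/
theorem exists_cluster (D : ℕ) : ∃ Δ : ℕ, ∀ {V : Type} [Fintype V] [DecidableEq V] (A : V → V → ℤ)
    (δ : ℝ), 0 ≤ δ → δ ≤ 0.0199 → IsSignedMat A → (∀ x, 0 ≤ qform A (2 + δ) x) → ∀ p : V,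
    Δ < {u | A p u ≠ 0}.ncard → ∃ Q : Finset V, Q.card = D ∧
      (∀ q ∈ Q, ∀ q' ∈ Q, q ≠ q' → A q q' ≠ 0) ∧ DRep A Q := by
  obtain ⟨N₂, h₂⟩ := exists_ramsey D 3
  obtain ⟨N₁, h₁⟩ := exists_ramsey 5 N₂
  refine ⟨N₁, fun {V} _ _ A δ hδ0 hδ hA hgood p hp => ?_⟩
  set S : Finset V := Finset.univ.filter fun u => A p u ≠ 0 with hS
  have hSc : N₁ ≤ S.card := by
    have : {u | A p u ≠ 0}.ncard = S.card := by
      rw [← Set.ncard_coe_finset]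
      simp [hS]
    omega
  have hSp : ∀ x ∈ S, A p x ≠ 0 := fun x hx => (Finset.mem_filter.1 hx).2
  have hsymm : ∀ x y, A p x * A x y * A p y = A p y * A y x * A p x := fun x y => by
    rw [hA.symm x y]
    ring
  rcases h₁ (fun x y => A p x * A x y * A p y = 0) (fun x y h => hsymm x y ▸ h) S hSc with
    ⟨T, hTS, hT, hTP⟩ | ⟨T, hTS, hT, hTP⟩
  · exfalso
    have h3 := hgood (fun v => if v = p then -2 else if v ∈ T then 1 * A p v else 0)
    rw [qform_star hA (2 + δ) (fun x hx => hSp x (hTS hx)) (c := 0)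
      (fun x hx y hy hxy => hTP hx hy hxy), hT] at h3
    push_cast at h3
    linarith
  have hpos : ∀ x ∈ S, (A p x = 1 ∨ A p x = -1) := fun x hx => by
    have h1 := hA.lower p x
    have h2 := hA.upper p x
    have h3 := hSp x hx
    omega
  rcases h₂ (fun x y => A p x * A x y * A p y = 1) (fun x y h => hsymm x y ▸ h) T hT.ge with
    ⟨Q, hQT, hQ, hQP⟩ | ⟨Q, hQT, hQ, hQP⟩
  · refine ⟨Q, hQ, fun q hq q' hq' hne h0 => ?_, ?_⟩
    · have := hQP hq hq' hne
      simp [h0] at this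
    · refine ⟨Option Q, inferInstance, fun c v => A p v * c.elim 1 fun q => if q = v then 1 else 0,
        fun g hg h hh => ?_⟩
      rw [Fintype.sum_option]
      simp only [Option.elim]
      have hg1 := hpos g (hTS (hQT hg))
      have hh1 := hpos h (hTS (hQT hh))
      have hs : ∑ i : Q, A p g * (if (i : V) = g then 1 else 0) *
          (A p h * if (i : V) = h then 1 else 0) = if g = h then A p g * A p h else 0 := by
        rw [Finset.sum_eq_single ⟨g, hg⟩]
        · by_cases hgh : g = h <;> simp [hgh]
        · rintro ⟨i, hi⟩ _ hne
          have : i ≠ g := fun h => hne (Subtype.ext h)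
          simp [this]
        · exact fun h => absurd (Finset.mem_univ _) h
      rw [hs]
      by_cases hgh : g = h
      · subst hgh
        rw [if_pos rfl, if_pos rfl, hA.diag]
        rcases hg1 with e | e <;> rw [e] <;> norm_num
      · have : A p g * A g h * A p h = 1 := hQP hg hh hgh
        rw [if_neg hgh, if_neg hgh]
        rcases hg1 with e | e <;> rcases hh1 with e' | e' <;> rw [e, e'] at this <;> rw [e, e'] <;>
          linarith
  · exfalso
    have h3 := hgood (fun v => if v = p then -1 else if v ∈ Q then 1 * A p v else 0)
    rw [qform_star hA (2 + δ) (fun x hx => hSp x (hTS (hQT hx))) (c := -1)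
      (fun x hx y hy hxy => ?_), hQ] at h3
    · push_cast at h3
      linarith
    · have e1 := hTP (hQT hx) (hQT hy) hxy
      have e2 := hQP hx hy hxy
      have l1 := hA.lower x y
      have l2 := hA.upper x y
      rcases hpos x (hTS (hQT hx)) with e | e <;> rcases hpos y (hTS (hQT hy)) with e' | e' <;>
        simp only [e, e'] at e1 e2 ⊢ <;> omega

end

/-- Large connected good signed graphs are represented by vectors `±e_c ± e_d`. -/
theorem exists_dRep_bound {δ C₀ κ : ℝ} (hP : Params δ C₀ κ) {K : ℕ → ℝ} {n₀ : ℕ}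
    (hK : IsConduct δ C₀ K n₀) : ∃ N : ℕ, ∀ {V : Type} [Fintype V] [DecidableEq V] (A : V → V → ℤ),
    IsSignedMat A → (∀ x, 0 ≤ qform A (2 + δ) x) → (adjGraph A).Connected → N < Fintype.card V →
    DRep A Finset.univ := by
  obtain ⟨D, hD⟩ := exists_nat_ge (28 / κ)
  obtain ⟨Δ, hΔ⟩ := exists_cluster D
  refine ⟨(Δ + 1) ^ (2 * (n₀ + 3)), fun {V} _ _ A hA hgood hG hV => ?_⟩
  by_cases h : ∃ p, Δ < {u | A p u ≠ 0}.ncard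
  · obtain ⟨p, hp⟩ := h
    obtain ⟨Q, hQ, hadj, hrep⟩ := hΔ A δ hP.δ_pos.le hP.δ_le hA hgood p hp
    refine DRep.univ_of_cluster hP hA hgood hG hadj ?_ hrep
    rw [hQ]
    rwa [div_le_iff₀' hP.κ_pos] at hD
  · push Not at h
    exact DRep.univ_of_degree_le hP hK hA hgood hG h hV

/-- The iteration computing the conductances of paths converges to its fixed point. -/
theorem exists_isConduct {s : ℝ} (hs : 1 < s) {C₀ : ℝ} (hC : C₀ < 1 / (s - 1)) :
    ∃ (K : ℕ → ℝ) (n₀ : ℕ), IsConduct (s + 1 / s - 2) C₀ K n₀ := by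
  set δ := s + 1 / s - 2 with hδ
  set C := 1 / (s - 1) with hCdef
  have hs0 : 0 < s := by linarith
  have hs1 : 0 < s - 1 := by linarith
  have hδs : δ = (s - 1) ^ 2 / s := by
    rw [hδ]
    field_simp
    ring
  have hδ0 : 0 < δ := by
    rw [hδs]
    positivity
  have hC0 : 0 < C := by positivity
  have hfix : δ * (1 + C) + 1 = s := by
    rw [hδs, hCdef]
    field_simp
    ring
  have hCs : C * s = 1 + C := by
    rw [hCdef]
    field_simp
    ring
  clear_value δ C
  let K : ℕ → ℝ := fun n => Nat.rec 0 (fun _ k => 1 / (δ + 1 / (1 + k))) n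
  have hK : ∀ n, K (n + 1) = 1 / (δ + 1 / (1 + K n)) := fun n => rfl
  have hmain : ∀ n, 0 ≤ K n ∧ 0 ≤ C - K n ∧ (C - K n) * s ^ n ≤ C := by
    intro n
    induction n with
    | zero => exact ⟨le_rfl, by change 0 ≤ C - 0; linarith, by change (C - 0) * s ^ 0 ≤ C; simp⟩
    | succ n ih =>
      obtain ⟨h1, h2, h3⟩ := ih
      have hd : 0 < δ * (1 + K n) := by positivity
      have e1 : K (n + 1) = (1 + K n) / (δ * (1 + K n) + 1) := by
        rw [hK]
        field_simp
      have e2 : C - K (n + 1) = (C - K n) / (s * (δ * (1 + K n) + 1)) := by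
        rw [e1]
        field_simp
        linear_combination (δ * (1 + K n) + 1) * hCs + (1 + K n) * hfix
      refine ⟨by rw [e1]; positivity, by rw [e2]; positivity, ?_⟩
      have e3 : (C - K (n + 1)) * s ^ (n + 1) = (C - K n) * s ^ n / (δ * (1 + K n) + 1) := by
        rw [e2, pow_succ]
        field_simp
      rw [e3]
      refine (div_le_self (by positivity) (by linarith)).trans h3
  obtain ⟨n, hn⟩ := pow_unbounded_of_one_lt (C / (C - C₀)) hs
  refine ⟨K, n, rfl, fun n => (hmain n).1, fun n => ?_, ?_⟩
  · have := (hmain n).1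
    rw [hK, one_div, inv_mul_cancel₀ (by positivity)]
  · have hsn : 0 < s ^ n := by positivity
    have h4 : 0 < C - C₀ := by linarith
    rw [div_lt_iff₀ h4] at hn
    have := (hmain n).2.2
    refine le_of_not_gt fun hlt => ?_
    nlinarith

/-- Below the threshold, the numerical conditions can be met. -/
theorem exists_params {σ lam : ℝ} (hσ : 1 < σ) (hσ6 : σ ^ 6 = σ ^ 2 + 1) (h : lam < σ + 1 / σ) :
    ∃ (δ C₀ κ : ℝ) (K : ℕ → ℝ) (n₀ : ℕ), lam < 2 + δ ∧ Params δ C₀ κ ∧ IsConduct δ C₀ K n₀ := by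
  have hlow : 1.15 < σ := by
    by_contra! hle
    have h2 : 1 < σ ^ 2 := by nlinarith
    have h3 : σ ^ 2 ≤ 1.3225 := by nlinarith
    nlinarith [mul_nonneg (sub_nonneg.2 h2.le) (sub_nonneg.2 h3)]
  have hup : σ < 1.151 := by
    by_contra! hle
    have h2 : 1.3248 ≤ σ ^ 2 := by nlinarith
    have h4 : 1.755 ≤ σ ^ 4 := by nlinarith
    nlinarith
  obtain ⟨s, hs1, hs2, hs3⟩ : ∃ s, 1.15 < s ∧ s < σ ∧ lam < s + 1 / s := by
    have hcont : ContinuousAt (fun s : ℝ => s + 1 / s) σ := by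
      have : σ ≠ 0 := by linarith
      fun_prop (disch := exact this)
    have h1 := (hcont.eventually (lt_mem_nhds h)).filter_mono (nhdsWithin_le_nhds (s := Set.Iio σ))
    obtain ⟨s, ha, hb, hc⟩ := (h1.and ((eventually_mem_nhdsWithin (s := Set.Iio σ)).and
      ((lt_mem_nhds hlow).filter_mono (nhdsWithin_le_nhds (s := Set.Iio σ))))).exists
    exact ⟨s, hc, hb, ha⟩
  have hs0 : 0 < s := by linarith
  have hsm : 0 < s - 1 := by linarith
  have hs6 : s ^ 6 < s ^ 2 + 1 := by
    have h2 : s ^ 2 < σ ^ 2 := by nlinarith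
    have h3 : 1 < s ^ 2 := by nlinarith
    have h4 : s ^ 4 < σ ^ 4 := by nlinarith
    have h5 : s ^ 2 * (s ^ 4 - 1) < σ ^ 2 * (σ ^ 4 - 1) :=
      mul_lt_mul'' h2 (by linarith) (by linarith) (by nlinarith)
    linarith
  set δ := s + 1 / s - 2 with hδ
  set C := 1 / (s - 1) with hCdef
  have hδs : δ = (s - 1) ^ 2 / s := by
    rw [hδ]
    field_simp
    ring
  have hfix : δ * (1 + C) + 1 = s := by
    rw [hδs, hCdef]
    field_simp
    ring
  have hC1 : 6.6 < C := by
    rw [hCdef, lt_div_iff₀ hsm]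
    linarith
  have hC2 : C < 6.7 := by
    rw [hCdef, div_lt_iff₀ hsm]
    linarith
  have hδ1 : 0.0195 ≤ δ := by
    rw [hδs, le_div_iff₀ hs0]
    nlinarith
  have hδ2 : δ ≤ 0.0199 := by
    rw [hδs, div_le_iff₀ hs0]
    nlinarith
  have htight : 2 + δ + (C - C) < 1 / (2 * (2 + δ)) + (C + 1) / (2 * (2 + δ * (C + 1))) := by
    have e1 : 2 + δ = (s ^ 2 + 1) / s := by
      rw [hδ]
      field_simp
      ring
    have e2 : 2 + δ * (C + 1) = s + 1 := by linarith
    have e3 : C + 1 = s / (s - 1) := by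
      rw [hCdef]
      field_simp
      ring
    have e4 : 1 / (2 * (2 + δ)) + (C + 1) / (2 * (2 + δ * (C + 1))) =
        s ^ 3 / ((s ^ 2 + 1) * ((s - 1) * (s + 1))) := by
      rw [e2, e3, e1]
      field_simp
      ring
    rw [e4, e1, sub_self, add_zero, div_lt_div_iff₀ hs0 (by positivity)]
    nlinarith
  obtain ⟨C₀, h1, h2, h3, h4⟩ : ∃ C₀, 6.6 < C₀ ∧ C₀ < C ∧ C - C₀ < 0.001 ∧
      2 + δ + (C - C₀) < 1 / (2 * (2 + δ)) + (C₀ + 1) / (2 * (2 + δ * (C₀ + 1))) := by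
    have hcont : ContinuousAt (fun x : ℝ => 1 / (2 * (2 + δ)) +
        (x + 1) / (2 * (2 + δ * (x + 1))) - (2 + δ + (C - x))) C := by
      have : 2 * (2 + δ * (C + 1)) ≠ 0 := by positivity
      fun_prop (disch := exact this)
    have hev := hcont.eventually (lt_mem_nhds (sub_pos.2 htight))
    have hev' := (hev.and ((lt_mem_nhds hC1).and (lt_mem_nhds (show C - 0.001 < C by
      linarith)))).filter_mono (nhdsWithin_le_nhds (s := Set.Iio C))
    obtain ⟨x, ⟨ha, hb, hc⟩, hd⟩ := (hev'.and self_mem_nhdsWithin).exists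
    have hd' : x < C := hd
    exact ⟨x, hb, hd, by linarith, by linarith⟩
  obtain ⟨K, n₀, hK⟩ := exists_isConduct (by linarith : 1 < s) h2
  refine ⟨δ, C₀, C - C₀, K, n₀, by linarith, ⟨hδ1, hδ2, h1.le, by linarith, by linarith, h3.le,
    h4, ?_⟩, hK⟩
  have hp : 0 < 1 + C₀ := by linarith
  have e : C₀ * (δ + 1 / (1 + C₀)) = (C₀ * (δ * (1 + C₀) + 1)) / (1 + C₀) := by
    field_simp
  have h5 : δ * (1 + C₀) ≤ s - 1 := by nlinarith
  have h6 : C₀ * (s - 1) ≤ 1 := by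
    have : C * (s - 1) = 1 := by
      rw [hCdef]
      field_simp
    nlinarith
  rw [e, div_le_one hp]
  nlinarith

/-- `A` is minimal among the signed graphs for which `qform · lam` takes negative values. -/
structure IsMinBad {V : Type*} [Fintype V] (A : V → V → ℤ) (lam : ℝ) : Prop where
  bad : ∃ x, qform A lam x < 0
  nonneg : ∀ x v, x v = 0 → 0 ≤ qform A lam x

theorem exists_isMinBad {V : Type*} [Fintype V] {A : V → V → ℤ} {lam : ℝ}
    (h : ∃ x, qform A lam x < 0) :
    ∃ S : Finset V, IsMinBad (fun i j : S => A i j) lam := by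
  classical
  have hex : ∃ n, ∃ x, qform A lam x < 0 ∧ (Finset.univ.filter fun i => x i ≠ 0).card = n := by
    obtain ⟨x, hx⟩ := h
    exact ⟨_, x, hx, rfl⟩
  obtain ⟨x, hx, hn⟩ := Nat.find_spec hex
  have hmin : ∀ y, qform A lam y < 0 →
      Nat.find hex ≤ (Finset.univ.filter fun i => y i ≠ 0).card :=
    fun y hy => Nat.find_min' hex ⟨y, hy, rfl⟩
  set S := Finset.univ.filter fun i => x i ≠ 0 with hS
  refine ⟨S, ⟨fun i => x i, ?_⟩, fun y v hv => ?_⟩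
  · rw [← qform_extend A lam Subtype.val_injective]
    convert hx
    ext i
    by_cases hi : i ∈ S
    · exact Subtype.val_injective.extend_apply (fun i : S => x i) 0 ⟨i, hi⟩
    · rw [Function.extend_apply' _ _ _ (by rintro ⟨a, rfl⟩; exact hi a.2)]
      have : x i = 0 := by simpa [hS] using hi
      rw [this]
      rfl
  · by_contra! hneg
    rw [← qform_extend A lam Subtype.val_injective] at hneg
    have h1 := hmin _ hneg
    rw [← hn] at h1
    refine absurd h1 (not_le.2 (Finset.card_lt_card ⟨fun i hi => ?_, fun hsub => ?_⟩))
    · rw [Finset.mem_filter] at hi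
      by_contra hiS
      rw [Function.extend_apply' _ _ _ (by rintro ⟨a, rfl⟩; exact hiS a.2)] at hi
      exact hi.2 rfl
    · have h2 := (Finset.mem_filter.1 (hsub v.2)).2
      rw [Subtype.val_injective.extend_apply] at h2
      exact h2 hv

section

variable {V : Type*} [Fintype V] {A : V → V → ℤ} {lam : ℝ}

theorem IsMinBad.nonneg_of_support [DecidableEq V] (hM : IsMinBad A lam) {x : V → ℝ}
    {S : Finset V} (hS : ∀ v ∉ S, x v = 0) (hV : S.card < Fintype.card V) :
    0 ≤ qform A lam x := by
  obtain ⟨v, hv⟩ : ∃ v, v ∉ S := by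
    by_contra! h
    rw [Finset.eq_univ_iff_forall.2 h, Finset.card_univ] at hV
    exact hV.false
  exact hM.nonneg x v (hS v hv)

theorem IsMinBad.qform_ge (hA : IsSignedMat A) (hM : IsMinBad A lam) (x : V → ℝ) :
    0 ≤ (Fintype.card V - 2) * qform A lam x + lam * ∑ i, x i ^ 2 := by
  classical
  have h : ∀ v, qform A lam (fun i => x i - if i = v then x v else 0) =
      qform A lam x - 2 * ∑ j, (A v j : ℝ) * x v * x j - lam * x v ^ 2 := by
    intro v
    have e1 : ∑ i, (x i - if i = v then x v else 0) ^ 2 = ∑ i, x i ^ 2 - x v ^ 2 := by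
      have : ∀ i, (x i - if i = v then x v else 0) ^ 2 =
          x i ^ 2 - if i = v then x v ^ 2 else 0 := by
        intro i
        by_cases hi : i = v
        · subst hi
          simp
        · simp [hi]
      simp only [this, Finset.sum_sub_distrib, Finset.sum_ite_eq', Finset.mem_univ, if_true]
    have e2 : ∑ i, ∑ j, (A i j : ℝ) * (x i - if i = v then x v else 0) *
        (x j - if j = v then x v else 0) =
        ∑ i, ∑ j, (A i j : ℝ) * x i * x j - 2 * ∑ j, (A v j : ℝ) * x v * x j := by
      have : ∀ i j, (A i j : ℝ) * (x i - if i = v then x v else 0) *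
          (x j - if j = v then x v else 0) = (A i j : ℝ) * x i * x j -
          (if i = v then (A v j : ℝ) * x v * x j else 0) -
          (if j = v then (A v i : ℝ) * x v * x i else 0) +
          if i = v then if j = v then (A v v : ℝ) * x v * x v else 0 else 0 := by
        intro i j
        by_cases hi : i = v <;> by_cases hj : j = v
        · subst hi hj
          simp
        · subst hi
          simp [hj]
        · subst hj
          simp [hi, hA.symm i j]
          ring
        · simp [hi, hj]
      simp only [this, Finset.sum_sub_distrib, Finset.sum_add_distrib, Finset.sum_ite_eq',
        Finset.mem_univ, if_true, hA.diag, Finset.sum_ite_irrel, Finset.sum_const_zero]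
      simp
      ring
    rw [qform, qform, e1, e2]
    ring
  have h2 : 0 ≤ ∑ v, (qform A lam x - 2 * ∑ j, (A v j : ℝ) * x v * x j - lam * x v ^ 2) :=
    Finset.sum_nonneg fun v _ => by
      rw [← h v]
      exact hM.nonneg _ v (by simp)
  rw [Finset.sum_sub_distrib, Finset.sum_sub_distrib, ← Finset.mul_sum, ← Finset.mul_sum,
    Finset.sum_const, nsmul_eq_mul, Finset.card_univ] at h2
  have h3 : ∑ v, ∑ j, (A v j : ℝ) * x v * x j = qform A lam x - lam * ∑ i, x i ^ 2 := by
    rw [qform]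
    ring
  rw [h3] at h2
  linarith

theorem IsMinBad.good (hA : IsSignedMat A) (hM : IsMinBad A lam) {lam' : ℝ}
    (h2 : 2 < Fintype.card V)
    (h : lam ≤ (lam' - lam) * (Fintype.card V - 2)) (x : V → ℝ) : 0 ≤ qform A lam' x := by
  have h1 := hM.qform_ge hA x
  have h3 : (0 : ℝ) < Fintype.card V - 2 := by
    have : (2 : ℝ) < Fintype.card V := by exact_mod_cast h2
    linarith
  have h4 := qform_add_lam A lam (lam' - lam) x
  rw [add_sub_cancel] at h4
  have h5 : 0 ≤ ∑ i, x i ^ 2 := Finset.sum_nonneg fun i _ => sq_nonneg _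
  rw [h4]
  have h6 := mul_le_mul_of_nonneg_right h h5
  refine nonneg_of_mul_nonneg_right ?_ h3
  nlinarith

/-- If a symmetric matrix splits into two blocks, so does its quadratic form. -/
theorem qform_split (hA : ∀ i j, A i j = A j i) (S : V → Prop) [DecidablePred S]
    (h : ∀ i j, S i → ¬ S j → A i j = 0) (x : V → ℝ) :
    qform A lam x = qform A lam (fun i => if S i then x i else 0) +
      qform A lam (fun i => if S i then 0 else x i) := by
  simp only [qform]
  have e1 : ∀ i, x i ^ 2 = (if S i then x i else 0) ^ 2 + (if S i then 0 else x i) ^ 2 := by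
    intro i
    by_cases hi : S i <;> simp [hi]
  have e2 : ∀ i j, (A i j : ℝ) * x i * x j =
      (A i j : ℝ) * (if S i then x i else 0) * (if S j then x j else 0) +
      (A i j : ℝ) * (if S i then 0 else x i) * (if S j then 0 else x j) := by
    intro i j
    by_cases hi : S i <;> by_cases hj : S j
    · simp [hi, hj]
    · simp [hi, hj, h i j hi hj]
    · simp [hi, hj, hA i j, h j i hj hi]
    · simp [hi, hj]
  rw [Finset.sum_congr rfl fun i _ => e1 i,
    Finset.sum_congr rfl fun i _ => Finset.sum_congr rfl fun j _ => e2 i j]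
  simp only [Finset.sum_add_distrib]
  ring

theorem IsMinBad.connected_of (hM : IsMinBad A lam) (hA : ∀ i j, A i j = A j i)
    {H : SimpleGraph V} (hH : ∀ i j, i ≠ j → A i j ≠ 0 → H.Adj i j) : H.Connected := by
  classical
  obtain ⟨x, hx⟩ := hM.bad
  have hne : Nonempty V := by
    by_contra h
    rw [not_nonempty_iff] at h
    simp [qform] at hx
  rw [SimpleGraph.connected_iff]
  refine ⟨fun u v => ?_, hne⟩
  by_contra huv
  rw [qform_split hA (fun w => H.Reachable u w) fun i j hi hj => ?_] at hx
  · have h1 := hM.nonneg (fun i => if H.Reachable u i then x i else 0) v (by simp [huv])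
    have h2 := hM.nonneg (fun i => if H.Reachable u i then 0 else x i) u (by simp)
    linarith
  · by_contra h0
    refine hj (hi.trans (hH i j ?_ h0).reachable)
    rintro rfl
    exact hj hi

theorem IsMinBad.connected (hA : IsSignedMat A) (hM : IsMinBad A lam) : (adjGraph A).Connected :=
  hM.connected_of hA.symm fun _ _ _ h => hA.adj_iff.2 h

end

/-- A quadratic form given by an induced path takes the value of a suitable alternating vector. -/
theorem exists_qform_path {V : Type*} [Fintype V] {A : V → V → ℤ} (hA : IsSignedMat A) {p : ℕ → V}
    {n : ℕ} (hadj : ∀ i < n, A (p i) (p (i + 1)) ≠ 0)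
    (hfar : ∀ i j, i + 2 ≤ j → j ≤ n → A (p i) (p j) = 0)
    (hinj : ∀ i j, i < j → j ≤ n → p i ≠ p j) :
    ∃ x : V → ℝ, (∀ i ≤ n, x (p i) ^ 2 = 1) ∧ (∀ v, (∀ i ≤ n, p i ≠ v) → x v = 0) ∧
      ∀ lam, qform A lam x = lam * (n + 1) - 2 * n := by
  let s : ℕ → ℝ := fun n => Nat.rec 1 (fun i t => -(A (p i) (p (i + 1))) * t) n
  have hs : ∀ i, s (i + 1) = -(A (p i) (p (i + 1))) * s i := fun i => rfl
  have hsq : ∀ i < n, (A (p i) (p (i + 1)) : ℝ) ^ 2 = 1 := fun i hi => by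
    have h1 := hA.lower (p i) (p (i + 1))
    have h2 := hA.upper (p i) (p (i + 1))
    have h3 := hadj i hi
    have : A (p i) (p (i + 1)) = 1 ∨ A (p i) (p (i + 1)) = -1 := by omega
    rcases this with e | e <;> rw [e] <;> norm_num
  have hs2 : ∀ i ≤ n, s i ^ 2 = 1 := by
    intro i
    induction i with
    | zero => exact fun _ => one_pow 2
    | succ i ih =>
      intro hi
      rw [hs, mul_pow, neg_sq, hsq i hi, ih (by omega), one_mul]
  have hsum : ∀ m ≤ n, ∑ i ∈ Finset.range (m + 1), ∑ j ∈ Finset.range (m + 1),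
      (A (p i) (p j) : ℝ) * s i * s j = -2 * m := by
    intro m
    induction m with
    | zero => simp [hA.diag]
    | succ m ih =>
      intro hm
      have h1 : ∑ i ∈ Finset.range (m + 1), (A (p i) (p (m + 1)) : ℝ) * s i * s (m + 1) = -1 := by
        rw [Finset.sum_range_succ, Finset.sum_eq_zero fun i hi => ?_, hs]
        · linear_combination (-s m ^ 2) * hsq m (by omega) - hs2 m (by omega)
        · rw [hfar i (m + 1) (by rw [Finset.mem_range] at hi; omega) hm]
          simp
      have h2 : ∑ j ∈ Finset.range (m + 1), (A (p (m + 1)) (p j) : ℝ) * s (m + 1) * s j = -1 := by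
        rw [← h1]
        exact Finset.sum_congr rfl fun j _ => by
          rw [hA.symm]
          ring
      rw [Finset.sum_range_succ]
      simp only [fun i => Finset.sum_range_succ (fun j => (A (p i) (p j) : ℝ) * s i * s j) (m + 1)]
      rw [Finset.sum_add_distrib, ih (by omega), h1, h2, hA.diag]
      push_cast
      ring
  have hf : Function.Injective fun i : Fin (n + 1) => p i := by
    intro i j hij
    by_contra hne
    rcases lt_or_gt_of_ne hne with h | h
    · exact hinj i j h (by omega) hij
    · exact hinj j i h (by omega) hij.symm
  refine ⟨Function.extend (fun i : Fin (n + 1) => p i) (fun i => s i) 0, fun i hi => ?_,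
    fun v hv => ?_, fun lam => ?_⟩
  · rw [show p i = (fun i : Fin (n + 1) => p i) ⟨i, by omega⟩ from rfl, hf.extend_apply]
    exact hs2 i hi
  · rw [Function.extend_apply']
    · rfl
    · rintro ⟨i, hi⟩
      exact hv i (by omega) hi
  · rw [qform_extend A lam hf, qform, Fin.sum_univ_eq_sum_range (fun i => s i ^ 2) (n + 1),
      Finset.sum_congr rfl (g := fun _ => (1 : ℝ)) fun i hi => hs2 i (by
        rw [Finset.mem_range] at hi; omega)]
    simp only [fun i : Fin (n + 1) =>
      Fin.sum_univ_eq_sum_range (fun j => (A (p i) (p j) : ℝ) * s i * s j) (n + 1)]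
    rw [Fin.sum_univ_eq_sum_range (fun i => ∑ j ∈ Finset.range (n + 1),
      (A (p i) (p j) : ℝ) * s i * s j) (n + 1), hsum n le_rfl]
    simp
    ring

/-- A long induced path does not fit into a minimal bad signed graph. -/
theorem IsMinBad.not_path {V : Type*} [Fintype V] [DecidableEq V] {A : V → V → ℤ} {lam : ℝ}
    (hA : IsSignedMat A) (hM : IsMinBad A lam) {p : ℕ → V} {n : ℕ}
    (hadj : ∀ i < n, A (p i) (p (i + 1)) ≠ 0)
    (hfar : ∀ i j, i + 2 ≤ j → j ≤ n → A (p i) (p j) = 0)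
    (hinj : ∀ i j, i < j → j ≤ n → p i ≠ p j) (hn : 2 < (2 - lam) * (n + 1))
    (hV : n + 1 < Fintype.card V) : False := by
  obtain ⟨x, -, hx, hq⟩ := exists_qform_path hA hadj hfar hinj
  have h1 := hM.nonneg_of_support (x := x) (S := (Finset.range (n + 1)).image p) (fun v hv => ?_)
    ((Finset.card_image_le.trans_eq (Finset.card_range _)).trans_lt hV)
  · rw [hq] at h1
    linarith
  · refine hx v fun i hi e => hv ?_
    exact e ▸ Finset.mem_image_of_mem _ (Finset.mem_range.2 (by omega))

/-- Finitely many quadratic forms which are negative somewhere are uniformly negative. -/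
theorem exists_uniform_gap (m : ℕ) (α : ℝ) : ∃ θ > 0, ∀ {W : Type} [Fintype W] (G : W → W → ℤ),
    Fintype.card W ≤ m → (∀ g h, -3 ≤ G g h) → (∀ g h, G g h ≤ 3) → (∃ x, qform G (-α) x < 0) →
    ∃ x : W → ℝ, x ≠ 0 ∧ qform G (-(α - θ)) x ≤ 0 := by
  have h1 : ∀ (k : Fin (m + 1)) (G : Fin k → Fin k → Set.Icc (-3 : ℤ) 3), ∀ᶠ θ in nhdsWithin (0 : ℝ)
      (Set.Ioi 0), (∃ x, qform (fun g h => (G g h : ℤ)) (-α) x < 0) →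
      ∃ x : Fin k → ℝ, x ≠ 0 ∧ qform (fun g h => (G g h : ℤ)) (-(α - θ)) x ≤ 0 := by
    intro k G
    by_cases h : ∃ x, qform (fun g h => (G g h : ℤ)) (-α) x < 0
    · obtain ⟨x, hx⟩ := h
      have hx0 : x ≠ 0 := by
        rintro rfl
        simp [qform] at hx
      have hc : ContinuousAt (fun θ : ℝ => qform (fun g h => (G g h : ℤ)) (-(α - θ)) x) 0 := by
        unfold qform
        fun_prop
      have := (hc.eventually (gt_mem_nhds (a := 0) (by simpa using hx))).filter_mono
        (nhdsWithin_le_nhds (s := Set.Ioi 0))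
      filter_upwards [this] with θ hθ _
      exact ⟨x, hx0, hθ.le⟩
    · exact Filter.Eventually.of_forall fun θ h' => absurd h' h
  have h2 := Filter.eventually_all.2 fun k => Filter.eventually_all.2 (h1 k)
  obtain ⟨θ, hθ, hθ0⟩ := (h2.and eventually_mem_nhdsWithin).exists
  refine ⟨θ, hθ0, fun {W} _ G hm hl hu => ?_⟩
  set k : Fin (m + 1) := ⟨Fintype.card W, by omega⟩
  let e : W ≃ Fin k := Fintype.equivFin W
  have hq : ∀ (lam : ℝ) (y : Fin k → ℝ), qform (fun g h => G (e.symm g) (e.symm h)) lam y =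
      qform G lam fun g => y (e g) := by
    intro lam y
    rw [← qform_extend G lam e.symm.injective]
    congr 1
    ext g
    have := e.symm.injective.extend_apply y 0 (e g)
    rwa [e.symm_apply_apply] at this
  rintro ⟨x, hx⟩
  obtain ⟨y, hy0, hy⟩ := hθ k (fun g h => ⟨G (e.symm g) (e.symm h), hl _ _, hu _ _⟩)
    ⟨fun g => x (e.symm g), by
      refine (hq (-α) _).trans_lt ?_
      simpa using hx⟩
  refine ⟨fun g => y (e g), fun h => hy0 ?_, ?_⟩
  · ext g
    simpa using congrFun h (e.symm g)
  · rw [← hq]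
    exact hy

/-- The coordinate `c` of the combination of the columns of `R` with coefficients `x`. -/
def coordSum {V C : Type*} [Fintype V] (R : C → V → ℤ) (x : V → ℝ) (c : C) : ℝ :=
  ∑ h, (R c h : ℝ) * x h

/-- Two columns are adjacent if they share a coordinate outside `F`. -/
def coordGraph {V C : Type*} (R : C → V → ℤ) (F : Set C) : SimpleGraph V where
  Adj g h := g ≠ h ∧ ∃ c ∉ F, R c g ≠ 0 ∧ R c h ≠ 0
  symm := ⟨fun _ _ h => ⟨h.1.symm, h.2.imp fun _ hc => ⟨hc.1, hc.2.2, hc.2.1⟩⟩⟩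
  loopless := ⟨fun _ h => h.1 rfl⟩

/-- The first `n + 1` values of `p` form an induced path. -/
structure IsInducedPath {V : Type*} (G : SimpleGraph V) (p : ℕ → V) (n : ℕ) : Prop where
  adj : ∀ i < n, G.Adj (p i) (p (i + 1))
  ne : ∀ i j, i < j → j ≤ n → p i ≠ p j
  far : ∀ i j, i + 2 ≤ j → j ≤ n → ¬ G.Adj (p i) (p j)

theorem IsInducedPath.of_level {V : Type*} {G : SimpleGraph V} {p : ℕ → V} {n : ℕ} {l : V → ℕ}
    (hl : ∀ g h, G.Adj g h → l h ≤ l g + 1) (hp : ∀ i ≤ n, l (p i) = i)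
    (ha : ∀ i < n, G.Adj (p i) (p (i + 1))) : IsInducedPath G p n := by
  refine ⟨ha, fun i j hij hj h => ?_, fun i j hij hj h => ?_⟩
  · have h1 := hp i (by omega)
    rw [h, hp j hj] at h1
    omega
  · have := hl _ _ h
    rw [hp i (by omega), hp j hj] at this
    omega

theorem IsInducedPath.mono {V : Type*} {G : SimpleGraph V} {p : ℕ → V} {n m : ℕ}
    (h : IsInducedPath G p n) (hm : m ≤ n) : IsInducedPath G p m :=
  ⟨fun i hi => h.adj i (by omega), fun i j hij hj => h.ne i j hij (by omega),
    fun i j hij hj => h.far i j hij (by omega)⟩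

theorem coordSum_add_smul {V C : Type*} [Fintype V] {R : C → V → ℤ} (x y : V → ℝ) (t : ℝ)
    (c : C) :
    coordSum R (fun h => x h + t * y h) c = coordSum R x c + t * coordSum R y c := by
  simp only [coordSum, mul_add, Finset.sum_add_distrib, Finset.mul_sum]
  congr 1
  exact Finset.sum_congr rfl fun h _ => by ring

theorem sum_coordSum_sq {V C : Type*} [Fintype V] {R : C → V → ℤ} (P : Finset C)
    (x : V → ℝ) : ∑ c ∈ P, coordSum R x c ^ 2 =
    ∑ g, ∑ h, ((∑ c ∈ P, R c g * R c h : ℤ) : ℝ) * x g * x h := by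
  simp only [coordSum, sq, Finset.sum_mul_sum]
  rw [Finset.sum_comm]
  refine Finset.sum_congr rfl fun g _ => ?_
  rw [Finset.sum_comm]
  refine Finset.sum_congr rfl fun h _ => ?_
  push_cast
  rw [Finset.sum_mul, Finset.sum_mul]
  exact Finset.sum_congr rfl fun c _ => by ring

section

variable {V C : Type*} [Fintype V] [DecidableEq V] [Fintype C] {A : V → V → ℤ} {R : C → V → ℤ}

theorem IsRep.qform_eq (hR : IsRep A Finset.univ R) (lam : ℝ) (x : V → ℝ) :
    qform A lam x = ∑ c, coordSum R x c ^ 2 - (2 - lam) * ∑ h, x h ^ 2 := by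
  have h : ∀ g h, ((∑ c, R c g * R c h : ℤ) : ℝ) * x g * x h =
      (A g h : ℝ) * x g * x h + if g = h then 2 * x g ^ 2 else 0 := fun g h => by
    rw [hR g (Finset.mem_univ _) h (Finset.mem_univ _)]
    by_cases hgh : g = h
    · subst hgh
      simp
      ring
    · simp [hgh]
  rw [sum_coordSum_sq]
  simp only [h, Finset.sum_add_distrib, Finset.sum_ite_eq, Finset.mem_univ, if_true]
  rw [qform, ← Finset.mul_sum]
  ring

theorem IsRep.ne_zero_of_common (hR : IsRep A Finset.univ R) (hA : IsSignedMat A) {g h : V} {c : C}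
    (hgh : g ≠ h) (hg : R c g ≠ 0) (hh : R c h ≠ 0) (huniq : ∀ d ≠ c, R d g ≠ 0 → R d h = 0) :
    A g h ≠ 0 := by
  classical
  obtain ⟨d, hd⟩ := hR.exists_isEdge hA (Finset.mem_univ g) hg
  have h1 := hR g (Finset.mem_univ _) h (Finset.mem_univ _)
  rw [hd.sum_eq fun e => R e h, huniq d hd.ne.symm hd.right_ne, if_neg hgh] at h1
  intro h0
  rw [h0] at h1
  simp [hg, hh] at h1

theorem IsRep.eq_zero_of_common (hR : IsRep A Finset.univ R) {g h : V}
    (hgh : g ≠ h) (hno : ∀ c, R c g ≠ 0 → R c h = 0) : A g h = 0 := by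
  have h1 := hR g (Finset.mem_univ _) h (Finset.mem_univ _)
  rw [if_neg hgh, add_zero] at h1
  rw [← h1]
  refine Finset.sum_eq_zero fun c _ => ?_
  by_cases hc : R c g = 0
  · simp [hc]
  · simp [hno c hc]

theorem IsInducedPath.ne_zero (hR : IsRep A Finset.univ R) (hA : IsSignedMat A) {F : Set C}
    {p : ℕ → V} {n : ℕ} (hp : IsInducedPath (coordGraph R F) p n) {i : ℕ} (hi : i + 2 ≤ n) :
    A (p i) (p (i + 1)) ≠ 0 := by
  obtain ⟨hne, c, hcF, hc, hc'⟩ := hp.adj i (by omega)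
  obtain ⟨-, e, heF, he, he'⟩ := hp.adj (i + 1) (by omega)
  refine hR.ne_zero_of_common hA hne hc hc' fun d hdc hd => ?_
  by_contra hd'
  refine hp.far i (i + 2) le_rfl hi ⟨hp.ne _ _ (by omega) hi, e, heF, ?_, he'⟩
  obtain ⟨d', hcd⟩ := hR.exists_isEdge hA (Finset.mem_univ (p (i + 1))) hc'
  have h1 : d = d' := (hcd.eq_or_eq hd').resolve_left hdc
  rcases hcd.eq_or_eq he with rfl | rfl
  · exact hc
  · exact h1 ▸ hd

theorem IsInducedPath.eq_zero_of_mem (hR : IsRep A Finset.univ R) (hA : IsSignedMat A) {F : Set C}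
    {p : ℕ → V} {n : ℕ} (hp : IsInducedPath (coordGraph R F) p n) {i : ℕ} (hi : i + 2 ≤ n) {f : C}
    (hf : f ∈ F) : R f (p (i + 1)) = 0 := by
  obtain ⟨hne, c, hcF, hc, hc'⟩ := hp.adj i (by omega)
  obtain ⟨-, e, heF, he, he'⟩ := hp.adj (i + 1) (by omega)
  have hce : e ≠ c := by
    rintro rfl
    exact hp.far i (i + 2) le_rfl hi ⟨hp.ne _ _ (by omega) hi, e, heF, hc, he'⟩
  obtain ⟨d, hcd⟩ := hR.exists_isEdge hA (Finset.mem_univ (p (i + 1))) hc'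
  have h1 : e = d := (hcd.eq_or_eq he).resolve_left hce
  refine hcd.other f ?_ ?_
  · rintro rfl
    exact hcF hf
  · rintro rfl
    exact heF (h1 ▸ hf)

theorem IsMinBad.not_isInducedPath {lam : ℝ} (hR : IsRep A Finset.univ R) (hA : IsSignedMat A)
    (hM : IsMinBad A lam) {F : Set C} {p : ℕ → V} {L : ℕ} (hL : 2 < (2 - lam) * (L + 1))
    (hV : L + 1 < Fintype.card V) : ¬ IsInducedPath (coordGraph R F) p (L + 2) := by
  intro hp
  refine hM.not_path hA (p := fun i => p (i + 1)) (n := L)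
    (fun i hi => hp.ne_zero hR hA (by omega)) (fun i j hij hj => ?_)
    (fun i j hij hj => hp.ne _ _ (by omega) (by omega)) hL hV
  have hne := hp.ne (i + 1) (j + 1) (by omega) (by omega)
  refine hR.eq_zero_of_common hne fun c hc => ?_
  by_cases hcF : c ∈ F
  · exact hp.eq_zero_of_mem hR hA (by omega) hcF
  · by_contra hc'
    exact hp.far (i + 1) (j + 1) (by omega) (by omega) ⟨hne, c, hcF, hc, hc'⟩

/-- Averaging over many columns through `f` nearly isolates the coordinate `f`. -/
theorem IsRep.exists_average (hR : IsRep A Finset.univ R) (hA : IsSignedMat A) {f : C}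
    {E : Finset V} (hE : ∀ h ∈ E, R f h ≠ 0) {D : ℕ} (hD : E.card = D) (hD0 : 0 < D) :
    ∃ s : V → ℝ, (∀ h ∉ E, s h = 0) ∧ coordSum R s f = -1 ∧
      ∑ c, coordSum R s c ^ 2 ≤ 1 + 1 / D ∧ ∑ h, s h ^ 2 = 1 / D := by
  have hDr : (0 : ℝ) < D := by exact_mod_cast hD0
  have hsq : ∀ h ∈ E, (R f h : ℝ) ^ 2 = 1 := fun h hh => by
    exact_mod_cast (hR.sq_le_one hA (Finset.mem_univ h) f).resolve_left (hE h hh)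
  have hsum : ∀ φ : V → ℝ, ∑ h, (if h ∈ E then φ h else 0) = ∑ h ∈ E, φ h := fun φ => by
    rw [Finset.sum_ite_mem, Finset.univ_inter]
  have hs2 : ∑ h, (if h ∈ E then -(R f h : ℝ) / D else 0) ^ 2 = 1 / D := by
    simp only [ite_pow, ne_eq, OfNat.ofNat_ne_zero, not_false_eq_true, zero_pow]
    rw [hsum, Finset.sum_congr rfl (g := fun _ => 1 / (D : ℝ) ^ 2) fun h hh => by
      rw [div_pow, neg_sq, hsq h hh], Finset.sum_const, nsmul_eq_mul, hD]
    field_simp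
  refine ⟨fun h => if h ∈ E then -(R f h : ℝ) / D else 0, fun h hh => if_neg hh, ?_, ?_, hs2⟩
  · simp only [coordSum, mul_ite, mul_zero]
    rw [hsum, Finset.sum_congr rfl (g := fun _ => -1 / (D : ℝ)) fun h hh => by
      rw [← hsq h hh]; ring, Finset.sum_const, nsmul_eq_mul, hD]
    field_simp
  · have h1 := hR.qform_eq 1 fun h => if h ∈ E then -(R f h : ℝ) / D else 0
    have h2 : qform A 1 (fun h => if h ∈ E then -(R f h : ℝ) / D else 0) ≤ 1 := by
      rw [qform, hs2]
      have h3 : ∑ i, ∑ j, (A i j : ℝ) * (if i ∈ E then -(R f i : ℝ) / D else 0) *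
          (if j ∈ E then -(R f j : ℝ) / D else 0) ≤
          ∑ i ∈ E, ∑ j ∈ E, ((1 : ℝ) / D ^ 2 - if i = j then 1 / (D : ℝ) ^ 2 else 0) := by
        rw [← hsum]
        refine Finset.sum_le_sum fun i _ => ?_
        by_cases hi : i ∈ E
        · simp only [hi, if_true, mul_ite, mul_zero]
          rw [hsum]
          refine Finset.sum_le_sum fun j hj => ?_
          by_cases hij : i = j
          · subst hij
            simp [hA.diag]
          · rw [if_neg hij, sub_zero]
            have hi2 := hsq i hi
            have hj2 := hsq j hj
            have hl : (-1 : ℝ) ≤ A i j := by exact_mod_cast hA.lower i j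
            have hu : (A i j : ℝ) ≤ 1 := by exact_mod_cast hA.upper i j
            have h4 : (A i j : ℝ) * (R f i * R f j) ≤ 1 := by
              have h5 : ((R f i : ℝ) * R f j) ^ 2 = 1 := by rw [mul_pow, hi2, hj2, one_mul]
              rcases sq_eq_one_iff.1 h5 with h6 | h6 <;> rw [h6] <;> linarith
            calc (A i j : ℝ) * (-R f i / D) * (-R f j / D) = (A i j * (R f i * R f j)) / D ^ 2 := by
                  ring
              _ ≤ 1 / D ^ 2 := by gcongr
        · simp [hi]
      have h4 : ∑ i ∈ E, ∑ j ∈ E, ((1 : ℝ) / D ^ 2 - if i = j then 1 / (D : ℝ) ^ 2 else 0) =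
          1 - 1 / (D : ℝ) := by
        simp only [Finset.sum_sub_distrib, Finset.sum_const, nsmul_eq_mul, hD,
          Finset.sum_ite_eq, Finset.sum_ite_mem, Finset.inter_self]
        field_simp
      linarith
    rw [h1, hs2] at h2
    linarith

end

theorem SimpleGraph.Connected.card_le_of_not_isInducedPath {W : Type*} [Fintype W]
    {G : SimpleGraph W} (hG : G.Connected) {Δ n : ℕ} (hΔ : ∀ v, {u | G.Adj v u}.ncard ≤ Δ)
    (hn : ∀ p, ¬ IsInducedPath G p n) : Fintype.card W ≤ (Δ + 1) ^ n := by
  obtain ⟨r⟩ := hG.nonempty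
  refine le_trans ?_ (hG.card_distBall_le hΔ r n)
  rw [← Finset.card_univ]
  refine Finset.card_le_card fun v _ => ?_
  rw [SimpleGraph.mem_distBall]
  by_contra! hlt
  obtain ⟨p, -, hd, ha⟩ := hG.exists_geodesic r _ v rfl
  refine hn p (IsInducedPath.mono (.of_level (l := fun w => G.dist r w) (fun g h hgh => ?_) hd ha)
    hlt.le)
  have := hG.setDist_le_succ (Set.singleton_nonempty r) hgh.symm
  rwa [SimpleGraph.setDist_singleton, SimpleGraph.setDist_singleton] at this

/-- A shortest path from the set `S` to `v` has strictly increasing distance from `S`. -/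
theorem SimpleGraph.Connected.exists_path_setDist {W : Type*} {G : SimpleGraph W}
    (hG : G.Connected) {S : Set W} (hS : S.Nonempty) (v : W) :
    ∃ p : ℕ → W, p (G.setDist S v) = v ∧ (∀ i ≤ G.setDist S v, G.setDist S (p i) = i) ∧
      ∀ i < G.setDist S v, G.Adj (p i) (p (i + 1)) := by
  obtain ⟨s, hs, hd⟩ := SimpleGraph.exists_setDist_eq (G := G) hS v
  obtain ⟨p, hpv, hp, ha⟩ := hG.exists_geodesic s _ v hd
  refine ⟨p, hpv, fun i hi => le_antisymm ?_ ?_, ha⟩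
  · exact (SimpleGraph.setDist_le hs _).trans_eq (hp i hi)
  · have h : ∀ j, i + j ≤ G.setDist S v → G.setDist S (p (i + j)) ≤ G.setDist S (p i) + j := by
      intro j
      induction j with
      | zero => exact fun _ => le_rfl
      | succ j ih =>
        intro hj
        have h1 := hG.setDist_le_succ hS (ha (i + j) (by omega)).symm
        have h2 := ih (by omega)
        rw [← add_assoc]
        omega
    have h3 := h (G.setDist S v - i) (by omega)
    rw [Nat.add_sub_cancel' hi, hpv] at h3
    omega

section

variable {V C : Type*} [Fintype V] [DecidableEq V] [Fintype C] {A : V → V → ℤ} {R : C → V → ℤ}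

theorem IsRep.ncard_coordGraph_le (hR : IsRep A Finset.univ R) (hA : IsSignedMat A) {F : Set C}
    {D : ℕ} (hD : ∀ c ∉ F, (Finset.univ.filter fun h => R c h ≠ 0).card ≤ D) (v : V) :
    {u | (coordGraph R F).Adj v u}.ncard ≤ 2 * D := by
  classical
  obtain ⟨c, d, hcd⟩ := hR.exists_isEdge' hA (Finset.mem_univ v)
  let T : C → Finset V := fun c => if c ∈ F then ∅ else Finset.univ.filter fun h => R c h ≠ 0
  have hT : ∀ c, (T c).card ≤ D := fun c => by
    by_cases hc : c ∈ F
    · simp [T, hc]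
    · simpa only [T, if_neg hc] using hD c hc
  have hsub : {u | (coordGraph R F).Adj v u} ⊆ (T c ∪ T d : Finset V) := by
    rintro u ⟨-, e, heF, hev, heu⟩
    have : u ∈ T e := by simp [T, heF, heu]
    rcases hcd.eq_or_eq hev with rfl | rfl
    · exact Finset.mem_coe.2 (Finset.mem_union_left _ this)
    · exact Finset.mem_coe.2 (Finset.mem_union_right _ this)
  refine (Set.ncard_le_ncard hsub (Finset.finite_toSet _)).trans ?_
  rw [Set.ncard_coe_finset]
  have := Finset.card_union_le (T c) (T d)
  have h1 := hT c
  have h2 := hT d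
  omega

theorem IsMinBad.coordGraph_connected {lam : ℝ} (hR : IsRep A Finset.univ R) (hA : IsSignedMat A)
    (hM : IsMinBad A lam) : (coordGraph R ∅).Connected :=
  hM.connected_of hA.symm fun i j hij h0 => by
    obtain ⟨c, hc⟩ := hR.exists_common (Finset.mem_univ i) (Finset.mem_univ j) hij h0
    exact ⟨hij, c, Set.notMem_empty c, hc⟩

theorem sum_residue_sq_le [DecidableEq C] {r : C → ℝ} {f : C} {t : ℝ} (hf : r f = -1)
    (h : ∑ c, r c ^ 2 ≤ 1 + t) : ∑ c, (if c = f then 0 else r c) ^ 2 ≤ t := by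
  have h1 : ∀ c, (if c = f then 0 else r c) ^ 2 = r c ^ 2 - if c = f then 1 else 0 := by
    intro c
    by_cases hc : c = f
    · simp [hc, hf]
    · simp [hc]
  simp only [h1, Finset.sum_sub_distrib, Finset.sum_ite_eq', Finset.mem_univ, if_true]
  linarith

/-- At most one coordinate of a large minimal bad signed graph has high degree. -/
theorem IsMinBad.hub_unique {lam : ℝ} (hR : IsRep A Finset.univ R) (hA : IsSignedMat A)
    (hM : IsMinBad A lam) {L D : ℕ} (hlam : lam < 2) (hL : 2 < (2 - lam) * (L + 1))
    (hD : 8 * (3 - lam) < (2 - lam) * D) (hV : L + 2 + 2 * D < Fintype.card V) {f f' : C}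
    {E E' : Finset V} (hE : ∀ h ∈ E, R f h ≠ 0) (hE' : ∀ h ∈ E', R f' h ≠ 0) (hEc : E.card = D)
    (hEc' : E'.card = D) : f = f' := by
  classical
  by_contra hff
  have hDr : (0 : ℝ) < D := by
    by_contra! h
    nlinarith
  have hD0 : 0 < D := by exact_mod_cast hDr
  have hG := hM.coordGraph_connected hR hA
  set G := coordGraph R ∅ with hGdef
  set S : Set V := {h | R f h ≠ 0} with hS
  obtain ⟨e, he⟩ : E.Nonempty := Finset.card_pos.1 (by omega)
  obtain ⟨e', he'⟩ : E'.Nonempty := Finset.card_pos.1 (by omega)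
  have hSne : S.Nonempty := ⟨e, hE e he⟩
  obtain ⟨v, hv, hmin⟩ := Set.exists_min_image {h | R f' h ≠ 0} (fun h => G.setDist S h)
    (Set.toFinite _) ⟨e', hE' e' he'⟩
  obtain ⟨p, hpv, hlev, ha⟩ := hG.exists_path_setDist hSne v
  set n := G.setDist S v with hn
  have hind : IsInducedPath G p n :=
    .of_level (fun g h hgh => hG.setDist_le_succ hSne hgh.symm) hlev ha
  have hnL : n ≤ L + 1 := by
    by_contra! hlt
    exact hM.not_isInducedPath hR hA hL (by omega) (hind.mono (m := L + 2) (by omega))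
  have hf0 : ∀ i ≤ n, i ≠ 0 → R f (p i) = 0 := by
    intro i hi hi0
    by_contra h
    have h1 := hlev i hi
    rw [(hG.setDist_eq_zero hSne).2 h] at h1
    exact hi0 h1.symm
  have hf1 : R f (p 0) ≠ 0 := (hG.setDist_eq_zero hSne).1 (hlev 0 (Nat.zero_le _))
  have hf'0 : ∀ i ≤ n, i ≠ n → R f' (p i) = 0 := by
    intro i hi hin
    by_contra h
    have h1 := hmin (p i) h
    have h2 := hlev i hi
    omega
  have hadj : ∀ i < n, A (p i) (p (i + 1)) ≠ 0 := by
    intro i hi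
    by_cases hi2 : i + 2 ≤ n
    · exact hind.ne_zero hR hA hi2
    · have hin : i + 1 = n := by omega
      obtain ⟨hne, c, -, hc, hc'⟩ := ha i hi
      refine hR.ne_zero_of_common hA hne hc hc' fun d hdc hd => ?_
      by_contra hd'
      obtain ⟨d', hcd⟩ := hR.exists_isEdge hA (Finset.mem_univ _) hc'
      have h1 : d = d' := (hcd.eq_or_eq hd').resolve_left hdc
      have h2 : R f' (p (i + 1)) ≠ 0 := by
        rw [hin, hpv]
        exact hv
      have h3 := hf'0 i hi.le (by omega)
      rcases hcd.eq_or_eq h2 with rfl | rfl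
      · exact hc h3
      · exact hd (h1 ▸ h3)
  have hfar : ∀ i j, i + 2 ≤ j → j ≤ n → A (p i) (p j) = 0 := by
    intro i j hij hj
    have hne := hind.ne i j (by omega) hj
    refine hR.eq_zero_of_common hne fun c hc => ?_
    by_contra hc'
    exact hind.far i j hij hj ⟨hne, c, Set.notMem_empty c, hc, hc'⟩
  obtain ⟨x, hx1, hx0, hq⟩ := exists_qform_path hA hadj hfar hind.ne
  have hRsq : ∀ c h, R c h ≠ 0 → (R c h : ℝ) ^ 2 = 1 := fun c h hh => by
    exact_mod_cast (hR.sq_le_one hA (Finset.mem_univ h) c).resolve_left hh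
  have hsumx : ∑ h, x h ^ 2 = n + 1 := by
    have h1 := qform_add_lam A 0 1 x
    rw [hq, hq] at h1
    linarith
  have hcs : ∑ c, coordSum R x c ^ 2 = 2 := by
    have h1 := hR.qform_eq 2 x
    rw [hq] at h1
    linarith
  have hcoord : ∀ c i, i ≤ n → R c (p i) ≠ 0 → (∀ j ≤ n, j ≠ i → R c (p j) = 0) →
      coordSum R x c ^ 2 = 1 := by
    intro c i hi hci hcj
    rw [coordSum, Finset.sum_eq_single (p i), mul_pow, hRsq c _ hci, hx1 i hi, one_mul]
    · intro h _ hne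
      by_cases hh : ∃ j ≤ n, p j = h
      · obtain ⟨j, hj, rfl⟩ := hh
        rw [hcj j hj (by rintro rfl; exact hne rfl)]
        simp
      · push Not at hh
        rw [hx0 h hh, mul_zero]
    · exact fun h => absurd (Finset.mem_univ _) h
  have hcf := hcoord f 0 (Nat.zero_le _) hf1 hf0
  have hcf' := hcoord f' n le_rfl (by rw [hpv]; exact hv) hf'0
  have hc0 : ∀ c, c ≠ f → c ≠ f' → coordSum R x c = 0 := by
    intro c hc hc'
    have h1 : ∑ d ∈ {f, f', c}, coordSum R x d ^ 2 ≤ 2 := by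
      rw [← hcs]
      exact Finset.sum_le_univ_sum_of_nonneg fun d => sq_nonneg _
    rw [Finset.sum_insert (by simp [hff, hc.symm]), Finset.sum_pair hc'.symm, hcf, hcf'] at h1
    have h2 : coordSum R x c ^ 2 ≤ 0 := by linarith
    exact pow_eq_zero_iff two_ne_zero |>.1 (le_antisymm h2 (sq_nonneg _))
  obtain ⟨s, hs0, hsf, hsc, hss⟩ := hR.exists_average hA hE hEc hD0
  obtain ⟨s', hs0', hsf', hsc', hss'⟩ := hR.exists_average hA hE' hEc' hD0
  set a := coordSum R x f with haf
  set b := coordSum R x f' with hbf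
  have hneg := hM.nonneg_of_support (x := fun h => (x h + a * s h) + b * s' h)
    (S := (Finset.range (n + 1)).image p ∪ E ∪ E') (fun h hh => ?_) ?_
  · rw [hR.qform_eq] at hneg
    have h1 : ∀ c, coordSum R (fun h => (x h + a * s h) + b * s' h) c ^ 2 ≤
        2 * (if c = f then 0 else coordSum R s c) ^ 2 +
        2 * (if c = f' then 0 else coordSum R s' c) ^ 2 := by
      intro c
      have e1 : coordSum R (fun h => (x h + a * s h) + b * s' h) c =
          a * (if c = f then 0 else coordSum R s c) +
          b * (if c = f' then 0 else coordSum R s' c) := by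
        rw [coordSum_add_smul, coordSum_add_smul]
        by_cases hc : c = f
        · subst hc
          rw [if_pos rfl, if_neg hff, hsf]
          ring
        · by_cases hc' : c = f'
          · subst hc'
            rw [if_neg hc, if_pos rfl, hsf']
            ring
          · rw [if_neg hc, if_neg hc', hc0 c hc hc', zero_add]
      rw [e1]
      generalize (if c = f then 0 else coordSum R s c) = u
      generalize (if c = f' then 0 else coordSum R s' c) = w
      nlinarith [sq_nonneg (a * u - b * w)]
    have h2 := Finset.sum_le_sum fun c (_ : c ∈ Finset.univ) => h1 c
    rw [Finset.sum_add_distrib, ← Finset.mul_sum, ← Finset.mul_sum] at h2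
    have h3 := sum_residue_sq_le hsf hsc
    have h4 := sum_residue_sq_le hsf' hsc'
    have h5 : ∀ h, 1 / 2 * x h ^ 2 - (2 * s h ^ 2 + 2 * s' h ^ 2) ≤
        ((x h + a * s h) + b * s' h) ^ 2 := by
      intro h
      nlinarith [sq_nonneg (a * s h - b * s' h), sq_nonneg (x h + 2 * (a * s h + b * s' h))]
    have h6 := Finset.sum_le_sum fun h (_ : h ∈ Finset.univ) => h5 h
    rw [Finset.sum_sub_distrib, Finset.sum_add_distrib, ← Finset.mul_sum, ← Finset.mul_sum,
      ← Finset.mul_sum, hsumx, hss, hss'] at h6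
    have h7 : (2 - lam) * (1 / 2 - 4 * (1 / D)) ≤
        (2 - lam) * ∑ h, ((x h + a * s h) + b * s' h) ^ 2 := by
      refine mul_le_mul_of_nonneg_left ?_ (by linarith)
      have : (0 : ℝ) ≤ n := Nat.cast_nonneg n
      linarith
    have h8 : 8 * (3 - lam) * (1 / D) < 2 - lam := by
      rw [mul_one_div, div_lt_iff₀ hDr]
      exact hD
    linarith
  · simp only [Finset.mem_union, not_or] at hh
    rw [hs0 h hh.1.2, hs0' h hh.2, hx0 h fun i hi e => hh.1.1 (e ▸ Finset.mem_image_of_mem _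
      (Finset.mem_range.2 (by omega)))]
    ring
  · have h1 := Finset.card_union_le ((Finset.range (n + 1)).image p ∪ E) E'
    have h2 := Finset.card_union_le ((Finset.range (n + 1)).image p) E
    have h3 := Finset.card_image_le (s := Finset.range (n + 1)) (f := p)
    rw [Finset.card_range] at h3
    omega

end

section

variable {V C : Type*} [Fintype V] [DecidableEq V] [Fintype C] {A : V → V → ℤ} {R : C → V → ℤ}

/-- A vector that is bad outside the coordinate `f` can be corrected using columns through `f`. -/
theorem IsRep.exists_neg_of_gap [DecidableEq C] (hR : IsRep A Finset.univ R) (hA : IsSignedMat A)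
    {lam θ η m : ℝ} (hlam : lam < 2) (hη : 0 < η) (hηθ : 4 * (2 - lam) * η = θ)
    {f : C} {E : Finset V} (hE : ∀ h ∈ E, R f h ≠ 0) {D : ℕ} (hED : E.card = D) (hD0 : 0 < D)
    (hD : 2 * m * ((1 + 1 / η) + (2 - lam) / η) < θ * D) {x : V → ℝ} (hx0 : 0 < ∑ h, x h ^ 2)
    (hx : ∑ c ∈ Finset.univ.erase f, coordSum R x c ^ 2 ≤ (2 - lam - θ) * ∑ h, x h ^ 2)
    (hm : coordSum R x f ^ 2 ≤ m * ∑ h, x h ^ 2) :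
    ∃ x' : V → ℝ, qform A lam x' < 0 ∧ ∀ v ∉ E, x v = 0 → x' v = 0 := by
  obtain ⟨s, hsE, hsf, hsq, hs2⟩ := hR.exists_average hA hE hED hD0
  have hDr : (0 : ℝ) < D := by exact_mod_cast hD0
  set l := coordSum R x f with hl
  set X := ∑ h, x h ^ 2 with hX
  have hα : 0 < 2 - lam := by linarith
  refine ⟨fun h => x h + l * s h, ?_, fun v hv hxv => by simp [hsE v hv, hxv]⟩
  have hyoung : ∀ a b : ℝ, (a + b) ^ 2 ≤ (1 + η) * a ^ 2 + (1 + 1 / η) * b ^ 2 := fun a b => by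
    have h1 : (1 + η) * a ^ 2 + (1 + 1 / η) * b ^ 2 - (a + b) ^ 2 = (η * a - b) ^ 2 / η := by
      field_simp
      ring
    have h2 : 0 ≤ (η * a - b) ^ 2 / η := by positivity
    linarith
  have hyoung' : ∀ a b : ℝ, (1 - η) * a ^ 2 - 1 / η * b ^ 2 ≤ (a + b) ^ 2 := fun a b => by
    have h1 : (a + b) ^ 2 - ((1 - η) * a ^ 2 - 1 / η * b ^ 2) = b ^ 2 + (η * a + b) ^ 2 / η := by
      field_simp
      ring
    have h2 : 0 ≤ (η * a + b) ^ 2 / η := by positivity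
    nlinarith [sq_nonneg b]
  have hres : ∑ c ∈ Finset.univ.erase f, coordSum R s c ^ 2 ≤ 1 / D := by
    have h1 := Finset.add_sum_erase Finset.univ (fun c => coordSum R s c ^ 2) (Finset.mem_univ f)
    simp only [hsf] at h1
    linarith
  have hcs : ∑ c, coordSum R (fun h => x h + l * s h) c ^ 2 ≤
      (1 + η) * ((2 - lam - θ) * X) + (1 + 1 / η) * (l ^ 2 * (1 / D)) := by
    rw [← Finset.add_sum_erase Finset.univ _ (Finset.mem_univ f), coordSum_add_smul, hsf, ← hl]
    have h1 : ∑ c ∈ Finset.univ.erase f, coordSum R (fun h => x h + l * s h) c ^ 2 ≤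
        (1 + η) * ∑ c ∈ Finset.univ.erase f, coordSum R x c ^ 2 +
          (1 + 1 / η) * (l ^ 2 * ∑ c ∈ Finset.univ.erase f, coordSum R s c ^ 2) := by
      simp only [Finset.mul_sum]
      rw [← Finset.sum_add_distrib]
      refine Finset.sum_le_sum fun c _ => ?_
      rw [coordSum_add_smul]
      refine (hyoung _ _).trans_eq (by ring)
    refine le_trans ?_ (h1.trans (by gcongr))
    nlinarith
  have hsqx : (1 - η) * X - 1 / η * (l ^ 2 * (1 / D)) ≤ ∑ h, (x h + l * s h) ^ 2 := by
    rw [← hs2, hX]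
    simp only [Finset.mul_sum]
    rw [← Finset.sum_sub_distrib]
    refine Finset.sum_le_sum fun h _ => le_trans (le_of_eq (by ring)) (hyoung' _ _)
  rw [hR.qform_eq]
  set K := (1 + 1 / η) + (2 - lam) / η with hK
  have hK0 : 0 < K := by positivity
  have h1 : K * (l ^ 2 * (1 / D)) < θ / 2 * X := by
    have h2 : K * (l ^ 2 * (1 / D)) ≤ K * (m * X * (1 / D)) := by gcongr
    have h3 : K * (m * X * (1 / D)) = (2 * m * K) * X / (2 * D) := by
      field_simp
    have h4 : (2 * m * K) * X / (2 * D) < θ * D * X / (2 * D) := by gcongr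
    have h5 : θ * D * X / (2 * D) = θ / 2 * X := by field_simp
    linarith
  have h2 := mul_le_mul_of_nonneg_left hsqx hα.le
  have h3 : (1 + η) * ((2 - lam - θ) * X) - (2 - lam) * (1 - η) * X ≤ - (θ / 2 * X) := by
    have : 0 < θ * η * X := by
      have : 0 < θ := by rw [← hηθ]; positivity
      positivity
    have h6 : (2 - lam) * η * X = θ / 4 * X := by rw [← hηθ]; ring
    nlinarith
  have h4 : K * (l ^ 2 * (1 / D)) = (1 + 1 / η) * (l ^ 2 * (1 / D)) +
    (2 - lam) * (1 / η * (l ^ 2 * (1 / D))) := by rw [hK]; ring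
  nlinarith

theorem IsMinBad.card_le_of_hub [DecidableEq C] {lam : ℝ} (hR : IsRep A Finset.univ R)
    (hA : IsSignedMat A) (hM : IsMinBad A lam) {L D : ℕ} (hL : 2 < (2 - lam) * (L + 1))
    (hV : L + 1 < Fintype.card V) {f : C} (hf : ∃ h, R f h ≠ 0)
    (hD : ∀ c ∉ ({f} : Set C), (Finset.univ.filter fun h => R c h ≠ 0).card ≤ D) :
    Fintype.card V ≤
      (Finset.univ.filter fun h => R f h ≠ 0).card * (2 * D + 1) ^ (L + 1) := by
  classical
  have hH := hM.coordGraph_connected hR hA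
  set H := coordGraph R (∅ : Set C) with hHdef
  set E : Finset V := Finset.univ.filter fun h => R f h ≠ 0 with hE
  have hmem : ∀ v, v ∈ E ↔ R f v ≠ 0 := fun v => by simp [hE]
  have hEne : (E : Set V).Nonempty := by
    obtain ⟨h, hh⟩ := hf
    exact ⟨h, (hmem h).2 hh⟩
  have hle : coordGraph R ({f} : Set C) ≤ H := fun g h ⟨hne, c, _, hc⟩ =>
    ⟨hne, c, Set.notMem_empty c, hc⟩
  have hadj : ∀ g h, H.Adj g h → h ∉ E → (coordGraph R ({f} : Set C)).Adj g h :=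
    fun g h ⟨hne, c, _, hc⟩ hh => ⟨hne, c, fun hcf => hh ((hmem h).2 (by
      rw [Set.mem_singleton_iff] at hcf
      exact hcf ▸ hc.2)), hc⟩
  have hdist : ∀ v, H.setDist E v ≤ L + 1 := fun v => by
    by_contra! hlt
    obtain ⟨p, hpv, hp, ha⟩ := hH.exists_path_setDist hEne v
    have hind : IsInducedPath (coordGraph R ({f} : Set C)) p (H.setDist E v) := by
      refine .of_level (l := H.setDist E)
        (fun g h hgh => hH.setDist_le_succ hEne (hle hgh).symm) hp fun i hi => ?_
      refine hadj _ _ (ha i hi) fun hmem' => ?_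
      have := (hH.setDist_eq_zero hEne).2 (Finset.mem_coe.2 hmem')
      rw [hp (i + 1) hi] at this
      omega
    exact hM.not_isInducedPath hR hA hL hV (hind.mono (by omega : L + 2 ≤ _))
  have hcard : ∀ n, (Finset.univ.filter fun v => H.setDist E v ≤ n).card ≤
      E.card * (2 * D + 1) ^ n := fun n => by
    induction n with
    | zero =>
      rw [pow_zero, mul_one]
      refine Finset.card_le_card fun v hv => ?_
      exact Finset.mem_coe.1
        ((hH.setDist_eq_zero hEne).1 (Nat.le_zero.1 (Finset.mem_filter.1 hv).2))
    | succ n ih =>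
      have hsub : (Finset.univ.filter fun v => H.setDist E v ≤ n + 1) ⊆
          (Finset.univ.filter fun v => H.setDist E v ≤ n).biUnion fun u =>
            insert u (Finset.univ.filter fun w => (coordGraph R ({f} : Set C)).Adj u w) := by
        intro v hv
        have hv := (Finset.mem_filter.1 hv).2
        rw [Finset.mem_biUnion]
        by_cases hvn : H.setDist E v ≤ n
        · exact ⟨v, by simpa using hvn, Finset.mem_insert_self _ _⟩
        · obtain ⟨g, hg, hd⟩ := hH.exists_adj_setDist hEne (h := v) (by omega)
          have hvE : v ∉ E := fun h => by
            have := (hH.setDist_eq_zero hEne).2 (Finset.mem_coe.2 h)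
            omega
          refine ⟨g, by simpa using (by omega : H.setDist E g ≤ n), Finset.mem_insert_of_mem ?_⟩
          simpa using hadj g v hg hvE
      refine (Finset.card_le_card hsub).trans ?_
      refine (Finset.card_biUnion_le_card_mul _ _ (2 * D + 1) fun u _ => ?_).trans ?_
      · refine (Finset.card_insert_le _ _).trans (Nat.succ_le_succ ?_)
        rw [← Set.ncard_coe_finset, Finset.coe_filter]
        simpa using hR.ncard_coordGraph_le hA hD u
      · rw [pow_succ, ← mul_assoc]
        exact Nat.mul_le_mul_right _ ih
  have := hcard (L + 1)
  rwa [Finset.filter_true_of_mem fun v _ => hdist v, Finset.card_univ] at this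

end

section

variable {V C : Type} [Fintype V] [DecidableEq V] [Fintype C] {A : V → V → ℤ} {R : C → V → ℤ}

/-- Some vector with small support is bad outside the coordinate `f`, with a uniform gap. -/
theorem IsMinBad.exists_gap [DecidableEq C] {lam θ : ℝ} (hR : IsRep A Finset.univ R)
    (hA : IsSignedMat A) (hM : IsMinBad A lam) {L D m : ℕ} (hL : 2 < (2 - lam) * (L + 1))
    (hV : L + 1 < Fintype.card V) {f : C}
    (hD : ∀ c ∉ ({f} : Set C), (Finset.univ.filter fun h => R c h ≠ 0).card ≤ D)
    (hm : (2 * D + 1) ^ (L + 2) ≤ m)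
    (hθ : ∀ {W : Type} [Fintype W] (G : W → W → ℤ), Fintype.card W ≤ m → (∀ g h, -3 ≤ G g h) →
      (∀ g h, G g h ≤ 3) → (∃ x, qform G (-(2 - lam)) x < 0) →
      ∃ x : W → ℝ, x ≠ 0 ∧ qform G (-(2 - lam - θ)) x ≤ 0) :
    ∃ (x : V → ℝ) (S : Finset V), S.card ≤ m ∧ (∀ v ∉ S, x v = 0) ∧ 0 < ∑ h, x h ^ 2 ∧
      ∑ c ∈ Finset.univ.erase f, coordSum R x c ^ 2 ≤ (2 - lam - θ) * ∑ h, x h ^ 2 := by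
  let G : V → V → ℤ := fun g h => ∑ c ∈ Finset.univ.erase f, R c g * R c h
  have hq : ∀ (t : ℝ) x, qform G (-t) x =
      ∑ c ∈ Finset.univ.erase f, coordSum R x c ^ 2 - t * ∑ h, x h ^ 2 := fun t x => by
    rw [sum_coordSum_sq, qform]
    ring
  have hG : ∀ g h, G g h = (A g h + if g = h then 2 else 0) - R f g * R f h := fun g h => by
    rw [← hR g (Finset.mem_univ _) h (Finset.mem_univ _),
      ← Finset.add_sum_erase Finset.univ _ (Finset.mem_univ f)]
    ring
  have hR1 : ∀ g, -1 ≤ R f g ∧ R f g ≤ 1 := fun g => by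
    rcases hR.sq_le_one hA (Finset.mem_univ g) f with h | h
    · simp [h]
    · rcases sq_eq_one_iff.1 h with h | h <;> simp [h]
  have hG3 : ∀ g h, -3 ≤ G g h ∧ G g h ≤ 3 := fun g h => by
    rw [hG]
    have h1 := hR1 g
    have h2 := hR1 h
    have h3 := hA.lower g h
    have h4 := hA.upper g h
    by_cases hgh : g = h
    · subst hgh
      rw [hA.diag, if_pos rfl]
      constructor <;> nlinarith
    · rw [if_neg hgh]
      constructor <;> nlinarith
  have hGs : ∀ g h, G g h = G h g := fun g h =>
    Finset.sum_congr rfl fun c _ => mul_comm _ _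
  have hbad : ∃ x, qform G (-(2 - lam)) x < 0 := by
    obtain ⟨x, hx⟩ := hM.bad
    refine ⟨x, ?_⟩
    rw [hR.qform_eq, ← Finset.add_sum_erase Finset.univ _ (Finset.mem_univ f)] at hx
    rw [hq]
    nlinarith [sq_nonneg (coordSum R x f)]
  obtain ⟨S, hS⟩ := exists_isMinBad hbad
  have hconn : ((coordGraph R ({f} : Set C)).comap (Subtype.val : S → V)).Connected := by
    refine hS.connected_of (fun i j => hGs i j) fun i j hij h0 => ?_
    obtain ⟨c, hc, hc0⟩ := Finset.exists_ne_zero_of_sum_ne_zero h0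
    exact ⟨fun h => hij (Subtype.ext h), c, Finset.ne_of_mem_erase hc, left_ne_zero_of_mul hc0,
      right_ne_zero_of_mul hc0⟩
  have hcard : Fintype.card S ≤ m := by
    refine (hconn.card_le_of_not_isInducedPath (Δ := 2 * D) (n := L + 2) (fun v => ?_)
      fun p hp => ?_).trans hm
    · refine le_trans ?_ (hR.ncard_coordGraph_le hA hD v)
      rw [← Set.ncard_image_of_injective _ Subtype.val_injective]
      refine Set.ncard_le_ncard ?_ (Set.toFinite _)
      rintro _ ⟨u, hu, rfl⟩
      exact hu
    · exact hM.not_isInducedPath hR hA hL hV (p := fun i => (p i : V))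
        ⟨hp.adj, fun i j hij hj h => hp.ne i j hij hj (Subtype.ext h), hp.far⟩
  obtain ⟨y, hy0, hy⟩ := hθ (fun i j : S => G i j) hcard (fun _ _ => (hG3 _ _).1)
    (fun _ _ => (hG3 _ _).2) hS.bad
  refine ⟨Function.extend Subtype.val y 0, S, by simpa using hcard, fun v hv => ?_, ?_, ?_⟩
  · rw [Function.extend_apply' _ _ _ (by rintro ⟨a, rfl⟩; exact hv a.2)]
    rfl
  · rw [sum_sq_extend Subtype.val_injective]
    refine lt_of_le_of_ne (Finset.sum_nonneg fun i _ => sq_nonneg _) fun h => hy0 ?_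
    funext i
    exact pow_eq_zero_iff two_ne_zero |>.1
      ((Finset.sum_eq_zero_iff_of_nonneg fun i _ => sq_nonneg _).1 h.symm i (Finset.mem_univ i))
  · rw [← qform_extend G _ Subtype.val_injective, hq] at hy
    linarith

theorem IsRep.coordSum_sq_le (hR : IsRep A Finset.univ R) (hA : IsSignedMat A) {x : V → ℝ}
    {S : Finset V} (hS : ∀ v ∉ S, x v = 0) (f : C) :
    coordSum R x f ^ 2 ≤ S.card * ∑ h, x h ^ 2 := by
  have h1 : coordSum R x f = ∑ h ∈ S, (R f h : ℝ) * x h :=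
    (Finset.sum_subset (Finset.subset_univ S) fun v _ hv => by simp [hS v hv]).symm
  have h2 : ∑ h ∈ S, (R f h : ℝ) ^ 2 ≤ S.card := by
    rw [Finset.card_eq_sum_ones, Nat.cast_sum]
    refine Finset.sum_le_sum fun h _ => ?_
    rcases hR.sq_le_one hA (Finset.mem_univ h) f with h | h
    · simp [h]
    · exact_mod_cast h.le
  have h3 : ∑ h ∈ S, x h ^ 2 ≤ ∑ h, x h ^ 2 :=
    Finset.sum_le_sum_of_subset_of_nonneg (Finset.subset_univ _) fun _ _ _ => sq_nonneg _
  rw [h1]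
  exact (Finset.sum_mul_sq_le_sq_mul_sq _ _ _).trans (mul_le_mul h2 h3
    (Finset.sum_nonneg fun _ _ => sq_nonneg _) (Nat.cast_nonneg _))

end

theorem exists_isMinBad_card_bound {lam : ℝ} (hlam : lam < 2) :
    ∃ N : ℕ, ∀ {V : Type} [Fintype V] [DecidableEq V] (A : V → V → ℤ), IsSignedMat A →
      IsMinBad A lam → DRep A Finset.univ → Fintype.card V ≤ N := by
  classical
  have hα : 0 < 2 - lam := by linarith
  obtain ⟨L, hL⟩ := exists_nat_gt (2 / (2 - lam))
  obtain ⟨D, hD⟩ := exists_nat_gt (8 * (3 - lam) / (2 - lam))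
  have hL' : 2 < (2 - lam) * (L + 1) := by
    rw [div_lt_iff₀ hα] at hL
    nlinarith
  rw [div_lt_iff₀ hα, mul_comm (D : ℝ)] at hD
  set m := (2 * D + 1) ^ (L + 2) with hm
  obtain ⟨θ, hθ0, hθ⟩ := exists_uniform_gap m (2 - lam)
  set η := θ / (4 * (2 - lam)) with hη
  have hη0 : 0 < η := by positivity
  obtain ⟨D', hD'⟩ := exists_nat_gt (2 * m * ((1 + 1 / η) + (2 - lam) / η) / θ)
  rw [div_lt_iff₀ hθ0, mul_comm (D' : ℝ)] at hD'
  have hD'0 : 0 < D' := by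
    rw [← Nat.cast_pos (α := ℝ)]
    refine pos_of_mul_pos_right (lt_of_le_of_lt ?_ hD') hθ0.le
    positivity
  refine ⟨L + 2 + 2 * D + m + D' * (2 * D + 1) ^ (L + 1) + D', ?_⟩
  intro V _ _ A hA hM ⟨C, _, R, hR⟩
  by_contra! hlt
  have hV : L + 1 < Fintype.card V := by omega
  let T : C → Finset V := fun c => Finset.univ.filter fun h => R c h ≠ 0
  have hT : ∀ c, ∀ h ∈ T c, R c h ≠ 0 := fun c h hh => (Finset.mem_filter.1 hh).2
  obtain ⟨f, hf⟩ : ∃ f, D ≤ (T f).card := by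
    by_contra! hno
    have h1 := (hM.coordGraph_connected hR hA).card_le_of_not_isInducedPath
      (hR.ncard_coordGraph_le hA fun c _ => (hno c).le)
      (fun p => hM.not_isInducedPath hR hA hL' hV)
    omega
  have hsmall : ∀ c ∉ ({f} : Set C), (T c).card ≤ D := fun c hc => by
    by_contra! hcD
    obtain ⟨E, hE, hEc⟩ := Finset.exists_subset_card_eq hf
    obtain ⟨E', hE', hEc'⟩ := Finset.exists_subset_card_eq hcD.le
    exact hc (hM.hub_unique hR hA hlam hL' hD (by omega) (fun h hh => hT c h (hE' hh))
      (fun h hh => hT f h (hE hh)) hEc' hEc)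
  have hD0 : 0 < D := by
    rw [← Nat.cast_pos (α := ℝ)]
    exact pos_of_mul_pos_right (lt_trans (by linarith) hD) hα.le
  obtain ⟨h₀, hh₀⟩ := Finset.card_pos.1 (hD0.trans_le hf)
  have hbig : D' ≤ (T f).card := by
    by_contra! hlt'
    have h1 := hM.card_le_of_hub hR hA hL' hV ⟨h₀, hT f h₀ hh₀⟩ hsmall
    have h2 := Nat.mul_le_mul_right ((2 * D + 1) ^ (L + 1)) hlt'.le
    have h3 := h1.trans h2
    omega
  obtain ⟨E, hE, hEc⟩ := Finset.exists_subset_card_eq hbig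
  obtain ⟨x, S, hSm, hxS, hx0, hx⟩ := hM.exists_gap hR hA hL' hV hsmall hm.ge hθ
  have hxm : coordSum R x f ^ 2 ≤ (m : ℝ) * ∑ h, x h ^ 2 :=
    (hR.coordSum_sq_le hA hxS f).trans
      (mul_le_mul_of_nonneg_right (by exact_mod_cast hSm) hx0.le)
  obtain ⟨x', hx', hsupp⟩ := hR.exists_neg_of_gap hA hlam hη0 (by rw [hη]; field_simp)
    (fun h hh => hT f h (hE hh)) hEc hD'0 hD' hx0 hx hxm
  refine absurd (hM.nonneg_of_support (S := S ∪ E) (x := x') (fun v hv => ?_) ?_) (not_le.2 hx')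
  · rw [Finset.mem_union, not_or] at hv
    exact hsupp v hv.2 (hxS v hv.1)
  · have := Finset.card_union_le S E
    omega

theorem exists_bound_of_lt {σ lam : ℝ} (hσ : 1 < σ) (hσ6 : σ ^ 6 = σ ^ 2 + 1)
    (h : lam < σ + 1 / σ) : ∃ N : ℕ, ∀ {V : Type} [Fintype V] [DecidableEq V] (A : V → V → ℤ),
      IsSignedMat A → IsMinBad A lam → Fintype.card V ≤ N := by
  obtain ⟨δ, C₀, κ, K, n₀, hδ, hP, hK⟩ := exists_params hσ hσ6 h
  obtain ⟨N₁, h₁⟩ := exists_dRep_bound hP hK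
  have h₂ : ∃ N : ℕ, ∀ {V : Type} [Fintype V] [DecidableEq V] (A : V → V → ℤ), IsSignedMat A →
      IsMinBad A lam → DRep A Finset.univ → Fintype.card V ≤ N := by
    rcases lt_or_ge lam 2 with hlam | hlam
    · exact exists_isMinBad_card_bound hlam
    · refine ⟨0, fun {V} _ _ A _ hM ⟨C, _, R, hR⟩ => ?_⟩
      obtain ⟨x, hx⟩ := hM.bad
      rw [hR.qform_eq] at hx
      have h1 : 0 ≤ ∑ c, coordSum R x c ^ 2 := Finset.sum_nonneg fun _ _ => sq_nonneg _
      have h2 : 0 ≤ ∑ v, x v ^ 2 := Finset.sum_nonneg fun _ _ => sq_nonneg _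
      nlinarith
  obtain ⟨N₂, h₂⟩ := h₂
  obtain ⟨N₃, h₃⟩ := exists_nat_gt (lam / (2 + δ - lam))
  rw [div_lt_iff₀ (by linarith)] at h₃
  refine ⟨N₁ + N₂ + N₃ + 2, fun {V} _ _ A hA hM => ?_⟩
  by_contra! hlt
  have hgood : ∀ x, 0 ≤ qform A (2 + δ) x := by
    refine hM.good hA (by omega) ?_
    have h4 : (N₃ : ℝ) + 2 ≤ Fintype.card V := by exact_mod_cast (by omega)
    nlinarith
  have := h₂ A hA hM (h₁ A hA hgood (hM.connected hA) (by omega))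
  omega

theorem hasFFSC_of_lt {σ lam : ℝ} (hσ : 1 < σ) (hσ6 : σ ^ 6 = σ ^ 2 + 1)
    (h : lam < σ + 1 / σ) :
    HasFFSC {G | IsSignedGraph G} {G | IsSignedGraph G ∧ -lam ≤ sgLam1 G} := by
  rcases lt_or_ge lam 0 with hlam | hlam
  · exact hasFFSC_of_neg hlam
  obtain ⟨N, hN⟩ := exists_bound_of_lt hσ hσ6 h
  refine hasFFSC_of_bounded_support hlam N fun n A hA hbad => ?_
  obtain ⟨S, hS⟩ := exists_isMinBad hbad
  have hcard := hN _ (hA.comp ((↑) : S → Fin n)) hS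
  obtain ⟨y, hy⟩ := hS.bad
  refine ⟨Function.extend Subtype.val y 0, by rwa [qform_extend A lam Subtype.val_injective], ?_⟩
  refine le_trans (Finset.card_le_card fun v hv => ?_) ((Fintype.card_coe S).symm.trans_le hcard)
  by_contra hvS
  refine (Finset.mem_filter.1 hv).2 ?_
  rw [Function.extend_apply' _ _ _ (by rintro ⟨a, rfl⟩; exact hvS a.2)]
  rfl

theorem one_lt_of_cube_eq {ρ : ℝ} (hρ : ρ ^ 3 = ρ + 1) : 1 < ρ := by
  by_contra! hle
  rcases le_or_gt ρ (-1) with h | h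
  · nlinarith [mul_nonneg (sub_nonneg.2 hle) (sq_nonneg ρ)]
  · nlinarith [sq_nonneg ρ, mul_nonneg (sub_nonneg.2 hle) (sq_nonneg ρ), sq_nonneg (ρ + 1 / 2)]

/-- The family `𝒢(λ)` of signed graphs with smallest eigenvalue at least `-λ` has a
finite forbidden subgraph characterization within the class of all signed graphs if and
only if `λ < λ*`, where `λ* = √ρ + 1/√ρ` and `ρ` is the unique real root of `x³ = x + 1`. -/
theorem ffsc_signed_iff (lam : ℝ) (ρ : ℝ) (hρ : ρ ^ 3 = ρ + 1)
    (lamStar : ℝ) (hlamStar : lamStar = Real.sqrt ρ + (Real.sqrt ρ)⁻¹) :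
    HasFFSC {G | IsSignedGraph G} {G | IsSignedGraph G ∧ -lam ≤ sgLam1 G} ↔
      lam < lamStar := by
  have hρ1 := one_lt_of_cube_eq hρ
  have hσ : 1 < Real.sqrt ρ := Real.lt_sqrt_of_sq_lt (by linarith)
  have hσ6 : Real.sqrt ρ ^ 6 = Real.sqrt ρ ^ 2 + 1 := by
    rw [show Real.sqrt ρ ^ 6 = (Real.sqrt ρ ^ 2) ^ 3 by ring, Real.sq_sqrt (by linarith), hρ]
  rw [← one_div] at hlamStar
  refine ⟨fun h => ?_, fun h => hasFFSC_of_lt hσ hσ6 (hlamStar ▸ h)⟩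
  by_contra! hle
  rw [hlamStar] at hle
  have h0 : 0 ≤ lam := le_trans (by positivity) hle
  exact not_hasFFSC_of_rightLimit h0 (rightLimit_of_ge hσ hσ6 hle) h
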